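/- Suppose D_P is a WB-domain, i.e., every boundary point q = (q',q_n) ∈ ∂D_P with q' ≠ 0 is a strongly pseudoconvex boundary point: writing ρ(z) = |z_n|² + P(z') − 1, for every t ∈ ℂⁿ \ {0} that is complex-tangent to ∂D_P at q (i.e., Dρ(q)(t) = 0 and Dρ(q)(i t) = 0, where Dρ(q) is the real Fréchet derivative of ρ at q) the single-variable function w ↦ ρ(q + w t), w ∈ ℂ, has strictly positive Laplacian at w = 0. Then D_P is holomorphically homogeneous regular: inf_{z ∈ D_P} σ_{D_P}(z) > 0. -/

import Mathlib

open Complex Metric Set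

noncomputable section

/-- `ℂⁿ` with `n = N + 1`, carrying the Euclidean norm; points are written `z = (z', z_n)`
with `z' ∈ ℂᴺ` the first `N` coordinates and `z_n` the last coordinate. -/
abbrev CSp (N : ℕ) : Type := EuclideanSpace ℂ (Fin (N + 1))

variable {N : ℕ}

/-- The last coordinate `z_n` of `z = (z', z_n)`. -/
def lastC (z : CSp N) : ℂ := z (Fin.last N)

/-- The first `N` coordinates `z'` of `z = (z', z_n)`. -/
def initC (z : CSp N) : Fin N → ℂ := fun j => z j.castSucc

/-- The point `(z', z_n) ∈ ℂⁿ`. -/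
def mkPt (z' : Fin N → ℂ) (zn : ℂ) : CSp N := WithLp.toLp 2 (Fin.snoc z' zn : Fin (N + 1) → ℂ)

/-- The weight `wt(K) = Σ_j k_j / (2 m_j)` of a multi-index `K` with respect to
`Λ = (1/m₁, …, 1/m_N)`. -/
def wt (m : Fin N → ℕ) (K : Fin N → ℕ) : ℝ := ∑ j, (K j : ℝ) / (2 * m j)

/-- `P` is a real-valued weighted homogeneous polynomial of the form
`P(z') = Σ_{wt(K)=wt(L)=1/2} a_{KL} z'^K conj(z')^L` with `a_{KL} = conj (a_{LK})`. -/
def IsWHP (m : Fin N → ℕ) (P : (Fin N → ℂ) → ℝ) : Prop :=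
  ∃ a : (Fin N → ℕ) → (Fin N → ℕ) → ℂ,
    {q : (Fin N → ℕ) × (Fin N → ℕ) | a q.1 q.2 ≠ 0}.Finite ∧
    (∀ K L, a K L = starRingEnd ℂ (a L K)) ∧
    (∀ K L, a K L ≠ 0 → wt m K = 1 / 2 ∧ wt m L = 1 / 2) ∧
    (∀ z' : Fin N → ℂ, (P z' : ℂ) =
      ∑ᶠ K, ∑ᶠ L, a K L * (∏ j, z' j ^ K j) * ∏ j, starRingEnd ℂ (z' j) ^ L j)

/-- The general ellipsoid `D_P = {(z',z_n) : |z_n|² + P(z') < 1}`. -/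
def DP (P : (Fin N → ℂ) → ℝ) : Set (CSp N) :=
  {z | ‖lastC z‖ ^ 2 + P (initC z) < 1}

/-- The squeezing function `σ_Ω(p)`: the supremum of all `r > 0` such that some holomorphic
embedding `f : Ω → 𝔹ⁿ` with `f p = 0` satisfies `B(0;r) ⊆ f(Ω)`. -/
def sqf {n : ℕ} (Ω : Set (EuclideanSpace ℂ (Fin n))) (p : EuclideanSpace ℂ (Fin n)) : ℝ :=
  sSup {r : ℝ | 0 < r ∧ ∃ f : EuclideanSpace ℂ (Fin n) → EuclideanSpace ℂ (Fin n),
    DifferentiableOn ℂ f Ω ∧ InjOn f Ω ∧ f '' Ω ⊆ ball 0 1 ∧ f p = 0 ∧ ball 0 r ⊆ f '' Ω}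

section PartA
open MeasureTheory Filter Topology
open scoped ContDiff ComplexConjugate

/-- complex Euclidean space -/
abbrev EE (n : ℕ) : Type := EuclideanSpace ℂ (Fin n)

/-- basis vectors -/
def ev {n : ℕ} (j : Fin n) : EE n := EuclideanSpace.single j (1 : ℂ)

/-- generic Wirtinger derivative: `s = I` gives the d-bar derivative, `s = -I` the d derivative. -/
def wd {n : ℕ} (s : ℂ) (j : Fin n) (f : EE n → ℂ) (x : EE n) : ℂ :=
  (1 / 2) * (fderiv ℝ f x (ev j) + s * fderiv ℝ f x (I • ev j))

section WD
variable {n : ℕ} {s t : ℂ} {j k : Fin n} {f g : EE n → ℂ}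

lemma wd_contDiff (hf : ContDiff ℝ ∞ f) : ContDiff ℝ ∞ (wd s j f) := by
  unfold wd
  have h : ContDiff ℝ ∞ (fderiv ℝ f) := hf.fderiv_right (by simp)
  have h1 : ∀ v, ContDiff ℝ ∞ (fun x => fderiv ℝ f x v) := fun v => h.clm_apply contDiff_const
  exact contDiff_const.mul ((h1 _).add (contDiff_const.mul (h1 _)))

lemma wd_mul {x : EE n} (hf : DifferentiableAt ℝ f x) (hg : DifferentiableAt ℝ g x) :
    wd s j (fun y => f y * g y) x = wd s j f x * g x + f x * wd s j g x := by
  unfold wd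
  rw [fderiv_fun_mul hf hg]
  simp only [add_apply, smul_apply, smul_eq_mul]
  ring

lemma wd_add {x : EE n} (hf : DifferentiableAt ℝ f x) (hg : DifferentiableAt ℝ g x) :
    wd s j (fun y => f y + g y) x = wd s j f x + wd s j g x := by
  unfold wd
  rw [fderiv_fun_add hf hg]
  simp only [add_apply]
  ring

lemma wd_sub {x : EE n} (hf : DifferentiableAt ℝ f x) (hg : DifferentiableAt ℝ g x) :
    wd s j (fun y => f y - g y) x = wd s j f x - wd s j g x := by
  unfold wd
  rw [fderiv_fun_sub hf hg]
  simp only [sub_apply]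
  ring

lemma wd_const_mul {x : EE n} (c : ℂ) (hf : DifferentiableAt ℝ f x) :
    wd s j (fun y => c * f y) x = c * wd s j f x := by
  unfold wd
  rw [fderiv_const_mul hf]
  simp only [smul_apply, smul_eq_mul]
  ring

lemma wd_conj {x : EE n} (hf : DifferentiableAt ℝ f x) :
    conj (wd s j f x) = wd (conj s) j (fun y => conj (f y)) x := by
  unfold wd
  have : fderiv ℝ (fun y => conj (f y)) x = conjCLE.toContinuousLinearMap.comp (fderiv ℝ f x) :=
    (conjCLE.toContinuousLinearMap.hasFDerivAt.comp x hf.hasFDerivAt).fderiv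
  rw [this]
  simp
  left; exact map_ofNat _ 2

lemma wd_support : Function.support (wd s j f) ⊆ tsupport f := by
  intro x hx
  by_contra h
  apply hx
  have h0 : fderiv ℝ f x = 0 := by
    have := support_fderiv_subset ℝ (f := f)
    by_contra h'
    exact h (this h')
  simp [wd, h0]

lemma wd_tsupport : tsupport (wd s j f) ⊆ tsupport f :=
  closure_minimal wd_support (isClosed_tsupport f)

lemma wd_hcs (hf : HasCompactSupport f) : HasCompactSupport (wd s j f) :=
  hf.mono' wd_support

lemma wd_comm (hf : ContDiff ℝ ∞ f) (x : EE n) :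
    wd s j (wd t k f) x = wd t k (wd s j f) x := by
  have hd : ContDiff ℝ ∞ (fderiv ℝ f) := hf.fderiv_right (by simp)
  have h1 : ∀ v x, HasFDerivAt (fun x => fderiv ℝ f x v)
      ((ContinuousLinearMap.apply ℝ ℂ v).comp (fderiv ℝ (fderiv ℝ f) x)) x := fun v x =>
    (ContinuousLinearMap.apply ℝ ℂ v).hasFDerivAt.comp x
      ((hd.differentiable (by simp)) x).hasFDerivAt
  have h2 : ∀ (t : ℂ) (k : Fin n) (u : EE n), fderiv ℝ (wd t k f) x u =
      (1/2) * (fderiv ℝ (fderiv ℝ f) x u (ev k) + t * fderiv ℝ (fderiv ℝ f) x u (I • ev k)) := by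
    intro t k u
    have := (((h1 (ev k) x).add ((h1 (I • ev k) x).const_mul t)).const_mul (1/2 : ℂ)).fderiv
    have e : fderiv ℝ (wd t k f) x = _ := this
    rw [e]
    simp
    try ring
  have hs : IsSymmSndFDerivAt ℝ f x := (hf.contDiffAt).isSymmSndFDerivAt (by simp; exact WithTop.coe_le_coe.2 (le_top : (2:ℕ∞) ≤ ⊤))
  rw [wd, wd, h2, h2, h2, h2]
  rw [hs (ev j) (ev k), hs (ev j) (I • ev k), hs (I • ev j) (ev k), hs (I • ev j) (I • ev k)]
  ring

lemma int_cs (hf : ContDiff ℝ ∞ f) (hs : HasCompactSupport f) : Integrable f :=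
  hf.continuous.integrable_of_hasCompactSupport hs

lemma ibp (hf : ContDiff ℝ ∞ f) (hg : ContDiff ℝ ∞ g) (hs : HasCompactSupport f ∨ HasCompactSupport g) :
    ∫ x, wd s j f x * g x = - ∫ x, f x * wd s j g x := by
  have hcs : ∀ {u v : EE n → ℂ}, HasCompactSupport u ∨ HasCompactSupport v →
      HasCompactSupport (fun x => u x * v x) := by
    intro u v h
    rcases h with h | h
    · exact h.mul_right
    · exact h.mul_left
  have hfd : ∀ v, ContDiff ℝ ∞ (fun x => fderiv ℝ f x v) := fun v =>
    (hf.fderiv_right (m := ∞) (by simp)).clm_apply contDiff_const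
  have hgd : ∀ v, ContDiff ℝ ∞ (fun x => fderiv ℝ g x v) := fun v =>
    (hg.fderiv_right (m := ∞) (by simp)).clm_apply contDiff_const
  have hfc : ∀ v, HasCompactSupport f → HasCompactSupport (fun x => fderiv ℝ f x v) := fun v h =>
    h.fderiv_apply ℝ v
  have hgc : ∀ v, HasCompactSupport g → HasCompactSupport (fun x => fderiv ℝ g x v) := fun v h =>
    h.fderiv_apply ℝ v
  have i1 : ∀ v, Integrable (fun x => fderiv ℝ f x v * g x) := fun v =>
    int_cs ((hfd v).mul hg) (hcs (hs.imp_left (hfc v)))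
  have i2 : ∀ v, Integrable (fun x => f x * fderiv ℝ g x v) := fun v =>
    int_cs (hf.mul (hgd v)) (hcs (hs.imp_right (hgc v)))
  have i3 : Integrable (fun x => f x * g x) := int_cs (hf.mul hg) (hcs hs)
  have key : ∀ v, ∫ x, f x * fderiv ℝ g x v = - ∫ x, fderiv ℝ f x v * g x := fun v =>
    integral_mul_fderiv_eq_neg_fderiv_mul_of_integrable (i1 v) (i2 v) i3
      (fun x _ => (hf.differentiable (by simp)) x) (fun x _ => (hg.differentiable (by simp)) x)
  have e1 : (fun x => wd s j f x * g x) = fun x =>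
      (1/2) * (fderiv ℝ f x (ev j) * g x) + (s / 2) * (fderiv ℝ f x (I • ev j) * g x) := by
    ext x; simp only [wd]; ring
  have e2 : (fun x => f x * wd s j g x) = fun x =>
      (1/2) * (f x * fderiv ℝ g x (ev j)) + (s / 2) * (f x * fderiv ℝ g x (I • ev j)) := by
    ext x; simp only [wd]; ring
  rw [e1, e2, integral_add ((i1 _).const_mul _) ((i1 _).const_mul _),
    integral_add ((i2 _).const_mul _) ((i2 _).const_mul _)]
  simp only [integral_const_mul, key]
  ring

end WD

section Boch
variable {n : ℕ} (φ : EE n → ℝ)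

/-- weight -/
def wgt (x : EE n) : ℂ := ((Real.exp (-φ x) : ℝ) : ℂ)
/-- complexified weight exponent -/
def phc (x : EE n) : ℂ := (φ x : ℂ)
/-- twisted derivative -/
def dl (j : Fin n) (g : EE n → ℂ) (x : EE n) : ℂ :=
  wd (-I) j g x - wd (-I) j (phc φ) x * g x
/-- weighted d-bar Laplacian on functions -/
def bx (g : EE n → ℂ) (x : EE n) : ℂ := - ∑ j, dl φ j (wd I j g) x

variable {φ}

lemma phc_cd (hφ : ContDiff ℝ ∞ φ) : ContDiff ℝ ∞ (phc φ) :=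
  ofRealCLM.contDiff.comp hφ

lemma wgt_cd (hφ : ContDiff ℝ ∞ φ) : ContDiff ℝ ∞ (wgt φ) :=
  ofRealCLM.contDiff.comp (Real.contDiff_exp.comp hφ.neg)

lemma wd_wgt (hφ : ContDiff ℝ ∞ φ) (s : ℂ) (j : Fin n) (x : EE n) :
    wd s j (wgt φ) x = - wd s j (phc φ) x * wgt φ x := by
  have hd := ((hφ.differentiable (by simp)) x).hasFDerivAt
  have h1 : HasFDerivAt (phc φ) (ofRealCLM.comp (fderiv ℝ φ x)) x :=
    ofRealCLM.hasFDerivAt.comp x hd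
  have h2 : HasFDerivAt (wgt φ) (ofRealCLM.comp (Real.exp (-φ x) • (-fderiv ℝ φ x))) x :=
    ofRealCLM.hasFDerivAt.comp x (hd.neg.exp)
  simp only [wd, h1.fderiv, h2.fderiv, wgt]
  simp
  ring

lemma dl_cd (hφ : ContDiff ℝ ∞ φ) {g : EE n → ℂ} (hg : ContDiff ℝ ∞ g) (j : Fin n) :
    ContDiff ℝ ∞ (dl φ j g) :=
  (wd_contDiff hg).sub ((wd_contDiff (phc_cd hφ)).mul hg)

lemma dl_cs {g : EE n → ℂ} (hg : HasCompactSupport g) (j : Fin n) :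
    HasCompactSupport (dl φ j g) :=
  (wd_hcs hg).sub (hg.mul_left)

lemma conj_cd {g : EE n → ℂ} (hg : ContDiff ℝ ∞ g) : ContDiff ℝ ∞ (fun x => conj (g x)) :=
  conjCLE.contDiff.comp hg

lemma conj_cs {g : EE n → ℂ} (hg : HasCompactSupport g) : HasCompactSupport (fun x => conj (g x)) :=
  hg.comp_left (g := fun z => conj z) (by simp)

lemma ibp_w (hφ : ContDiff ℝ ∞ φ) {f g : EE n → ℂ} (hf : ContDiff ℝ ∞ f) (hg : ContDiff ℝ ∞ g)
    (hs : HasCompactSupport g) (k : Fin n) :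
    ∫ x, wd I k f x * (conj (g x) * wgt φ x) = - ∫ x, f x * (conj (dl φ k g x) * wgt φ x) := by
  rw [ibp hf ((conj_cd hg).mul (wgt_cd hφ)) (Or.inr (conj_cs hs).mul_right)]
  congr 1
  apply integral_congr_ae
  filter_upwards with x
  rw [wd_mul ((conj_cd hg).differentiable (by simp) x) ((wgt_cd hφ).differentiable (by simp) x),
    wd_wgt hφ]
  have e1 : wd I k (fun y => conj (g y)) x = conj (wd (-I) k g x) := by
    rw [wd_conj (hg.differentiable (by simp) x)]; simp
  have e2 : wd I k (phc φ) x = conj (wd (-I) k (phc φ) x) := by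
    rw [wd_conj ((phc_cd hφ).differentiable (by simp) x)]; simp [phc]; rfl
  rw [e1, e2]
  simp only [dl, map_sub, map_mul]
  ring

lemma conj_wgt (x : EE n) : conj (wgt φ x) = wgt φ x := conj_ofReal _

/-- conjugate version -/
lemma ibp_w' (hφ : ContDiff ℝ ∞ φ) {f g : EE n → ℂ} (hf : ContDiff ℝ ∞ f) (hg : ContDiff ℝ ∞ g)
    (hs : HasCompactSupport g) (k : Fin n) :
    ∫ x, dl φ k g x * (conj (f x) * wgt φ x) = - ∫ x, g x * (conj (wd I k f x) * wgt φ x) := by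
  have h := congrArg conj (ibp_w hφ hf hg hs k)
  rw [map_neg, ← integral_conj, ← integral_conj] at h
  rw [eq_neg_iff_add_eq_zero] at h ⊢
  rw [← h, add_comm]
  congr 1 <;> (apply integral_congr_ae; filter_upwards with x; simp [conj_wgt]; try ring)

lemma wd_dl (hφ : ContDiff ℝ ∞ φ) {f : EE n → ℂ} (hf : ContDiff ℝ ∞ f) (j k : Fin n) (x : EE n) :
    wd I k (dl φ j f) x = dl φ j (wd I k f) x - wd I k (wd (-I) j (phc φ)) x * f x := by
  have hp := wd_contDiff (s := -I) (j := j) (phc_cd hφ)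
  have h1 : wd I k (dl φ j f) x = wd I k (wd (-I) j f) x -
      (wd I k (wd (-I) j (phc φ)) x * f x + wd (-I) j (phc φ) x * wd I k f x) := by
    rw [← wd_mul (hp.differentiable (by simp) x) (hf.differentiable (by simp) x),
      ← wd_sub ((wd_contDiff hf).differentiable (by simp) x)
      ((hp.mul hf).differentiable (by simp) x)]
    rfl
  rw [h1, wd_comm hf, dl]
  ring

/-- Bochner pairwise identity -/
lemma boch_pair (hφ : ContDiff ℝ ∞ φ) {g : EE n → ℂ} (hg : ContDiff ℝ ∞ g) (hs : HasCompactSupport g)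
    (j k : Fin n) :
    ∫ x, dl φ j (wd I j g) x * (conj (dl φ k (wd I k g) x) * wgt φ x) =
      ∫ x, (wd I k (wd I j g) x * conj (wd I k (wd I j g) x) * wgt φ x
        + wd I k (wd (-I) j (phc φ)) x * wd I j g x * conj (wd I k g x) * wgt φ x) := by
  have haj := wd_contDiff (s := I) (j := j) hg
  have hak := wd_contDiff (s := I) (j := k) hg
  have caj := wd_hcs (s := I) (j := j) hs
  have cak := wd_hcs (s := I) (j := k) hs
  have hL := wd_contDiff (s := I) (j := k) (wd_contDiff (s := -I) (j := j) (phc_cd hφ))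
  have hw := wgt_cd hφ
  have h1 := ibp_w hφ (dl_cd hφ haj j) hak cak k
  have h2 := ibp_w' hφ hak (wd_contDiff (s := I) (j := k) haj) (wd_hcs (s := I) (j := k) caj) j
  have i1 : Integrable (fun x => dl φ j (wd I k (wd I j g)) x * (conj (wd I k g x) * wgt φ x)) :=
    int_cs ((dl_cd hφ (wd_contDiff haj) j).mul ((conj_cd hak).mul hw)) (dl_cs (wd_hcs caj) j).mul_right
  have i2 : Integrable (fun x => wd I k (wd (-I) j (phc φ)) x * wd I j g x * conj (wd I k g x) * wgt φ x) :=
    int_cs (((hL.mul haj).mul (conj_cd hak)).mul hw) (caj.mul_left.mul_right.mul_right)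
  have i3 : Integrable (fun x => wd I k (wd I j g) x * conj (wd I k (wd I j g) x) * wgt φ x) :=
    int_cs (((wd_contDiff haj).mul (conj_cd (wd_contDiff haj))).mul hw) ((wd_hcs caj).mul_right.mul_right)
  rw [integral_add i3 i2]
  have h3 : ∫ x, wd I k (dl φ j (wd I j g)) x * (conj (wd I k g x) * wgt φ x) =
      (∫ x, dl φ j (wd I k (wd I j g)) x * (conj (wd I k g x) * wgt φ x)) -
      ∫ x, wd I k (wd (-I) j (phc φ)) x * wd I j g x * conj (wd I k g x) * wgt φ x := by
    rw [← integral_sub i1 i2]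
    apply integral_congr_ae
    filter_upwards with x
    rw [wd_dl hφ haj]; ring
  have h4 : ∫ x, wd I k (wd I j g) x * (conj (wd I j (wd I k g) x) * wgt φ x) =
      ∫ x, wd I k (wd I j g) x * conj (wd I k (wd I j g) x) * wgt φ x := by
    apply integral_congr_ae
    filter_upwards with x
    rw [wd_comm hg (s := I) (t := I) (j := j) (k := k)]; ring
  rw [h3, h2, h4] at h1
  linear_combination h1
end Boch

end PartA

section PartB1
open MeasureTheory Filter Topology
open scoped ContDiff ComplexConjugate

/-- the complex Hessian form -/
def levi {n : ℕ} (φ : EE n → ℝ) (x : EE n) (t : Fin n → ℂ) : ℝ :=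
  (∑ j, ∑ k, wd I k (wd (-I) j (phc φ)) x * t j * conj (t k)).re

section Hil
variable {n : ℕ} {φ : EE n → ℝ}

lemma bx_cd (hφ : ContDiff ℝ ∞ φ) {g : EE n → ℂ} (hg : ContDiff ℝ ∞ g) : ContDiff ℝ ∞ (bx φ g) :=
  (ContDiff.sum fun j _ => dl_cd hφ (wd_contDiff hg) j).neg

lemma bx_cs {g : EE n → ℂ} (hg : HasCompactSupport g) : HasCompactSupport (bx φ g) := by
  apply hg.mono'
  intro x hx
  by_contra h
  apply hx
  have hw : ∀ (s : ℂ) (j : Fin n), wd s j g x = 0 := fun s j => by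
    by_contra h'
    exact h (wd_support h')
  have hw2 : ∀ (s r : ℂ) (j : Fin n), wd r j (wd s j g) x = 0 := fun s r j => by
    by_contra h'
    exact h (wd_tsupport (wd_support h'))
  simp [bx, dl, hw, hw2]

lemma bx_sq (hφ : ContDiff ℝ ∞ φ) {g : EE n → ℂ} (hg : ContDiff ℝ ∞ g) (hs : HasCompactSupport g) :
    ∫ x, levi φ x (fun j => wd I j g x) * Real.exp (-φ x) ≤ ∫ x, ‖bx φ g x‖ ^ 2 * Real.exp (-φ x) := by
  have hw := wgt_cd hφ
  have h0 : ∫ x, bx φ g x * (conj (bx φ g x) * wgt φ x) =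
      ∑ j, ∑ k, ∫ x, dl φ j (wd I j g) x * (conj (dl φ k (wd I k g) x) * wgt φ x) := by
    have i : ∀ j k, Integrable (fun x => dl φ j (wd I j g) x * (conj (dl φ k (wd I k g) x) * wgt φ x)) :=
      fun j k => int_cs ((dl_cd hφ (wd_contDiff hg) j).mul ((conj_cd (dl_cd hφ (wd_contDiff hg) k)).mul hw))
        (dl_cs (wd_hcs hs) j).mul_right
    have e : ∀ j, ∑ k, ∫ x, dl φ j (wd I j g) x * (conj (dl φ k (wd I k g) x) * wgt φ x) =
        ∫ x, ∑ k, dl φ j (wd I j g) x * (conj (dl φ k (wd I k g) x) * wgt φ x) := fun j =>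
      (integral_finsetSum _ (fun k _ => i j k)).symm
    simp only [e]
    rw [← integral_finsetSum _ (fun j _ => integrable_finsetSum _ (fun k _ => i j k))]
    apply integral_congr_ae
    filter_upwards with x
    simp only [bx, map_neg, map_sum, ← Finset.mul_sum, ← Finset.sum_mul]
    ring
  have haj := fun j : Fin n => wd_contDiff (s := I) (j := j) hg
  have caj := fun j : Fin n => wd_hcs (s := I) (j := j) hs
  have hL := fun j k : Fin n => wd_contDiff (s := I) (j := k) (wd_contDiff (s := -I) (j := j) (phc_cd hφ))
  have i2 : ∀ j k, Integrable (fun x => wd I k (wd (-I) j (phc φ)) x * wd I j g x * conj (wd I k g x) * wgt φ x) :=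
    fun j k => int_cs ((((hL j k).mul (haj j)).mul (conj_cd (haj k))).mul hw) ((caj j).mul_left.mul_right.mul_right)
  have i3 : ∀ j k, Integrable (fun x => wd I k (wd I j g) x * conj (wd I k (wd I j g) x) * wgt φ x) :=
    fun j k => int_cs (((wd_contDiff (haj j)).mul (conj_cd (wd_contDiff (haj j)))).mul hw)
      ((wd_hcs (caj j)).mul_right.mul_right)
  have i23 : ∀ j k, Integrable (fun x => wd I k (wd I j g) x * conj (wd I k (wd I j g) x) * wgt φ x
        + wd I k (wd (-I) j (phc φ)) x * wd I j g x * conj (wd I k g x) * wgt φ x) :=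
    fun j k => (i3 j k).add (i2 j k)
  simp only [boch_pair hφ hg hs] at h0
  have h1 : ∑ j, ∑ k, ∫ x, (wd I k (wd I j g) x * conj (wd I k (wd I j g) x) * wgt φ x
        + wd I k (wd (-I) j (phc φ)) x * wd I j g x * conj (wd I k g x) * wgt φ x) =
      ∫ x, ∑ j, ∑ k, (wd I k (wd I j g) x * conj (wd I k (wd I j g) x) * wgt φ x
        + wd I k (wd (-I) j (phc φ)) x * wd I j g x * conj (wd I k g x) * wgt φ x) := by
    rw [integral_finsetSum _ (fun j _ => integrable_finsetSum _ (fun k _ => i23 j k))]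
    refine Finset.sum_congr rfl fun j _ => ?_
    rw [integral_finsetSum _ (fun k _ => i23 j k)]
  rw [h1] at h0
  have iA : Integrable (fun x => ∑ j, ∑ k, (wd I k (wd I j g) x * conj (wd I k (wd I j g) x) * wgt φ x
        + wd I k (wd (-I) j (phc φ)) x * wd I j g x * conj (wd I k g x) * wgt φ x)) :=
    integrable_finsetSum _ (fun j _ => integrable_finsetSum _ (fun k _ => i23 j k))
  have iB : Integrable (fun x => bx φ g x * (conj (bx φ g x) * wgt φ x)) :=
    int_cs ((bx_cd hφ hg).mul ((conj_cd (bx_cd hφ hg)).mul hw)) (bx_cs hs).mul_right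
  have h2 : ∀ x, ‖bx φ g x‖ ^ 2 * Real.exp (-φ x) = (bx φ g x * (conj (bx φ g x) * wgt φ x)).re := by
    intro x
    rw [← mul_assoc, mul_conj, wgt, ← ofReal_mul, ofReal_re, normSq_eq_norm_sq]
  have iA2 : Integrable (fun x => ∑ j, ∑ k, wd I k (wd (-I) j (phc φ)) x * wd I j g x * conj (wd I k g x) * wgt φ x) :=
    integrable_finsetSum _ (fun j _ => integrable_finsetSum _ (fun k _ => i2 j k))
  have h3 : ∀ x, levi φ x (fun j => wd I j g x) * Real.exp (-φ x) =
      (∑ j, ∑ k, wd I k (wd (-I) j (phc φ)) x * wd I j g x * conj (wd I k g x) * wgt φ x).re := by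
    intro x
    simp only [levi, wgt, ← Finset.sum_mul, re_mul_ofReal]
  simp only [h2]
  have h4 : ∫ x, (bx φ g x * (conj (bx φ g x) * wgt φ x)).re =
      ∫ x, (∑ j, ∑ k, (wd I k (wd I j g) x * conj (wd I k (wd I j g) x) * wgt φ x
        + wd I k (wd (-I) j (phc φ)) x * wd I j g x * conj (wd I k g x) * wgt φ x)).re := by
    have a1 := integral_re iB
    have a2 := integral_re iA
    simp only [RCLike.re_to_complex] at a1 a2
    rw [a1, a2, h0]
  rw [h4]
  apply integral_mono
  · simp only [h3]; exact iA2.re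
  · exact iA.re
  · intro x
    simp only [h3]
    simp only [re_sum]
    refine Finset.sum_le_sum fun j _ => Finset.sum_le_sum fun k _ => ?_
    rw [add_re]
    have : 0 ≤ (wd I k (wd I j g) x * conj (wd I k (wd I j g) x) * wgt φ x).re := by
      rw [mul_conj, wgt, ← ofReal_mul, ofReal_re]
      exact mul_nonneg (normSq_nonneg _) (Real.exp_pos _).le
    linarith

lemma bx_pair (hφ : ContDiff ℝ ∞ φ) {v g : EE n → ℂ} (hv : ContDiff ℝ ∞ v)
    (hg : ContDiff ℝ ∞ g) (hs : HasCompactSupport g) :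
    ∫ x, v x * (conj (bx φ g x) * wgt φ x) = ∫ x, ∑ j, wd I j v x * (conj (wd I j g x) * wgt φ x) := by
  have hw := wgt_cd hφ
  have haj := fun j : Fin n => wd_contDiff (s := I) (j := j) hg
  have caj := fun j : Fin n => wd_hcs (s := I) (j := j) hs
  rw [integral_finsetSum _ (fun j _ => int_cs ((wd_contDiff hv).mul ((conj_cd (haj j)).mul hw))
    (conj_cs (caj j)).mul_right.mul_left)]
  simp only [fun j => ibp_w hφ hv (haj j) (caj j) j, Finset.sum_neg_distrib]
  rw [← integral_finsetSum _ (fun j _ => int_cs (hv.mul ((conj_cd (dl_cd hφ (haj j) j)).mul hw))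
    (conj_cs (dl_cs (caj j) j)).mul_right.mul_left), ← integral_neg]
  apply integral_congr_ae
  filter_upwards with x
  simp only [bx, map_neg, map_sum, ← Finset.mul_sum, ← Finset.sum_mul]
  ring

lemma sq_le_of_amgm {x A B : ℝ} (hx : 0 ≤ x) (hA : 0 ≤ A) (hB : 0 ≤ B)
    (h : ∀ l : ℝ, 0 < l → x ≤ l / 2 * A + 1 / (2 * l) * B) : x ^ 2 ≤ A * B := by
  by_contra hc
  push Not at hc
  have hxp : 0 < x := by
    rcases hx.lt_or_eq with h1 | h1
    · exact h1
    · subst h1; nlinarith [mul_nonneg hA hB]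
  rcases hA.lt_or_eq with hA' | hA'
  · have := h (x / A) (by positivity)
    have e : x / A / 2 * A + 1 / (2 * (x / A)) * B = x / 2 + A * B / (2 * x) := by
      field_simp
    rw [e] at this
    have h2 : A * B / (2 * x) < x / 2 := by
      rw [div_lt_iff₀ (by positivity)]; nlinarith
    linarith
  · subst hA'
    have := h ((B + 1) / x) (by positivity)
    have e : (B + 1) / x / 2 * 0 + 1 / (2 * ((B + 1) / x)) * B = x * (B / (2 * (B + 1))) := by
      field_simp
      ring
    rw [e] at this
    have h2 : B / (2 * (B + 1)) < 1 := by
      rw [div_lt_one (by positivity)]; linarith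
    nlinarith

lemma apriori (hφ : ContDiff ℝ ∞ φ) {v g : EE n → ℂ} (hv : ContDiff ℝ ∞ v) (hvs : HasCompactSupport v)
    (hg : ContDiff ℝ ∞ g) (hs : HasCompactSupport g) {c : ℝ} (hc : 0 < c)
    (hL0 : ∀ x t, 0 ≤ levi φ x t) (hLc : ∀ x ∈ tsupport v, ∀ t, c * ∑ j, ‖t j‖ ^ 2 ≤ levi φ x t) :
    ‖∫ x, v x * (conj (bx φ g x) * wgt φ x)‖ ^ 2 ≤
      (1 / c * ∫ x, (∑ j, ‖wd I j v x‖ ^ 2) * Real.exp (-φ x)) * ∫ x, ‖bx φ g x‖ ^ 2 * Real.exp (-φ x) := by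
  have hw := wgt_cd hφ
  have haj := fun j : Fin n => wd_contDiff (s := I) (j := j) hg
  have caj := fun j : Fin n => wd_hcs (s := I) (j := j) hs
  have hvj := fun j : Fin n => wd_contDiff (s := I) (j := j) hv
  have cvj := fun j : Fin n => wd_hcs (s := I) (j := j) hvs
  have hce : Continuous (fun x => Real.exp (-φ x)) := Real.continuous_exp.comp hφ.continuous.neg
  have hL := fun j k : Fin n => (wd_contDiff (s := I) (j := k) (wd_contDiff (s := -I) (j := j) (phc_cd hφ))).continuous
  have iv : Integrable (fun x => (∑ j, ‖wd I j v x‖ ^ 2) * Real.exp (-φ x)) := by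
    apply Continuous.integrable_of_hasCompactSupport
    · exact (continuous_finsetSum _ fun j _ => (hvj j).continuous.norm.pow 2).mul hce
    · apply hvs.mono'
      intro x hx
      by_contra h
      apply hx
      have : ∀ j, wd I j v x = 0 := fun j => by
        by_contra h'; exact h (wd_support h')
      simp [this]
  have il : Integrable (fun x => levi φ x (fun j => wd I j g x) * Real.exp (-φ x)) := by
    apply Continuous.integrable_of_hasCompactSupport
    · refine Continuous.mul ?_ hce
      refine continuous_re.comp (continuous_finsetSum _ fun j _ => continuous_finsetSum _ fun k _ => ?_)
      exact ((hL j k).mul (haj j).continuous).mul (continuous_conj.comp (haj k).continuous)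
    · apply hs.mono'
      intro x hx
      by_contra h
      apply hx
      have : ∀ j, wd I j g x = 0 := fun j => by
        by_contra h'; exact h (wd_support h')
      simp [levi, this]
  refine sq_le_of_amgm (norm_nonneg _) ?_ ?_ ?_
  · refine mul_nonneg (by positivity) (integral_nonneg fun x => by positivity)
  · exact integral_nonneg fun x => by positivity
  intro l hl
  rw [bx_pair hφ hv hg hs]
  calc ‖∫ x, ∑ j, wd I j v x * (conj (wd I j g x) * wgt φ x)‖
      ≤ ∫ x, (l / 2 * (1 / c * ((∑ j, ‖wd I j v x‖ ^ 2) * Real.exp (-φ x))) +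
          1 / (2 * l) * (levi φ x (fun j => wd I j g x) * Real.exp (-φ x))) := by
        apply norm_integral_le_of_norm_le
        · exact ((iv.const_mul _).const_mul _).add (il.const_mul _)
        filter_upwards with x
        have hwn : ‖wgt φ x‖ = Real.exp (-φ x) := by
          rw [wgt, norm_real, Real.norm_of_nonneg (Real.exp_pos _).le]
        have hexp := Real.exp_pos (-φ x)
        by_cases hx : x ∈ tsupport v
        · have h1 := hLc x hx (fun j => wd I j g x)
          calc ‖∑ j, wd I j v x * (conj (wd I j g x) * wgt φ x)‖
              ≤ ∑ j, ‖wd I j v x * (conj (wd I j g x) * wgt φ x)‖ := norm_sum_le _ _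
            _ = ∑ j, ‖wd I j v x‖ * ‖wd I j g x‖ * Real.exp (-φ x) := by
                refine Finset.sum_congr rfl fun j _ => ?_
                rw [norm_mul, norm_mul, hwn, norm_conj]; ring
            _ ≤ ∑ j, (l / 2 * (1 / c * ‖wd I j v x‖ ^ 2) + 1 / (2 * l) * (c * ‖wd I j g x‖ ^ 2)) * Real.exp (-φ x) := by
                refine Finset.sum_le_sum fun j _ => ?_
                apply mul_le_mul_of_nonneg_right _ hexp.le
                have h2 : 0 ≤ (l * ‖wd I j v x‖ - c * ‖wd I j g x‖) ^ 2 / (2 * l * c) := by positivity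
                have h3 : (l * ‖wd I j v x‖ - c * ‖wd I j g x‖) ^ 2 / (2 * l * c) =
                  l / 2 * (1 / c * ‖wd I j v x‖ ^ 2) + 1 / (2 * l) * (c * ‖wd I j g x‖ ^ 2) - ‖wd I j v x‖ * ‖wd I j g x‖ := by
                  field_simp
                  ring
                linarith
            _ = l / 2 * (1 / c * ((∑ j, ‖wd I j v x‖ ^ 2) * Real.exp (-φ x))) +
                1 / (2 * l) * ((c * ∑ j, ‖wd I j g x‖ ^ 2) * Real.exp (-φ x)) := by
                rw [← Finset.sum_mul, Finset.sum_add_distrib, ← Finset.mul_sum, ← Finset.mul_sum,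
                  ← Finset.mul_sum, ← Finset.mul_sum]
                ring
            _ ≤ _ := by gcongr
        · have : ∀ j, wd I j v x = 0 := fun j => by
            by_contra h'; exact hx (wd_support h')
          simp only [this, zero_mul, Finset.sum_const_zero, norm_zero]
          have := hL0 x (fun j => wd I j g x)
          positivity
    _ = l / 2 * (1 / c * ∫ x, (∑ j, ‖wd I j v x‖ ^ 2) * Real.exp (-φ x)) +
          1 / (2 * l) * ∫ x, (levi φ x (fun j => wd I j g x) * Real.exp (-φ x)) := by
        rw [integral_add ((iv.const_mul _).const_mul _) (il.const_mul _)]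
        simp only [integral_const_mul]
    _ ≤ _ := by
        have := bx_sq hφ hg hs
        gcongr
end Hil

end PartB1

section PartB2
open MeasureTheory Filter Topology
open scoped ContDiff ComplexConjugate

section Hil2
variable {n : ℕ} {φ : EE n → ℝ}

lemma bx_add {f g : EE n → ℂ} (hf : ContDiff ℝ ∞ f) (hg : ContDiff ℝ ∞ g) (x : EE n) :
    bx φ (fun y => f y + g y) x = bx φ f x + bx φ g x := by
  have e : ∀ j : Fin n, wd I j (fun y => f y + g y) = fun y => wd I j f y + wd I j g y := fun j => by
    ext y; exact wd_add (hf.differentiable (by simp) y) (hg.differentiable (by simp) y)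
  simp only [bx, dl, e]
  rw [← neg_add, ← Finset.sum_add_distrib]
  congr 1
  refine Finset.sum_congr rfl fun j _ => ?_
  rw [wd_add ((wd_contDiff hf).differentiable (by simp) x) ((wd_contDiff hg).differentiable (by simp) x)]
  ring

lemma bx_smul {f : EE n → ℂ} (hf : ContDiff ℝ ∞ f) (c : ℂ) (x : EE n) :
    bx φ (fun y => c * f y) x = c * bx φ f x := by
  have e : ∀ j : Fin n, wd I j (fun y => c * f y) = fun y => c * wd I j f y := fun j => by
    ext y; exact wd_const_mul c (hf.differentiable (by simp) y)
  simp only [bx, dl, e]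
  rw [mul_neg, Finset.mul_sum]
  congr 1
  refine Finset.sum_congr rfl fun j _ => ?_
  rw [wd_const_mul c ((wd_contDiff hf).differentiable (by simp) x)]
  ring

/-- half weight -/
def hwt (φ : EE n → ℝ) (x : EE n) : ℂ := ((Real.exp (-φ x / 2) : ℝ) : ℂ)

lemma hwt_cd (hφ : ContDiff ℝ ∞ φ) : ContDiff ℝ ∞ (hwt φ) :=
  ofRealCLM.contDiff.comp (Real.contDiff_exp.comp (hφ.neg.div_const 2))

lemma hwt_sq (x : EE n) : hwt φ x * hwt φ x = wgt φ x := by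
  simp only [hwt, wgt, ← ofReal_mul, ← Real.exp_add]; congr 2; ring

lemma hwt_conj (x : EE n) : conj (hwt φ x) = hwt φ x := conj_ofReal _

lemma hwt_ne (x : EE n) : hwt φ x ≠ 0 := by
  simp only [hwt]; exact_mod_cast (Real.exp_pos _).ne'

lemma norm_hwt_sq (x : EE n) : ‖hwt φ x‖ ^ 2 = Real.exp (-φ x) := by
  rw [hwt, norm_real, Real.norm_of_nonneg (Real.exp_pos _).le, ← Real.exp_nat_mul]
  congr 1; push_cast; ring

lemma L2_norm_sq (f : Lp ℂ 2 (volume : Measure (EE n))) : ‖f‖ ^ 2 = ∫ x, ‖f x‖ ^ 2 := by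
  have h := L2.inner_def (𝕜 := ℂ) f f
  rw [inner_self_eq_norm_sq_to_K] at h
  have h2 : ∀ x, (inner ℂ (f x) (f x) : ℂ) = ((‖f x‖ ^ 2 : ℝ) : ℂ) := fun x => by
    rw [inner_self_eq_norm_sq_to_K]; push_cast; rfl
  simp only [h2] at h
  have h3 : ∫ x, ((‖f x‖ ^ 2 : ℝ) : ℂ) = ((∫ x, ‖f x‖ ^ 2 : ℝ) : ℂ) :=
    integral_ofReal (f := fun x => ‖f x‖ ^ 2)
  apply ofReal_injective
  rw [← h3, ← h, ofReal_pow]; rfl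

/-- the range of the box operator in L2 -/
def bxS (φ : EE n → ℝ) : Submodule ℂ (Lp ℂ 2 (volume : Measure (EE n))) where
  carrier := {h | ∃ g : EE n → ℂ, ContDiff ℝ ∞ g ∧ HasCompactSupport g ∧
    h =ᵐ[volume] fun x => bx φ g x * hwt φ x}
  add_mem' := by
    rintro a b ⟨f, hf, hfs, ha⟩ ⟨g, hg, hgs, hb⟩
    refine ⟨fun y => f y + g y, hf.add hg, hfs.add hgs, ?_⟩
    filter_upwards [ha, hb, Lp.coeFn_add a b] with x h1 h2 h3
    rw [h3, Pi.add_apply, h1, h2, bx_add hf hg]; ring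
  zero_mem' := by
    refine ⟨fun _ => 0, contDiff_const, HasCompactSupport.zero, ?_⟩
    filter_upwards [Lp.coeFn_zero ℂ 2 (volume : Measure (EE n))] with x h
    have := bx_smul (φ := φ) (f := fun _ : EE n => (0:ℂ)) contDiff_const 0 x
    simp only [zero_mul] at this
    rw [h, this]; simp
  smul_mem' := by
    rintro c a ⟨f, hf, hfs, ha⟩
    refine ⟨fun y => c * f y, contDiff_const.mul hf, hfs.mul_left, ?_⟩
    filter_upwards [ha, Lp.coeFn_smul c a] with x h1 h3
    rw [h3, Pi.smul_apply, h1, bx_smul hf, smul_eq_mul]; ring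

lemma bx_conj_wgt (hφ : ContDiff ℝ ∞ φ) {G : EE n → ℂ} (hG : ContDiff ℝ ∞ G) (x : EE n) :
    conj (bx φ (fun y => conj (G y)) x) * wgt φ x =
      - ∑ j, wd I j (fun y => wgt φ y * wd (-I) j G y) x := by
  simp only [bx, map_neg, map_sum, neg_mul, Finset.sum_mul]
  congr 1
  refine Finset.sum_congr rfl fun j _ => ?_
  have e : (fun y => conj (wd I j (fun y => conj (G y)) y)) = wd (-I) j G := by
    ext y; rw [wd_conj ((conj_cd hG).differentiable (by simp) y)]; simp
  rw [wd_mul ((wgt_cd hφ).differentiable (by simp) x) ((wd_contDiff hG).differentiable (by simp) x),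
    wd_wgt hφ, dl, map_sub, map_mul,
    wd_conj ((wd_contDiff (conj_cd hG)).differentiable (by simp) x), e]
  have e2 : wd I j (phc φ) x = conj (wd (-I) j (phc φ) x) := by
    rw [wd_conj ((phc_cd hφ).differentiable (by simp) x)]; simp [phc]; rfl
  rw [e2, show conj (wd I j (fun y => conj (G y)) x) = wd (-I) j G x from congrFun e x]
  simp
  ring

theorem T1a (hφ : ContDiff ℝ ∞ φ) {v : EE n → ℂ} (hv : ContDiff ℝ ∞ v) (hvs : HasCompactSupport v)
    {c : ℝ} (hc : 0 < c)
    (hL0 : ∀ x t, 0 ≤ levi φ x t) (hLc : ∀ x ∈ tsupport v, ∀ t, c * ∑ j, ‖t j‖ ^ 2 ≤ levi φ x t) :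
    ∃ F : EE n → ℂ, Measurable F ∧ MemLp (fun x => F x * hwt φ x) 2 ∧ MemLp (fun x => (v x - F x) * hwt φ x) 2 ∧
      ∫ x, ‖v x - F x‖ ^ 2 * Real.exp (-φ x) ≤ 1 / c * ∫ x, (∑ j, ‖wd I j v x‖ ^ 2) * Real.exp (-φ x) ∧
      ∀ G : EE n → ℂ, ContDiff ℝ ∞ G → HasCompactSupport G →
        ∫ x, F x * ∑ j, wd I j (fun y => wgt φ y * wd (-I) j G y) x = 0 := by
  have hwc := (hwt_cd hφ).continuous
  have mv : MemLp (fun x => v x * hwt φ x) 2 :=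
    (hv.continuous.mul hwc).memLp_of_hasCompactSupport hvs.mul_right
  have mb : ∀ g : EE n → ℂ, ContDiff ℝ ∞ g → HasCompactSupport g →
      MemLp (fun x => bx φ g x * hwt φ x) 2 := fun g hg hs =>
    ((bx_cd hφ hg).continuous.mul hwc).memLp_of_hasCompactSupport (bx_cs hs).mul_right
  set V := mv.toLp with hV
  set K := 1 / c * ∫ x, (∑ j, ‖wd I j v x‖ ^ 2) * Real.exp (-φ x) with hK
  have hK0 : 0 ≤ K := mul_nonneg (by positivity) (integral_nonneg fun x => by positivity)
  have hS : ∀ s ∈ bxS φ, ‖(inner ℂ s V : ℂ)‖ ^ 2 ≤ K * ‖s‖ ^ 2 := by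
    rintro s ⟨g, hg, hs, hsg⟩
    have h1 : (inner ℂ s V : ℂ) = ∫ x, v x * (conj (bx φ g x) * wgt φ x) := by
      rw [L2.inner_def]
      apply integral_congr_ae
      filter_upwards [hsg, mv.coeFn_toLp] with x h1 h2
      rw [h1, RCLike.inner_apply, hV, h2, map_mul, hwt_conj, ← hwt_sq]
      ring
    have h2 : ‖s‖ ^ 2 = ∫ x, ‖bx φ g x‖ ^ 2 * Real.exp (-φ x) := by
      rw [L2_norm_sq]
      apply integral_congr_ae
      filter_upwards [hsg] with x h1
      rw [h1, norm_mul, mul_pow, norm_hwt_sq]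
    rw [h1, h2]
    exact apriori hφ hv hvs hg hs hc hL0 hLc
  set S := (bxS φ).topologicalClosure with hSdef
  have hS2 : ∀ s ∈ S, ‖(inner ℂ s V : ℂ)‖ ^ 2 ≤ K * ‖s‖ ^ 2 := by
    intro s hs
    have hcl : IsClosed {s : Lp ℂ 2 (volume : Measure (EE n)) | ‖(inner ℂ s V : ℂ)‖ ^ 2 ≤ K * ‖s‖ ^ 2} :=
      isClosed_le (by fun_prop) (by fun_prop)
    exact closure_minimal hS hcl hs
  have : CompleteSpace S := (Submodule.isClosed_topologicalClosure _).completeSpace_coe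
  set U := S.starProjection V with hU
  have hUm : U ∈ S := S.starProjection_apply_mem V
  have hort : V - U ∈ Sᗮ := S.sub_starProjection_mem_orthogonal V
  have hUn : ‖U‖ ^ 2 ≤ K := by
    have h1 : (inner ℂ U (V - U) : ℂ) = 0 := hort U hUm
    rw [inner_sub_right, sub_eq_zero, inner_self_eq_norm_sq_to_K] at h1
    have h2 := hS2 U hUm
    rw [h1] at h2
    have h3 : ‖((‖U‖ : ℂ)) ^ 2‖ = ‖U‖ ^ 2 := by simp
    have h4 : (‖U‖ ^ 2) ^ 2 ≤ K * ‖U‖ ^ 2 := by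
      rw [← h3]; simpa using h2
    by_cases h0 : ‖U‖ ^ 2 = 0
    · rw [h0]; exact hK0
    · have : 0 < ‖U‖ ^ 2 := lt_of_le_of_ne (by positivity) (Ne.symm h0)
      nlinarith
  have hFe : ∀ x, ((V - U) x / hwt φ x) * hwt φ x = (V - U) x := fun x => div_mul_cancel₀ _ (hwt_ne x)
  have hae : (fun x => (v x - (V - U) x / hwt φ x) * hwt φ x) =ᵐ[volume] U := by
    filter_upwards [mv.coeFn_toLp, Lp.coeFn_sub V U] with x h1 h2
    rw [sub_mul, hFe, h2, Pi.sub_apply, hV, h1]; ring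
  refine ⟨fun x => (V - U) x / hwt φ x, (Lp.stronglyMeasurable _).measurable.div hwc.measurable, ?_, ?_, ?_, ?_⟩
  · simp only [hFe]; exact Lp.memLp _
  · exact (memLp_congr_ae hae).2 (Lp.memLp U)
  · have : ∫ x, ‖v x - (V - U) x / hwt φ x‖ ^ 2 * Real.exp (-φ x) = ‖U‖ ^ 2 := by
      rw [L2_norm_sq]
      apply integral_congr_ae
      filter_upwards [hae] with x h1
      rw [← h1, norm_mul, mul_pow, norm_hwt_sq]
    rw [this]; exact hUn
  · intro G hG hGs
    have m := mb _ (conj_cd hG) (conj_cs hGs)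
    have hmem : m.toLp ∈ S := Submodule.le_topologicalClosure _
      ⟨_, conj_cd hG, conj_cs hGs, m.coeFn_toLp⟩
    have h1 : (inner ℂ m.toLp (V - U) : ℂ) = 0 := hort _ hmem
    rw [L2.inner_def] at h1
    rw [← neg_eq_zero, ← integral_neg, ← h1]
    apply integral_congr_ae
    filter_upwards [m.coeFn_toLp] with x h2
    rw [h2, RCLike.inner_apply, map_mul, hwt_conj, ← mul_neg, ← bx_conj_wgt hφ hG, ← hwt_sq]
    have := hwt_ne (φ := φ) x
    field_simp
end Hil2

end PartB2

section PartB3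
open MeasureTheory Filter Topology
open scoped ContDiff ComplexConjugate Convolution

section Conv
variable {n : ℕ}

/-- convolution -/
def cv (f g : EE n → ℂ) (x : EE n) : ℂ := ∫ y, f y * g (x - y)

lemma cv_eq (f g : EE n → ℂ) : cv f g = (f ⋆[ContinuousLinearMap.mul ℝ ℂ, volume] g) := by
  ext x; rfl

lemma cv_int {f g : EE n → ℂ} (hf : LocallyIntegrable f) (hg : Continuous g)
    (hs : HasCompactSupport g) (x : EE n) : Integrable (fun y => f y * g (x - y)) := by
  have := hs.convolutionExists_right (L := ContinuousLinearMap.mul ℝ ℂ) (μ := volume) hf hg x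
  exact this

lemma cv_cd {f g : EE n → ℂ} (hf : LocallyIntegrable f) (hg : ContDiff ℝ ∞ g)
    (hs : HasCompactSupport g) : ContDiff ℝ ∞ (cv f g) := by
  rw [cv_eq]
  exact hs.contDiff_convolution_right _ hf hg

lemma cv_wd {f g : EE n → ℂ} (hf : LocallyIntegrable f) (hg : ContDiff ℝ ∞ g)
    (hs : HasCompactSupport g) (s : ℂ) (j : Fin n) (x : EE n) :
    wd s j (cv f g) x = cv f (wd s j g) x := by
  have hg1 : ContDiff ℝ 1 g := hg.of_le (by simp)
  have h := (hs.hasFDerivAt_convolution_right (L := ContinuousLinearMap.mul ℝ ℂ) (μ := volume) hf hg1 x).fderiv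
  rw [← cv_eq] at h
  have i0 : Integrable (fun y => ((ContinuousLinearMap.mul ℝ ℂ).precompR (EE n) (f y)) (fderiv ℝ g (x - y))) :=
    (hs.fderiv ℝ).convolutionExists_right (L := (ContinuousLinearMap.mul ℝ ℂ).precompR (EE n))
      hf (hg1.continuous_fderiv (by simp)) x
  have h2 : ∀ u, fderiv ℝ (cv f g) x u = ∫ y, f y * fderiv ℝ g (x - y) u := by
    intro u
    rw [h, convolution_def, ContinuousLinearMap.integral_apply i0]
    simp
  have i1 : ∀ u, Integrable (fun y => f y * fderiv ℝ g (x - y) u) := fun u =>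
    cv_int (g := fun z => fderiv ℝ g z u) hf ((hg1.continuous_fderiv (by simp)).clm_apply continuous_const)
      (hs.fderiv_apply ℝ u) x
  simp only [wd, h2, cv]
  rw [← integral_const_mul, ← integral_add (i1 _) ((i1 _).const_mul _), ← integral_const_mul]
  apply integral_congr_ae
  filter_upwards with y
  ring

/-- basic bump -/
def b0 (x : EE n) : ℝ := Real.smoothTransition (1 - ‖x‖ ^ 2)

lemma b0_cd : ContDiff ℝ ∞ (b0 : EE n → ℝ) :=
  Real.smoothTransition.contDiff.comp (contDiff_const.sub (contDiff_norm_sq ℝ))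

lemma b0_supp : Function.support (b0 : EE n → ℝ) = ball 0 1 := by
  ext x
  simp only [Function.mem_support, mem_ball, dist_zero_right, b0]
  constructor
  · intro h
    by_contra h'
    apply h
    apply Real.smoothTransition.zero_of_nonpos
    push Not at h'
    nlinarith
  · intro h
    apply (Real.smoothTransition.pos_of_pos _).ne'
    nlinarith [norm_nonneg x]

lemma b0_cs : HasCompactSupport (b0 : EE n → ℝ) := by
  apply HasCompactSupport.intro (isCompact_closedBall (0 : EE n) 1)
  intro x hx
  by_contra h
  have : x ∈ Function.support (b0 : EE n → ℝ) := h
  rw [b0_supp] at this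
  exact hx (ball_subset_closedBall this)

lemma b0_int_pos : 0 < ∫ x : EE n, b0 x := by
  rw [integral_pos_iff_support_of_nonneg (f := (b0 : EE n → ℝ)) (fun x => Real.smoothTransition.nonneg _)
    (b0_cd.continuous.integrable_of_hasCompactSupport b0_cs), b0_supp]
  exact measure_ball_pos _ _ one_pos

lemma wd_norm_le (s : ℂ) (hs : ‖s‖ ≤ 1) (j : Fin n) (f : EE n → ℂ) (x : EE n) :
    ‖wd s j f x‖ ≤ ‖fderiv ℝ f x‖ := by
  have e1 : ‖(ev j : EE n)‖ = 1 := by simp [ev]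
  have e2 : ‖(I • ev j : EE n)‖ = 1 := by simp [norm_smul, e1]
  have h1 := (fderiv ℝ f x).le_opNorm (ev j)
  have h2 := (fderiv ℝ f x).le_opNorm (I • ev j)
  rw [e1, mul_one] at h1
  rw [e2, mul_one] at h2
  calc ‖wd s j f x‖ ≤ 1 / 2 * (‖fderiv ℝ f x (ev j)‖ + ‖s‖ * ‖fderiv ℝ f x (I • ev j)‖) := by
        rw [wd, norm_mul]
        gcongr
        · simp
        · exact (norm_add_le _ _).trans (by rw [norm_mul])
    _ ≤ 1 / 2 * (‖fderiv ℝ f x‖ + 1 * ‖fderiv ℝ f x‖) := by gcongr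
    _ = _ := by ring

/-- volume of a ball -/
def vb (n : ℕ) (ε : ℝ) : ℝ := (volume (ball (0 : EE n) ε)).toReal

lemma vb_pos {ε : ℝ} (h : 0 < ε) : 0 < vb n ε :=
  ENNReal.toReal_pos (measure_ball_pos _ _ h).ne' measure_ball_lt_top.ne

lemma exists_moll (n : ℕ) : ∃ C : ℝ, 0 < C ∧ ∀ ε : ℝ, 0 < ε → ∃ b : EE n → ℂ, ContDiff ℝ ∞ b ∧
    (∀ x, x ∉ ball 0 ε → b x = 0) ∧ HasCompactSupport b ∧ (∫ x, b x = 1) ∧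
    (∀ x, ‖b x‖ ≤ C / vb n ε) ∧ (∀ x, ‖fderiv ℝ b x‖ ≤ C / (ε * vb n ε)) ∧
    (∀ x y, ‖x‖ = ‖y‖ → b x = b y) := by
  obtain ⟨C1, hC1⟩ := (b0_cs (n := n).fderiv ℝ).exists_bound_of_continuous
    (b0_cd.continuous_fderiv (by simp))
  have hC10 : 0 ≤ C1 := (norm_nonneg _).trans (hC1 0)
  set Z := ∫ x : EE n, b0 x with hZ
  have hZp : 0 < Z := b0_int_pos
  set d := Module.finrank ℝ (EE n)
  have hV : ∀ ε : ℝ, 0 < ε → vb n ε = ε ^ d * vb n 1 := by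
    intro ε hε
    have := Measure.addHaar_ball_of_pos (volume : Measure (EE n)) 0 hε
    rw [vb, this, ENNReal.toReal_mul, ENNReal.toReal_ofReal (by positivity), vb]
  have hv1 : 0 < vb n 1 := vb_pos one_pos
  refine ⟨(1 + C1) * vb n 1 / Z, by positivity, fun ε hε => ?_⟩
  have hsc : ContDiff ℝ ∞ (fun x : EE n => b0 (ε⁻¹ • x)) :=
    b0_cd.comp (contDiff_const_smul ε⁻¹)
  have hz : ∀ x : EE n, x ∉ ball 0 ε → b0 (ε⁻¹ • x) = 0 := by
    intro x hx
    by_contra h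
    have : ε⁻¹ • x ∈ Function.support (b0 : EE n → ℝ) := h
    rw [b0_supp, mem_ball, dist_zero_right, norm_smul, norm_inv, Real.norm_of_nonneg hε.le,
      inv_mul_lt_iff₀ hε, mul_one] at this
    exact hx (by simpa using this)
  have hden : 0 < ε ^ d * Z := by positivity
  refine ⟨fun x => ((b0 (ε⁻¹ • x) / (ε ^ d * Z) : ℝ) : ℂ), ?_, ?_, ?_, ?_, ?_, ?_, ?_⟩
  · exact ofRealCLM.contDiff.comp (hsc.div_const _)
  · intro x hx; simp [hz x hx]
  · apply HasCompactSupport.intro (isCompact_closedBall (0 : EE n) ε)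
    intro x hx
    rw [hz x (fun h => hx (ball_subset_closedBall h))]; simp
  · have h1 : ∫ x : EE n, b0 (ε⁻¹ • x) = ε ^ d * Z := by
      rw [Measure.integral_comp_inv_smul_of_nonneg _ _ hε.le, smul_eq_mul]
    have h2 : ∫ x : EE n, ((b0 (ε⁻¹ • x) / (ε ^ d * Z) : ℝ) : ℂ) =
        ((∫ x : EE n, b0 (ε⁻¹ • x) / (ε ^ d * Z) : ℝ) : ℂ) := integral_ofReal
    rw [h2, integral_div, h1, div_self hden.ne', ofReal_one]
  · intro x
    rw [norm_real, norm_div, Real.norm_of_nonneg hden.le, Real.norm_of_nonneg (show 0 ≤ b0 (ε⁻¹ • x) from Real.smoothTransition.nonneg _),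
      hV ε hε]
    have : b0 (ε⁻¹ • x) ≤ 1 := Real.smoothTransition.le_one _
    have e : (1 + C1) * vb n 1 / Z / (ε ^ d * vb n 1) = (1 + C1) / (ε ^ d * Z) := by
      field_simp
    rw [e]; gcongr; linarith
  · intro x
    have h1 : HasFDerivAt (fun x : EE n => b0 (ε⁻¹ • x)) ((fderiv ℝ b0 (ε⁻¹ • x)).comp
        (ε⁻¹ • ContinuousLinearMap.id ℝ (EE n))) x :=
      ((b0_cd.differentiable (by simp)) _).hasFDerivAt.comp x (ε⁻¹ • ContinuousLinearMap.id ℝ (EE n)).hasFDerivAt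
    have h2 : HasFDerivAt (fun x : EE n => ((b0 (ε⁻¹ • x) / (ε ^ d * Z) : ℝ) : ℂ))
        (ofRealCLM.comp ((ε ^ d * Z)⁻¹ • ((fderiv ℝ b0 (ε⁻¹ • x)).comp
        (ε⁻¹ • ContinuousLinearMap.id ℝ (EE n))))) x := by
      have h3 : HasFDerivAt (fun x : EE n => b0 (ε⁻¹ • x) / (ε ^ d * Z)) ((ε ^ d * Z)⁻¹ • ((fderiv ℝ b0 (ε⁻¹ • x)).comp
        (ε⁻¹ • ContinuousLinearMap.id ℝ (EE n)))) x := by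
        have h4 := h1.const_mul (ε ^ d * Z)⁻¹
        have e : (fun x : EE n => b0 (ε⁻¹ • x) / (ε ^ d * Z)) = fun x => (ε ^ d * Z)⁻¹ * b0 (ε⁻¹ • x) := by
          ext x; rw [div_eq_inv_mul]
        rw [e]; exact h4
      exact ofRealCLM.hasFDerivAt.comp x h3
    rw [h2.fderiv, hV ε hε]
    have e : (1 + C1) * vb n 1 / Z / (ε * (ε ^ d * vb n 1)) = (ε ^ d * Z)⁻¹ * ((1 + C1) * ε⁻¹) := by
      field_simp
    rw [e]
    refine ContinuousLinearMap.opNorm_le_bound _ (by positivity) fun u => ?_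
    simp only [ContinuousLinearMap.comp_apply, smul_apply, ofRealCLM_apply, norm_real, norm_smul, norm_mul,
      ContinuousLinearMap.id_apply, map_smul, norm_inv]
    rw [Real.norm_of_nonneg hε.le, Real.norm_of_nonneg hZp.le, norm_pow, Real.norm_of_nonneg hε.le]
    have h3 := (fderiv ℝ b0 (ε⁻¹ • x)).le_opNorm u
    have h4 := hC1 (ε⁻¹ • x)
    have h5 : ε⁻¹ * ‖fderiv ℝ b0 (ε⁻¹ • x) u‖ ≤ (1 + C1) * ε⁻¹ * ‖u‖ := by
      calc ε⁻¹ * ‖fderiv ℝ b0 (ε⁻¹ • x) u‖ ≤ ε⁻¹ * ((1 + C1) * ‖u‖) := by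
            gcongr; refine h3.trans ?_; gcongr; linarith
        _ = _ := by ring
    calc _ ≤ (ε ^ d * Z)⁻¹ * ((1 + C1) * ε⁻¹ * ‖u‖) := by gcongr
      _ = _ := by ring
  · intro x y hxy
    simp only [b0, norm_smul, hxy]
end Conv

end PartB3

section PartB4
open MeasureTheory Filter Topology
open scoped ContDiff ComplexConjugate ENNReal

section Tr
variable {n : ℕ}

lemma eLp2 (f : EE n → ℂ) : eLpNorm f 2 volume ^ 2 = ∫⁻ x, ‖f x‖ₑ ^ 2 := by
  have := eLpNorm_nnreal_pow_eq_lintegral (f := f) (p := 2) (μ := volume) (by norm_num)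
  simpa using this

instance factTwoTop : Fact ((2 : ℝ≥0∞) ≠ ⊤) := ⟨by simp⟩

lemma trans_cont_aux {X : Type*} [NormedAddCommGroup X] [MeasurableSpace X] [BorelSpace X]
    (μ : Measure X) [IsLocallyFiniteMeasure μ] [μ.InnerRegularCompactLTTop] [μ.IsAddLeftInvariant]
    {F : X → ℂ} (hF : MemLp F 2 μ) {r : ℝ≥0∞} (hr : 0 < r) :
    ∃ d > 0, ∀ w : X, edist w 0 < d → eLpNorm (fun x => F (w + x) - F x) 2 μ < r := by
  have hc : Continuous (fun w : X => (DomAddAct.mk w +ᵥ hF.toLp : Lp ℂ 2 μ)) := by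
    have h1 : Continuous (fun w : X => (DomAddAct.mk w : (X)ᵈᵃᵃ)) := DomAddAct.continuous_mk
    exact h1.vadd continuous_const
  have ht := hc.tendsto 0
  rw [EMetric.tendsto_nhds_nhds] at ht
  obtain ⟨d, hd, hdd⟩ := ht r hr
  refine ⟨d, hd, fun w hw => ?_⟩
  have h2 := hdd hw
  have e0 : (DomAddAct.mk (0 : X) +ᵥ hF.toLp : Lp ℂ 2 μ) = hF.toLp := by
    rw [DomAddAct.mk_zero, zero_vadd]
  rw [e0, DomAddAct.mk_vadd_toLp, Lp.edist_toLp_toLp] at h2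
  exact h2

lemma trans_cont {F : EE n → ℂ} (hF : MemLp F 2) {δ : ℝ≥0∞} (hδ : 0 < δ) :
    ∃ e : ℝ, 0 < e ∧ ∀ w : EE n, ‖w‖ < e → ∫⁻ x, ‖F (w + x) - F x‖ₑ ^ 2 ≤ δ := by
  obtain ⟨r, hr, hrδ⟩ : ∃ r : ℝ≥0∞, 0 < r ∧ r ^ 2 ≤ δ := by
    by_cases h1 : δ ≤ 1
    · refine ⟨δ, hδ, ?_⟩
      rw [pow_two]; exact mul_le_of_le_one_left (zero_le) h1
    · exact ⟨1, by simp, by simpa using (not_le.1 h1).le⟩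
  obtain ⟨d, hd, hdd⟩ := trans_cont_aux volume hF hr
  obtain ⟨e, he, hed⟩ : ∃ e : ℝ, 0 < e ∧ ENNReal.ofReal e ≤ d := by
    by_cases h : d = ⊤
    · exact ⟨1, one_pos, by simp [h]⟩
    · exact ⟨d.toReal, ENNReal.toReal_pos hd.ne' h, by rw [ENNReal.ofReal_toReal h]⟩
  refine ⟨e, he, fun w hw => ?_⟩
  have h1 : edist w 0 < d := by
    rw [edist_dist, dist_zero_right]
    exact lt_of_lt_of_le ((ENNReal.ofReal_lt_ofReal_iff he).2 hw) hed
  have h2 := (hdd w h1).le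
  refine le_trans ?_ hrδ
  refine le_trans ?_ (pow_le_pow_left₀ zero_le h2 2)
  rw [eLp2]
end Tr

end PartB4

section PartB5
open MeasureTheory Filter Topology
open scoped ContDiff ComplexConjugate ENNReal

section Fr
variable {n : ℕ}

lemma cs_l {α : Type*} [MeasurableSpace α] (μ : Measure α) {h : α → ℝ≥0∞} (hh : AEMeasurable h μ) :
    (∫⁻ x, h x ∂μ) ^ 2 ≤ μ univ * ∫⁻ x, h x ^ 2 ∂μ := by
  have := ENNReal.lintegral_mul_le_Lp_mul_Lq μ (p := 2) (q := 2) (by constructor <;> norm_num) hh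
    (aemeasurable_const (b := (1 : ℝ≥0∞)))
  simp only [Pi.mul_apply, mul_one, ENNReal.rpow_ofNat, one_pow, lintegral_const, one_mul] at this
  have h2 := pow_le_pow_left₀ zero_le this 2
  refine h2.trans (le_of_eq ?_)
  rw [mul_pow, ← ENNReal.rpow_natCast, ← ENNReal.rpow_natCast, ← ENNReal.rpow_mul, ← ENNReal.rpow_mul]
  norm_num
  rw [mul_comm]

lemma fried {F : EE n → ℂ} (hFm : Measurable F) {R : ℝ}
    (hF : MemLp (indicator (closedBall 0 (R + 1)) F) 2) {C : ℝ} (hC : 0 ≤ C) {δ : ℝ≥0∞} (hδ : 0 < δ) :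
    ∃ e : ℝ, 0 < e ∧ e ≤ 1 ∧ ∀ ε, 0 < ε → ε < e → ∀ (r : EE n → ℂ) (κ : EE n → EE n → ℂ),
      (∀ x ∈ closedBall (0 : EE n) R, r x = ∫ y, (F y - F x) * κ x y) →
      (∀ x ∈ closedBall (0 : EE n) R, ∀ y, ‖κ x y‖ ≤ C / vb n ε) →
      (∀ x ∈ closedBall (0 : EE n) R, ∀ y, y ∉ ball x ε → κ x y = 0) →
      ∫⁻ x in closedBall (0 : EE n) R, ‖r x‖ₑ ^ 2 ≤ δ := by
  set F1 := indicator (closedBall 0 (R + 1)) F with hF1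
  have hF1m : Measurable F1 := hFm.indicator measurableSet_closedBall
  obtain ⟨δ', hδ', hδδ⟩ : ∃ δ' : ℝ≥0∞, 0 < δ' ∧ (ENNReal.ofReal C) ^ 2 * δ' ≤ δ := by
    rcases eq_or_ne (ENNReal.ofReal C ^ 2) 0 with h | h
    · exact ⟨1, by simp, by rw [h, zero_mul]; exact zero_le⟩
    · refine ⟨δ / ENNReal.ofReal C ^ 2, ENNReal.div_pos hδ.ne' (by simp), ?_⟩
      exact ENNReal.mul_div_le
  obtain ⟨e, he, hee⟩ := trans_cont hF hδ'
  refine ⟨min e 1, by positivity, min_le_right _ _, fun ε hε hεe r κ hr hκ hκ0 => ?_⟩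
  have hεe1 : ε < e := hεe.trans_le (min_le_left _ _)
  have hε1 : ε < 1 := hεe.trans_le (min_le_right _ _)
  set M := ENNReal.ofReal (C / vb n ε) with hM
  set V := volume (ball (0 : EE n) ε) with hV
  have hMV : M * V = ENNReal.ofReal C := by
    have : V = ENNReal.ofReal (vb n ε) := by
      rw [vb, ENNReal.ofReal_toReal measure_ball_lt_top.ne]
    rw [this, hM, ← ENNReal.ofReal_mul (div_nonneg hC (vb_pos hε).le), div_mul_cancel₀ _ (vb_pos hε).ne']
  have hpt : ∀ x ∈ closedBall (0 : EE n) R, ‖r x‖ₑ ^ 2 ≤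
      M ^ 2 * V * ∫⁻ w in ball (0 : EE n) ε, ‖F1 (w + x) - F1 x‖ₑ ^ 2 := by
    intro x hx
    have hx' : ‖x‖ ≤ R := by simpa using hx
    have h1 : ‖r x‖ₑ ≤ ∫⁻ w in ball (0 : EE n) ε, M * ‖F1 (w + x) - F1 x‖ₑ := by
      rw [hr x hx]
      refine (enorm_integral_le_lintegral_enorm _).trans ?_
      rw [← lintegral_indicator measurableSet_ball]
      rw [← lintegral_add_right_eq_self _ x]
      apply lintegral_mono
      intro w
      dsimp only
      by_cases hw : w ∈ ball (0 : EE n) ε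
      · rw [indicator_of_mem hw, enorm_mul, mul_comm]
        have hw' : ‖w‖ < ε := by simpa using hw
        have e1 : F1 x = F x := indicator_of_mem (by simp; linarith) _
        have e2 : F1 (w + x) = F (w + x) := indicator_of_mem (by
          have := norm_add_le w x
          simp; linarith) _
        rw [e1, e2]
        gcongr
        rw [← ofReal_norm]
        exact ENNReal.ofReal_le_ofReal (hκ x hx _)
      · rw [indicator_of_notMem hw, hκ0 x hx (w + x) (by simpa [dist_eq_norm] using hw)]
        simp
    refine (pow_le_pow_left₀ zero_le h1 2).trans ?_
    refine (cs_l _ ?_).trans ?_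
    · exact ((((hF1m.comp (measurable_id.add_const x)).sub_const _)).enorm.const_mul _).aemeasurable
    · rw [Measure.restrict_apply_univ]
      simp only [mul_pow]
      have hm : Measurable (fun w => ‖F1 (w + x) - F1 x‖ₑ ^ 2) :=
        ((hF1m.comp (measurable_id.add_const x)).sub_const _).enorm.pow_const 2
      rw [lintegral_const_mul _ hm, ← mul_assoc, mul_comm (volume _)]
  have hmeas : Measurable (Function.uncurry fun (x w : EE n) => ‖F1 (w + x) - F1 x‖ₑ ^ 2) := by
    apply Measurable.pow_const
    apply Measurable.enorm
    exact (hF1m.comp (measurable_snd.add measurable_fst)).sub (hF1m.comp measurable_fst)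
  calc ∫⁻ x in closedBall (0 : EE n) R, ‖r x‖ₑ ^ 2
      ≤ ∫⁻ x in closedBall (0 : EE n) R, M ^ 2 * V * ∫⁻ w in ball (0 : EE n) ε, ‖F1 (w + x) - F1 x‖ₑ ^ 2 :=
        setLIntegral_mono' measurableSet_closedBall hpt
    _ ≤ ∫⁻ x, M ^ 2 * V * ∫⁻ w in ball (0 : EE n) ε, ‖F1 (w + x) - F1 x‖ₑ ^ 2 := setLIntegral_le_lintegral _ _
    _ = M ^ 2 * V * ∫⁻ x, ∫⁻ w in ball (0 : EE n) ε, ‖F1 (w + x) - F1 x‖ₑ ^ 2 := by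
        rw [lintegral_const_mul]
        exact hmeas.lintegral_prod_right'
    _ = M ^ 2 * V * ∫⁻ w in ball (0 : EE n) ε, ∫⁻ x, ‖F1 (w + x) - F1 x‖ₑ ^ 2 := by
        rw [lintegral_lintegral_swap hmeas.aemeasurable]
    _ ≤ M ^ 2 * V * ∫⁻ w in ball (0 : EE n) ε, δ' := by
        refine mul_le_mul_right ?_ _
        refine setLIntegral_mono' measurableSet_ball fun w hw => ?_
        exact hee w (lt_trans (by simpa using hw) hεe1)
    _ = (M * V) ^ 2 * δ' := by
        rw [setLIntegral_const]; ring
    _ ≤ δ := by rw [hMV]; exact hδδ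
end Fr

end PartB5

section PartB6
open MeasureTheory Filter Topology
open scoped ContDiff ComplexConjugate ENNReal

section Cacc
variable {n : ℕ}

lemma cacc_pt {a : ℝ} (ha : 0 < a) {η D r h u : ℂ} (hη : conj η = η) :
    1 / 2 * (‖η‖ ^ 2 * ‖D‖ ^ 2 * a) - (2 * (‖η‖ ^ 2 * ‖r‖ ^ 2 / a) + 5 * (a * ‖h‖ ^ 2 * ‖u‖ ^ 2)) ≤
      ((a * D - r) * (2 * η * h * conj u + η ^ 2 * conj D)).re := by
  have e : (a * D - r) * (2 * η * h * conj u + η ^ 2 * conj D) =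
      ((a * ‖η‖ ^ 2 * ‖D‖ ^ 2 : ℝ) : ℂ) - (r * (η ^ 2 * conj D) - a * D * (2 * η * h * conj u)
        + r * (2 * η * h * conj u)) := by
    have h1 : ((‖η‖ ^ 2 : ℝ) : ℂ) = η ^ 2 := by
      rw [← normSq_eq_norm_sq, ← mul_conj, hη]; ring
    have h2 : ((‖D‖ ^ 2 : ℝ) : ℂ) = D * conj D := by
      rw [← normSq_eq_norm_sq, ← mul_conj]
    rw [ofReal_mul, ofReal_mul, h1, h2]
    ring
  rw [e, sub_re, ofReal_re]
  have h3 : (r * (η ^ 2 * conj D) - a * D * (2 * η * h * conj u)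
        + r * (2 * η * h * conj u)).re ≤ ‖r‖ * (‖η‖ ^ 2 * ‖D‖) + a * ‖D‖ * (2 * ‖η‖ * ‖h‖ * ‖u‖) +
        ‖r‖ * (2 * ‖η‖ * ‖h‖ * ‖u‖) := by
    refine (re_le_norm _).trans ((norm_add_le _ _).trans ?_)
    refine add_le_add ((norm_sub_le _ _).trans (add_le_add ?_ ?_)) ?_ <;>
      simp [abs_of_pos ha]
  have h4 : 0 ≤ a * (‖η‖ * ‖D‖ / 2 - ‖η‖ * ‖r‖ / a) ^ 2 := by positivity
  have h5 : 0 ≤ a * (‖η‖ * ‖D‖ / 2 - 2 * (‖h‖ * ‖u‖)) ^ 2 := by positivity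
  have h6 : 0 ≤ a * (‖η‖ * ‖r‖ / a - (‖h‖ * ‖u‖)) ^ 2 := by positivity
  have e4 : a * (‖η‖ * ‖D‖ / 2 - ‖η‖ * ‖r‖ / a) ^ 2 = a * ‖η‖ ^ 2 * ‖D‖ ^ 2 / 4 - ‖η‖ ^ 2 * ‖D‖ * ‖r‖ + ‖η‖ ^ 2 * ‖r‖ ^ 2 / a := by
    field_simp; ring
  have e6 : a * (‖η‖ * ‖r‖ / a - (‖h‖ * ‖u‖)) ^ 2 = ‖η‖ ^ 2 * ‖r‖ ^ 2 / a - 2 * ‖η‖ * ‖r‖ * ‖h‖ * ‖u‖ + a * ‖h‖ ^ 2 * ‖u‖ ^ 2 := by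
    field_simp; ring
  rw [e4] at h4
  rw [e6] at h6
  linarith

lemma cacc {φ : EE n → ℝ} (hφ : ContDiff ℝ ∞ φ) {u : EE n → ℂ} (hu : ContDiff ℝ ∞ u)
    {B : Fin n → EE n → ℂ} (hB : ∀ j, ContDiff ℝ ∞ (B j)) (hdiv : ∀ x, ∑ j, wd (-I) j (B j) x = 0)
    {η : EE n → ℂ} (hη : ContDiff ℝ ∞ η) (hηs : HasCompactSupport η) (hηc : ∀ x, conj (η x) = η x) :
    ∫ x, ∑ j, ‖η x‖ ^ 2 * ‖wd I j u x‖ ^ 2 * Real.exp (-φ x) ≤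
      ∫ x, ∑ j, (4 * (‖η x‖ ^ 2 * ‖wgt φ x * wd I j u x - B j x‖ ^ 2 / Real.exp (-φ x)) +
        10 * (Real.exp (-φ x) * ‖wd (-I) j η x‖ ^ 2 * ‖u x‖ ^ 2)) := by
  have hce : Continuous (fun x => Real.exp (-φ x)) := Real.continuous_exp.comp hφ.continuous.neg
  have hen : ∀ x, Real.exp (-φ x) ≠ 0 := fun x => (Real.exp_pos _).ne'
  have cu := fun j : Fin n => (wd_contDiff (s := I) (j := j) hu)
  have ce := fun j : Fin n => (wd_contDiff (s := -I) (j := j) hη)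
  set W : EE n → ℂ := fun x => η x ^ 2 * conj (u x) with hW
  have hWc : ContDiff ℝ ∞ W := (hη.pow 2).mul (conj_cd hu)
  have hWs : HasCompactSupport W := by
    have : HasCompactSupport (fun x => η x ^ 2) := hηs.comp_left (g := fun z : ℂ => z ^ 2) (by simp)
    exact this.mul_right
  have hdW : ∀ j x, wd (-I) j W x = 2 * η x * wd (-I) j η x * conj (u x) + η x ^ 2 * conj (wd I j u x) := by
    intro j x
    have e1 : wd (-I) j (fun y => conj (u y)) x = conj (wd I j u x) := by
      rw [wd_conj (hu.differentiable (by simp) x)]; simp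
    have e2 : wd (-I) j (fun y => η y ^ 2) x = 2 * η x * wd (-I) j η x := by
      simp only [pow_two]
      rw [wd_mul (hη.differentiable (by simp) x) (hη.differentiable (by simp) x)]; ring
    rw [hW, wd_mul ((hη.pow 2).differentiable (by simp) x) ((conj_cd hu).differentiable (by simp) x), e1, e2]
  have key : ∫ x, ∑ j, B j x * wd (-I) j W x = 0 := by
    have i : ∀ j, Integrable (fun x => B j x * wd (-I) j W x) := fun j =>
      int_cs ((hB j).mul (wd_contDiff hWc)) (wd_hcs hWs).mul_left
    have i2 : ∀ j, Integrable (fun x => wd (-I) j (B j) x * W x) := fun j =>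
      int_cs ((wd_contDiff (hB j)).mul hWc) hWs.mul_left
    have e := fun j => ibp (s := -I) (j := j) (hB j) hWc (Or.inr hWs)
    rw [integral_finsetSum _ (fun j _ => i j)]
    have e2 : ∑ j, ∫ x, B j x * wd (-I) j W x = - ∑ j, ∫ x, wd (-I) j (B j) x * W x := by
      rw [← Finset.sum_neg_distrib]
      exact Finset.sum_congr rfl fun j _ => by rw [e j, neg_neg]
    rw [e2, ← integral_finsetSum _ (fun j _ => i2 j)]
    simp only [← Finset.sum_mul, hdiv, zero_mul, integral_zero, neg_zero]
  have iK : Integrable (fun x => ∑ j, B j x * wd (-I) j W x) :=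
    integrable_finsetSum _ fun j _ => int_cs ((hB j).mul (wd_contDiff hWc)) (wd_hcs hWs).mul_left
  have keyre : ∫ x, (∑ j, B j x * wd (-I) j W x).re = 0 := by
    have a1 := integral_re iK
    simp only [RCLike.re_to_complex] at a1
    rw [a1, key, zero_re]
  have hη0 : ∀ x, x ∉ tsupport η → η x = 0 ∧ ∀ j, wd (-I) j η x = 0 := fun x hx =>
    ⟨image_eq_zero_of_notMem_tsupport hx, fun j => by
      by_contra h'; exact hx (wd_support h')⟩
  have iL : Integrable (fun x => ∑ j, ‖η x‖ ^ 2 * ‖wd I j u x‖ ^ 2 * Real.exp (-φ x)) := by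
    apply Continuous.integrable_of_hasCompactSupport
    · exact continuous_finsetSum _ fun j _ => ((hη.continuous.norm.pow 2).mul ((cu j).continuous.norm.pow 2)).mul hce
    · apply HasCompactSupport.intro hηs
      intro x hx
      simp [(hη0 x hx).1]
  have iR : Integrable (fun x => ∑ j, (4 * (‖η x‖ ^ 2 * ‖wgt φ x * wd I j u x - B j x‖ ^ 2 / Real.exp (-φ x)) +
        10 * (Real.exp (-φ x) * ‖wd (-I) j η x‖ ^ 2 * ‖u x‖ ^ 2))) := by
    apply Continuous.integrable_of_hasCompactSupport
    · refine continuous_finsetSum _ fun j _ => ?_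
      refine (continuous_const.mul ?_).add (continuous_const.mul ?_)
      · refine Continuous.div ?_ hce hen
        exact (hη.continuous.norm.pow 2).mul
          ((((wgt_cd hφ).continuous.mul (cu j).continuous).sub (hB j).continuous).norm.pow 2)
      · exact (hce.mul ((ce j).continuous.norm.pow 2)).mul (hu.continuous.norm.pow 2)
    · apply HasCompactSupport.intro hηs
      intro x hx
      simp [(hη0 x hx).1, (hη0 x hx).2]
  have main : ∫ x, (1 / 2 * (∑ j, ‖η x‖ ^ 2 * ‖wd I j u x‖ ^ 2 * Real.exp (-φ x)) -
      1 / 2 * ∑ j, (4 * (‖η x‖ ^ 2 * ‖wgt φ x * wd I j u x - B j x‖ ^ 2 / Real.exp (-φ x)) +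
        10 * (Real.exp (-φ x) * ‖wd (-I) j η x‖ ^ 2 * ‖u x‖ ^ 2))) ≤
      ∫ x, (∑ j, B j x * wd (-I) j W x).re := by
    apply integral_mono ((iL.const_mul _).sub (iR.const_mul _)) iK.re
    intro x
    show 1 / 2 * (∑ j, ‖η x‖ ^ 2 * ‖wd I j u x‖ ^ 2 * Real.exp (-φ x)) -
      1 / 2 * ∑ j, (4 * (‖η x‖ ^ 2 * ‖wgt φ x * wd I j u x - B j x‖ ^ 2 / Real.exp (-φ x)) +
        10 * (Real.exp (-φ x) * ‖wd (-I) j η x‖ ^ 2 * ‖u x‖ ^ 2)) ≤ (∑ j, B j x * wd (-I) j W x).re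
    rw [Finset.mul_sum, Finset.mul_sum, ← Finset.sum_sub_distrib, re_sum]
    refine Finset.sum_le_sum fun j _ => ?_
    have := cacc_pt (Real.exp_pos (-φ x)) (D := wd I j u x) (r := wgt φ x * wd I j u x - B j x)
      (h := wd (-I) j η x) (u := u x) (hηc x)
    have e : ((Real.exp (-φ x) : ℝ) : ℂ) * wd I j u x - (wgt φ x * wd I j u x - B j x) = B j x := by
      rw [wgt]; ring
    rw [e, ← hdW] at this
    linarith
  rw [keyre, integral_sub (iL.const_mul _) (iR.const_mul _), integral_const_mul, integral_const_mul] at main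
  linarith
end Cacc

end PartB6

section PartB7
open MeasureTheory Filter Topology
open scoped ContDiff ComplexConjugate ENNReal

section Weak
variable {n : ℕ}

lemma wd_refl {β : EE n → ℂ} (hβ : ContDiff ℝ ∞ β) (s : ℂ) (j : Fin n) (x y : EE n) :
    wd s j (fun y => β (x - y)) y = - wd s j β (x - y) := by
  have h : HasFDerivAt (fun y => β (x - y)) ((fderiv ℝ β (x - y)).comp (-ContinuousLinearMap.id ℝ (EE n))) y :=
    (hβ.differentiable (by simp) (x - y)).hasFDerivAt.comp y ((hasFDerivAt_id y).const_sub x)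
  unfold wd
  rw [h.fderiv]
  simp only [ContinuousLinearMap.comp_apply, neg_apply, ContinuousLinearMap.id_apply, map_neg]
  ring

lemma refl_cd {β : EE n → ℂ} (hβ : ContDiff ℝ ∞ β) (x : EE n) : ContDiff ℝ ∞ (fun y => β (x - y)) :=
  hβ.comp (contDiff_const.sub contDiff_id)

lemma refl_cs {β : EE n → ℂ} (hβ : HasCompactSupport β) (x : EE n) : HasCompactSupport (fun y => β (x - y)) :=
  hβ.comp_homeomorph (Homeomorph.subLeft x)

lemma int_wd_zero {f : EE n → ℂ} (hf : ContDiff ℝ ∞ f) (hs : HasCompactSupport f) (s : ℂ) (j : Fin n) :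
    ∫ x, wd s j f x = 0 := by
  have := ibp (s := s) (j := j) hf (contDiff_const (c := (1 : ℂ))) (Or.inl hs)
  simpa [wd] using this

lemma wd_zero_off {b : EE n → ℂ} (hb : ContDiff ℝ ∞ b) {ε : ℝ} (hε : 0 < ε)
    (h0 : ∀ x, x ∉ ball 0 ε → b x = 0) (s : ℂ) (j : Fin n) {x : EE n} (hx : x ∉ ball 0 ε) : wd s j b x = 0 := by
  have hx' : x ∈ closure (closedBall (0 : EE n) ε)ᶜ := by
    rw [closure_compl, interior_closedBall _ hε.ne']; exact hx
  have hcl : IsClosed {x | wd s j b x = 0} := isClosed_eq (wd_contDiff hb).continuous continuous_const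
  refine hcl.closure_subset_iff.2 ?_ hx'
  intro y hy
  by_contra h
  have h1 : y ∈ tsupport b := wd_support h
  have h2 : tsupport b ⊆ closedBall 0 ε := by
    apply closure_minimal _ isClosed_closedBall
    intro z hz
    by_contra h3
    exact hz (h0 z fun h4 => h3 (ball_subset_closedBall h4))
  exact hy (h2 h1)

variable {φ : EE n → ℝ} {F : EE n → ℂ}

lemma loc_int (hφ : ContDiff ℝ ∞ φ) (hF : MemLp (fun x => F x * hwt φ x) 2) : LocallyIntegrable F := by
  have h1 := hF.locallyIntegrable (by norm_num)
  have h2 := h1.mul_continuous ((hwt_cd hφ).continuous.inv₀ hwt_ne)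
  have e : (fun x => F x * hwt φ x * (hwt φ)⁻¹ x) = F := by
    ext x
    simp [hwt_ne]
  rwa [e] at h2

lemma loc_L2 (hφ : ContDiff ℝ ∞ φ) (hFm : Measurable F) (hF : MemLp (fun x => F x * hwt φ x) 2) (R : ℝ) :
    MemLp (indicator (closedBall 0 R) F) 2 := by
  obtain ⟨M, hM⟩ := (isCompact_closedBall (0 : EE n) R).exists_bound_of_continuousOn
    ((hwt_cd hφ).continuous.inv₀ hwt_ne).continuousOn
  refine hF.of_le_mul (c := |M|) (hFm.indicator measurableSet_closedBall).aestronglyMeasurable (Eventually.of_forall fun x => ?_)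
  by_cases hx : x ∈ closedBall (0 : EE n) R
  · rw [indicator_of_mem hx]
    have := hM x hx
    rw [norm_mul]
    calc ‖F x‖ = ‖(hwt φ x)⁻¹‖ * (‖F x‖ * ‖hwt φ x‖) := by
          rw [norm_inv]; field_simp [norm_ne_zero_iff.2 (hwt_ne (φ := φ) x)]
      _ ≤ _ := mul_le_mul_of_nonneg_right (this.trans (le_abs_self M)) (by positivity)
  · rw [indicator_of_notMem hx, norm_zero]
    positivity

lemma approx (hφ : ContDiff ℝ ∞ φ) (hFm : Measurable F) (hF : MemLp (fun x => F x * hwt φ x) 2)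
    (hw : ∀ G : EE n → ℂ, ContDiff ℝ ∞ G → HasCompactSupport G →
        ∫ x, F x * ∑ j, wd I j (fun y => wgt φ y * wd (-I) j G y) x = 0) {R : ℝ} (hR : 0 ≤ R) {δ : ℝ≥0∞} (hδ : 0 < δ) :
    ∃ (u : EE n → ℂ) (B : Fin n → EE n → ℂ), ContDiff ℝ ∞ u ∧ (∀ j, ContDiff ℝ ∞ (B j)) ∧
      (∀ x, ∑ j, wd (-I) j (B j) x = 0) ∧
      (∀ j, ∫⁻ x in closedBall (0 : EE n) R, ‖wgt φ x * wd I j u x - B j x‖ₑ ^ 2 ≤ δ) ∧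
      ∫⁻ x in closedBall (0 : EE n) R, ‖u x - F x‖ₑ ^ 2 ≤ δ := by
  have hFl := loc_int hφ hF
  have hac := wgt_cd hφ
  obtain ⟨C, hC, hm⟩ := exists_moll n
  obtain ⟨L, hL⟩ := (isCompact_closedBall (0 : EE n) (R + 1)).exists_bound_of_continuousOn
    (hac.continuous_fderiv (by simp)).continuousOn
  have hL0 : 0 ≤ L := (norm_nonneg _).trans (hL 0 (by simp; linarith))
  obtain ⟨e, he, he1, hfr⟩ := fried hFm (loc_L2 hφ hFm hF (R + 1)) (C := C + 2 * L * C) (by positivity) hδ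
  obtain ⟨β, hβ, hβ0, hβs, hβ1, hβb, hβd, -⟩ := hm (e / 2) (by linarith)
  set ε := e / 2 with hε
  have hε0 : 0 < ε := by rw [hε]; linarith
  have hvb : 0 < vb n ε := vb_pos hε0
  have hfa : LocallyIntegrable (fun y => F y * wgt φ y) := hFl.mul_continuous hac.continuous
  have hfda : ∀ j, LocallyIntegrable (fun y => F y * wd I j (wgt φ) y) := fun j =>
    hFl.mul_continuous (wd_contDiff hac).continuous
  have hβj : ∀ s j, ContDiff ℝ ∞ (wd s j β) := fun s j => wd_contDiff hβ
  have hβjs : ∀ s j, HasCompactSupport (wd s j β) := fun s j => wd_hcs hβs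
  refine ⟨cv F β, fun j x => cv (fun y => F y * wgt φ y) (wd I j β) x -
    cv (fun y => F y * wd I j (wgt φ) y) β x, cv_cd hFl hβ hβs, fun j => (cv_cd hfa (hβj _ _) (hβjs _ _)).sub
      (cv_cd (hfda j) hβ hβs), fun x => ?_, fun j => ?_, ?_⟩
  · rw [← hw (fun y => β (x - y)) (refl_cd hβ x) (refl_cs hβs x)]
    have e1 : ∀ j, wd (-I) j (fun x => cv (fun y => F y * wgt φ y) (wd I j β) x -
        cv (fun y => F y * wd I j (wgt φ) y) β x) x =
        ∫ y, F y * wd I j (fun z => wgt φ z * wd (-I) j (fun y => β (x - y)) z) y := by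
      intro j
      rw [wd_sub ((cv_cd hfa (hβj _ _) (hβjs _ _)).differentiable (by simp) x)
        ((cv_cd (hfda j) hβ hβs).differentiable (by simp) x), cv_wd hfa (hβj _ _) (hβjs _ _), cv_wd (hfda j) hβ hβs,
        cv, cv, ← integral_sub (cv_int hfa (wd_contDiff (hβj _ _)).continuous (wd_hcs (hβjs _ _)) x)
          (cv_int (hfda j) (hβj _ _).continuous (hβjs _ _) x)]
      congr 1
      ext y
      have e2 : (fun z => wgt φ z * wd (-I) j (fun y => β (x - y)) z) =
          fun z => wgt φ z * ((-1) * (wd (-I) j β) (x - z)) := by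
        ext z; rw [wd_refl hβ]; ring
      have c2 := refl_cd (hβj (-I) j) x
      rw [e2, wd_mul (hac.differentiable (by simp) y) ((contDiff_const.mul c2).differentiable (by simp) y),
        wd_const_mul _ (c2.differentiable (by simp) y), wd_refl (hβj _ _), wd_comm hβ]
      ring
    rw [Finset.sum_congr rfl fun j _ => e1 j, ← integral_finsetSum]
    · simp only [Finset.mul_sum]
    · intro j _
      apply LocallyIntegrable.integrable_smul_right_of_hasCompactSupport hFl
      · exact (wd_contDiff (hac.mul (wd_contDiff (refl_cd hβ x)))).continuous
      · exact wd_hcs ((wd_hcs (refl_cs hβs x)).mul_left)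
  · apply hfr ε hε0 (by linarith) _ (fun x y => (wgt φ x - wgt φ y) * wd I j β (x - y) + wd I j (wgt φ) y * β (x - y))
    · intro x hx
      have hH : ContDiff ℝ ∞ (fun y => (wgt φ x - wgt φ y) * β (x - y)) :=
        (contDiff_const.sub hac).mul (refl_cd hβ x)
      have hHs : HasCompactSupport (fun y => (wgt φ x - wgt φ y) * β (x - y)) := (refl_cs hβs x).mul_left
      have e1 : ∀ y, (wgt φ x - wgt φ y) * wd I j β (x - y) + wd I j (wgt φ) y * β (x - y) =
          - wd I j (fun y => (wgt φ x - wgt φ y) * β (x - y)) y := by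
        intro y
        rw [wd_mul ((contDiff_const.sub hac).differentiable (by simp) y) ((refl_cd hβ x).differentiable (by simp) y),
          wd_sub (by fun_prop) (hac.differentiable (by simp) y), wd_refl hβ]
        simp [wd]
      have i1 : Integrable (fun y => F y * ((wgt φ x - wgt φ y) * wd I j β (x - y) + wd I j (wgt φ) y * β (x - y))) := by
        simp only [e1]
        exact hFl.integrable_smul_right_of_hasCompactSupport (wd_contDiff hH).continuous.neg (wd_hcs hHs).neg
      have i2 : Integrable (fun y => F x * ((wgt φ x - wgt φ y) * wd I j β (x - y) + wd I j (wgt φ) y * β (x - y))) := by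
        simp only [e1]
        exact (int_cs (wd_contDiff hH) (wd_hcs hHs)).neg.const_mul _
      simp only [sub_mul (F _)]
      rw [integral_sub i1 i2, integral_const_mul]
      have i3 : ∫ y, ((wgt φ x - wgt φ y) * wd I j β (x - y) + wd I j (wgt φ) y * β (x - y)) = 0 := by
        simp only [e1]
        rw [integral_neg, int_wd_zero hH hHs, neg_zero]
      rw [i3, mul_zero, sub_zero, cv_wd hFl hβ hβs, cv, cv, cv, ← integral_const_mul,
        ← integral_sub (cv_int hfa (hβj _ _).continuous (hβjs _ _) x) (cv_int (hfda j) hβ.continuous hβs x)]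
      refine (integral_sub ((cv_int hFl (hβj _ _).continuous (hβjs _ _) x).const_mul _)
        ((cv_int hfa (hβj _ _).continuous (hβjs _ _) x).sub (cv_int (hfda j) hβ.continuous hβs x))).symm.trans ?_
      congr 1
      ext y
      simp only [Pi.sub_apply]
      ring
    · intro x hx y
      by_cases hy : y ∈ ball x ε
      · have hx1 : x ∈ closedBall (0 : EE n) (R + 1) := closedBall_subset_closedBall (by linarith) hx
        have hy1 : y ∈ closedBall (0 : EE n) (R + 1) := by
          rw [mem_closedBall_zero_iff] at hx ⊢
          rw [mem_ball, dist_eq_norm] at hy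
          calc ‖y‖ = ‖x + (y - x)‖ := by congr 1; abel
            _ ≤ ‖x‖ + ‖y - x‖ := norm_add_le _ _
            _ ≤ _ := by linarith
        have h1 : ‖wgt φ x - wgt φ y‖ ≤ L * ε := by
          have h2 := Convex.norm_image_sub_le_of_norm_fderiv_le (𝕜 := ℝ)
            (fun x _ => hac.differentiable (by simp) x) hL (convex_closedBall _ _) hy1 hx1
          refine h2.trans (mul_le_mul_of_nonneg_left ?_ hL0)
          rw [mem_ball, dist_comm, dist_eq_norm] at hy
          exact hy.le
        have h2 : ‖wd I j β (x - y)‖ ≤ C / (ε * vb n ε) := (wd_norm_le _ (by simp) _ _ _).trans (hβd _)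
        have h3 : ‖wd I j (wgt φ) y‖ ≤ L := (wd_norm_le _ (by simp) _ _ _).trans (hL y hy1)
        calc _ ≤ ‖wgt φ x - wgt φ y‖ * ‖wd I j β (x - y)‖ + ‖wd I j (wgt φ) y‖ * ‖β (x - y)‖ := by
              refine (norm_add_le _ _).trans ?_
              rw [norm_mul, norm_mul]
          _ ≤ L * ε * (C / (ε * vb n ε)) + L * (C / vb n ε) := by
              gcongr
              exact hβb _
          _ = (2 * L * C) / vb n ε := by field_simp; ring
          _ ≤ _ := by gcongr; linarith
      · have hxy : x - y ∉ ball 0 ε := by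
          rwa [mem_ball_zero_iff, ← dist_eq_norm, dist_comm, ← mem_ball]
        rw [hβ0 _ hxy, wd_zero_off hβ hε0 hβ0 I j hxy]
        simp only [mul_zero, add_zero, norm_zero]
        positivity
    · intro x hx y hy
      have hxy : x - y ∉ ball 0 ε := by
        rwa [mem_ball_zero_iff, ← dist_eq_norm, dist_comm, ← mem_ball]
      rw [hβ0 _ hxy, wd_zero_off hβ hε0 hβ0 I j hxy]
      simp
  · apply hfr ε hε0 (by linarith) _ (fun x y => β (x - y))
    · intro x hx
      simp only [sub_mul (F _)]
      rw [integral_sub (cv_int hFl hβ.continuous hβs x) ((int_cs (refl_cd hβ x) (refl_cs hβs x)).const_mul _),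
        integral_const_mul, integral_sub_left_eq_self, hβ1, mul_one, cv]
    · intro x hx y
      refine (hβb _).trans ?_
      gcongr
      nlinarith
    · intro x hx y hy
      apply hβ0
      rwa [mem_ball_zero_iff, ← dist_eq_norm, dist_comm, ← mem_ball]

end Weak

end PartB7

section PartB8
open MeasureTheory Filter Topology
open scoped ContDiff ComplexConjugate ENNReal

section Weak2
variable {n : ℕ}

lemma cutoff (n : ℕ) : ∃ C0 : ℝ, 0 ≤ C0 ∧ ∀ R : ℝ, 0 < R → ∃ η : EE n → ℂ, ContDiff ℝ ∞ η ∧ HasCompactSupport η ∧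
    (∀ x, conj (η x) = η x) ∧ (∀ x, ‖η x‖ ≤ 1) ∧ (∀ x, ‖x‖ ≤ R → η x = 1) ∧ (∀ x, 2 * R ≤ ‖x‖ → η x = 0) ∧
    (∀ x, ‖fderiv ℝ η x‖ ≤ C0 / R) ∧ tsupport η ⊆ closedBall 0 (2 * R) := by
  set f : EE n → ℂ := fun x => ((Real.smoothTransition (2 - ‖x‖ ^ 2) : ℝ) : ℂ) with hf
  have hfc : ContDiff ℝ ∞ f :=
    ofRealCLM.contDiff.comp (Real.smoothTransition.contDiff.comp (contDiff_const.sub (contDiff_norm_sq ℝ)))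
  have hf0 : ∀ x, 2 ≤ ‖x‖ → f x = 0 := by
    intro x hx
    simp only [hf, ofReal_eq_zero]
    apply Real.smoothTransition.zero_of_nonpos
    nlinarith
  have hfs : HasCompactSupport f := by
    apply HasCompactSupport.intro (isCompact_closedBall (0 : EE n) 2)
    intro x hx
    apply hf0
    rw [mem_closedBall_zero_iff] at hx
    exact (not_le.1 hx).le
  obtain ⟨C0, hC0⟩ := (hfs.fderiv ℝ).exists_bound_of_continuous (hfc.continuous_fderiv (by simp))
  refine ⟨C0, (norm_nonneg _).trans (hC0 0), fun R hR => ?_⟩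
  have hz : ∀ x : EE n, 2 * R ≤ ‖x‖ → f (R⁻¹ • x) = 0 := by
    intro x hx
    apply hf0
    rw [norm_smul, norm_inv, Real.norm_of_nonneg hR.le, ← div_eq_inv_mul, le_div_iff₀ hR]
    exact hx
  refine ⟨fun x => f (R⁻¹ • x), hfc.comp (contDiff_const_smul _), ?_, fun x => conj_ofReal _, fun x => ?_, fun x hx => ?_, hz, fun x => ?_, ?_⟩
  · apply HasCompactSupport.intro (isCompact_closedBall (0 : EE n) (2 * R))
    intro x hx
    apply hz
    rw [mem_closedBall_zero_iff] at hx
    exact (not_le.1 hx).le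
  · simp only [hf, norm_real, Real.norm_of_nonneg (Real.smoothTransition.nonneg _)]
    exact Real.smoothTransition.le_one _
  · simp only [hf, ofReal_eq_one]
    apply Real.smoothTransition.one_of_one_le
    have : ‖R⁻¹ • x‖ ≤ 1 := by
      rw [norm_smul, norm_inv, Real.norm_of_nonneg hR.le, ← div_eq_inv_mul, div_le_one hR]; exact hx
    nlinarith [norm_nonneg (R⁻¹ • x)]
  · have h : HasFDerivAt (fun x => f (R⁻¹ • x)) ((fderiv ℝ f (R⁻¹ • x)).comp (R⁻¹ • ContinuousLinearMap.id ℝ (EE n))) x :=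
      (hfc.differentiable (by simp) _).hasFDerivAt.comp x ((hasFDerivAt_id x).const_smul R⁻¹)
    rw [h.fderiv]
    refine (ContinuousLinearMap.opNorm_comp_le _ _).trans ?_
    rw [div_eq_mul_inv]
    refine mul_le_mul (hC0 _) ?_ (norm_nonneg _) ((norm_nonneg _).trans (hC0 0))
    rw [norm_smul, norm_inv, Real.norm_of_nonneg hR.le]
    exact mul_le_of_le_one_right (by positivity) ContinuousLinearMap.norm_id_le
  · apply closure_minimal _ isClosed_closedBall
    intro x hx
    by_contra h
    rw [mem_closedBall_zero_iff] at h
    exact hx (hz x (not_le.1 h).le)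

lemma set_sq {h : EE n → ℂ} {S : Set (EE n)} (hm : AEStronglyMeasurable h) {δ : ℝ} (hδ : 0 ≤ δ)
    (hl : ∫⁻ x in S, ‖h x‖ₑ ^ 2 ≤ ENNReal.ofReal δ) :
    IntegrableOn (fun x => ‖h x‖ ^ 2) S ∧ ∫ x in S, ‖h x‖ ^ 2 ≤ δ := by
  have e : ∀ x, ENNReal.ofReal (‖h x‖ ^ 2) = ‖h x‖ₑ ^ 2 := fun x => by
    rw [ENNReal.ofReal_pow (norm_nonneg _), ofReal_norm]
  have hm2 : AEStronglyMeasurable (fun x => ‖h x‖ ^ 2) (volume.restrict S) := (hm.norm.pow 2).restrict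
  refine ⟨⟨hm2, ?_⟩, ?_⟩
  · rw [hasFiniteIntegral_iff_ofReal (Eventually.of_forall fun x => by positivity)]
    simp only [e]
    exact hl.trans_lt ENNReal.ofReal_lt_top
  · rw [integral_eq_lintegral_of_nonneg_ae (Eventually.of_forall fun x => by positivity) hm2]
    simp only [e]
    exact ENNReal.toReal_le_of_le_ofReal hδ hl

variable {φ : EE n → ℝ} {F : EE n → ℂ}

lemma weak_est (hφ : ContDiff ℝ ∞ φ) (hFm : Measurable F) (hF : MemLp (fun x => F x * hwt φ x) 2)
    (hw : ∀ G : EE n → ℂ, ContDiff ℝ ∞ G → HasCompactSupport G →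
        ∫ x, F x * ∑ j, wd I j (fun y => wgt φ y * wd (-I) j G y) x = 0)
    {t : EE n → ℂ} (ht : ContDiff ℝ ∞ t) (hts : HasCompactSupport t) (j : Fin n) :
    ∃ K : ℝ, ∃ R0 : ℝ, 0 < R0 ∧ ∀ R, R0 < R → ∃ A : ℝ, 0 ≤ A ∧ ∀ δ, 0 < δ → ∀ l, 0 < l →
      ‖∫ x, F x * wd I j t x‖ ≤ l⁻¹ * K + l * (K / R ^ 2 + A * δ) := by
  obtain ⟨C0, hC0, hcut⟩ := cutoff n
  set Λ := ∫ x, ‖F x‖ ^ 2 * Real.exp (-φ x) with hΛ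
  have hΛi : Integrable (fun x => ‖F x‖ ^ 2 * Real.exp (-φ x)) := by
    have := hF.norm.integrable_sq
    refine this.congr (Eventually.of_forall fun x => ?_)
    simp only [norm_mul, mul_pow, norm_hwt_sq]
  have hΛ0 : 0 ≤ Λ := integral_nonneg fun x => by positivity
  set T := ∫ x, ‖t x‖ ^ 2 * Real.exp (φ x) with hT
  have hTi : Integrable (fun x => ‖t x‖ ^ 2 * Real.exp (φ x)) := by
    apply Continuous.integrable_of_hasCompactSupport
    · exact (ht.continuous.norm.pow 2).mul (Real.continuous_exp.comp hφ.continuous)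
    · apply HasCompactSupport.intro hts
      intro x hx
      simp [image_eq_zero_of_notMem_tsupport hx]
  set T' := ∫ x, ‖wd I j t x‖ ^ 2 with hT'
  have hTi' : Integrable (fun x => ‖wd I j t x‖ ^ 2) := by
    apply Continuous.integrable_of_hasCompactSupport
    · exact ((wd_contDiff ht).continuous.norm.pow 2)
    · apply HasCompactSupport.intro (wd_hcs hts (s := I) (j := j))
      intro x hx
      simp [image_eq_zero_of_notMem_tsupport hx]
  have hT0 : 0 ≤ T := integral_nonneg fun x => by positivity
  have hT0' : 0 ≤ T' := integral_nonneg fun x => by positivity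
  obtain ⟨R0, hR0, hR0t⟩ : ∃ R0 > 0, tsupport t ⊆ closedBall (0 : EE n) R0 := by
    obtain ⟨r, hr⟩ := hts.isBounded.subset_closedBall (0 : EE n)
    exact ⟨max r 1, by positivity, hr.trans (closedBall_subset_closedBall (le_max_left _ _))⟩
  refine ⟨T + T' + n * (20 * C0 ^ 2 * Λ), R0, hR0, fun R hR => ?_⟩
  have hRp : 0 < R := hR0.trans hR
  set S := closedBall (0 : EE n) (2 * R) with hS
  have hexp : Continuous (fun x => Real.exp (φ x)) := Real.continuous_exp.comp hφ.continuous
  have hexp' : Continuous (fun x => Real.exp (-φ x)) := Real.continuous_exp.comp hφ.continuous.neg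
  obtain ⟨M, hM⟩ := (isCompact_closedBall (0 : EE n) (2 * R)).exists_bound_of_continuousOn hexp.continuousOn
  obtain ⟨M', hM'⟩ := (isCompact_closedBall (0 : EE n) (2 * R)).exists_bound_of_continuousOn hexp'.continuousOn
  have h0S : (0 : EE n) ∈ closedBall (0 : EE n) (2 * R) := by simp; linarith
  have hM0 : 0 ≤ M := (norm_nonneg _).trans (hM 0 h0S)
  have hM0' : 0 ≤ M' := (norm_nonneg _).trans (hM' 0 h0S)
  refine ⟨1 + n * (4 * M + 20 * (C0 / R) ^ 2 * M'), by positivity, fun δ hδ l hl => ?_⟩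
  obtain ⟨u, B, hu, hB, hdiv, hr, huF⟩ := approx hφ hFm hF hw (R := 2 * R) (by positivity)
    (δ := ENNReal.ofReal δ) (by simpa using hδ)
  obtain ⟨η, hη, hηs, hηc, hη1, hηR, hη0, hηd, hηt⟩ := hcut R hRp
  have hc := cacc hφ hu hB hdiv hη hηs hηc
  set J := ∫ x, ∑ j, ‖η x‖ ^ 2 * ‖wd I j u x‖ ^ 2 * Real.exp (-φ x) with hJ
  have hJi : Integrable (fun x => ∑ j, ‖η x‖ ^ 2 * ‖wd I j u x‖ ^ 2 * Real.exp (-φ x)) := by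
    apply Continuous.integrable_of_hasCompactSupport
    · exact continuous_finsetSum _ fun j _ => ((hη.continuous.norm.pow 2).mul ((wd_contDiff hu).continuous.norm.pow 2)).mul hexp'
    · apply HasCompactSupport.intro hηs
      intro x hx
      simp [image_eq_zero_of_notMem_tsupport hx]
  have hrm : ∀ j, AEStronglyMeasurable (fun x => wgt φ x * wd I j u x - B j x) volume := fun j =>
    (((wgt_cd hφ).continuous.mul (wd_contDiff hu).continuous).sub (hB j).continuous).aestronglyMeasurable
  have hFm' : AEStronglyMeasurable (fun x => u x - F x) volume :=
    (hu.continuous.measurable.sub hFm).aestronglyMeasurable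
  have hr' := fun j => set_sq (hrm j) hδ.le (hr j)
  obtain ⟨huFi, huFb⟩ := set_sq hFm' hδ.le huF
  -- bound of J
  have hJb : J ≤ n * (4 * M * δ + 20 * (C0 / R) ^ 2 * (M' * δ + Λ)) := by
    have e1 : ∫ x in S, ∑ j, (4 * M * ‖wgt φ x * wd I j u x - B j x‖ ^ 2 +
        20 * (C0 / R) ^ 2 * (M' * ‖u x - F x‖ ^ 2 + ‖F x‖ ^ 2 * Real.exp (-φ x))) ≤
        n * (4 * M * δ + 20 * (C0 / R) ^ 2 * (M' * δ + Λ)) := by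
      have ia : ∀ j, IntegrableOn (fun x => 4 * M * ‖wgt φ x * wd I j u x - B j x‖ ^ 2) S := fun j => (hr' j).1.const_mul _
      have ib : IntegrableOn (fun x => M' * ‖u x - F x‖ ^ 2) S := huFi.const_mul _
      have ic : IntegrableOn (fun x => ‖F x‖ ^ 2 * Real.exp (-φ x)) S := hΛi.integrableOn
      have id : IntegrableOn (fun x => 20 * (C0 / R) ^ 2 * (M' * ‖u x - F x‖ ^ 2 + ‖F x‖ ^ 2 * Real.exp (-φ x))) S :=
        (ib.add ic).const_mul _
      rw [integral_finsetSum _ (fun j _ => show Integrable (fun x => 4 * M * ‖wgt φ x * wd I j u x - B j x‖ ^ 2 +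
        20 * (C0 / R) ^ 2 * (M' * ‖u x - F x‖ ^ 2 + ‖F x‖ ^ 2 * Real.exp (-φ x))) (volume.restrict S) from (ia j).add id)]
      have e2 : ∀ j ∈ (Finset.univ : Finset (Fin n)), ∫ x in S, (4 * M * ‖wgt φ x * wd I j u x - B j x‖ ^ 2 +
        20 * (C0 / R) ^ 2 * (M' * ‖u x - F x‖ ^ 2 + ‖F x‖ ^ 2 * Real.exp (-φ x))) ≤
          4 * M * δ + 20 * (C0 / R) ^ 2 * (M' * δ + Λ) := by
        intro j _
        rw [integral_add (ia j) id, integral_const_mul, integral_const_mul, integral_add ib ic, integral_const_mul]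
        have h1 := (hr' j).2
        have h2 : ∫ x in S, ‖F x‖ ^ 2 * Real.exp (-φ x) ≤ Λ :=
          setIntegral_le_integral hΛi (Eventually.of_forall fun x => by positivity)
        gcongr
      refine (Finset.sum_le_sum e2).trans (le_of_eq ?_)
      rw [Finset.sum_const, Finset.card_univ, Fintype.card_fin, nsmul_eq_mul]
    refine hc.trans (le_trans ?_ e1)
    rw [← integral_indicator measurableSet_closedBall]
    apply integral_mono_of_nonneg
    · exact Eventually.of_forall fun x => Finset.sum_nonneg fun j _ => by positivity
    · rw [integrable_indicator_iff measurableSet_closedBall]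
      exact integrable_finsetSum _ fun j _ => ((hr' j).1.const_mul _).add
        (((huFi.const_mul _).add hΛi.integrableOn).const_mul _)
    · refine Eventually.of_forall fun x => ?_
      by_cases hx : x ∈ S
      · rw [indicator_of_mem hx]
        refine Finset.sum_le_sum fun k _ => ?_
        have h1 : ‖wgt φ x * wd I k u x - B k x‖ ^ 2 / Real.exp (-φ x) ≤ M * ‖wgt φ x * wd I k u x - B k x‖ ^ 2 := by
          rw [Real.exp_neg, div_inv_eq_mul, mul_comm]
          have := hM x hx
          rw [Real.norm_of_nonneg (Real.exp_pos _).le] at this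
          gcongr
        have h2 : ‖η x‖ ^ 2 * ‖wgt φ x * wd I k u x - B k x‖ ^ 2 / Real.exp (-φ x) ≤ ‖wgt φ x * wd I k u x - B k x‖ ^ 2 / Real.exp (-φ x) := by
          gcongr
          have : ‖η x‖ ^ 2 ≤ 1 := pow_le_one₀ (norm_nonneg _) (hη1 x)
          exact mul_le_of_le_one_left (by positivity) this
        have h3 : ‖wd (-I) k η x‖ ^ 2 ≤ (C0 / R) ^ 2 :=
          pow_le_pow_left₀ (norm_nonneg _) ((wd_norm_le _ (by simp) _ _ _).trans (hηd x)) 2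
        have h4 : ‖u x‖ ^ 2 ≤ 2 * ‖u x - F x‖ ^ 2 + 2 * ‖F x‖ ^ 2 := by
          have : ‖u x‖ ≤ ‖u x - F x‖ + ‖F x‖ := by
            simpa using norm_add_le (u x - F x) (F x)
          nlinarith [norm_nonneg (u x), sq_nonneg (‖u x - F x‖ - ‖F x‖)]
        have h5 := hM' x hx
        rw [Real.norm_of_nonneg (Real.exp_pos _).le] at h5
        have h6 : Real.exp (-φ x) * ‖wd (-I) k η x‖ ^ 2 * ‖u x‖ ^ 2 ≤ (C0 / R) ^ 2 * (2 * (M' * ‖u x - F x‖ ^ 2 + ‖F x‖ ^ 2 * Real.exp (-φ x))) := by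
          calc _ = ‖wd (-I) k η x‖ ^ 2 * (Real.exp (-φ x) * ‖u x‖ ^ 2) := by ring
            _ ≤ (C0 / R) ^ 2 * (Real.exp (-φ x) * ‖u x‖ ^ 2) := by gcongr
            _ ≤ (C0 / R) ^ 2 * (Real.exp (-φ x) * (2 * ‖u x - F x‖ ^ 2 + 2 * ‖F x‖ ^ 2)) := by gcongr
            _ ≤ _ := by
              refine mul_le_mul_of_nonneg_left ?_ (by positivity)
              nlinarith [mul_le_mul_of_nonneg_right h5 (sq_nonneg ‖u x - F x‖)]
        linarith
      · rw [indicator_of_notMem hx]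
        refine le_of_eq (Finset.sum_eq_zero fun k _ => ?_)
        have hx2 : x ∉ tsupport η := fun h => hx (hηt h)
        have h1 : wd (-I) k η x = 0 := by
          by_contra h'; exact hx2 (wd_support h')
        simp [h1, image_eq_zero_of_notMem_tsupport hx2]
  have hFl := loc_int hφ hF
  have i1 : Integrable (fun x => F x * wd I j t x) :=
    hFl.integrable_smul_right_of_hasCompactSupport (wd_contDiff ht).continuous (wd_hcs hts)
  have i2 : Integrable (fun x => u x * wd I j t x) := int_cs (hu.mul (wd_contDiff ht)) (wd_hcs hts).mul_left
  have i3 : Integrable (fun x => (F x - u x) * wd I j t x) := by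
    refine (i1.sub i2).congr (Eventually.of_forall fun x => ?_)
    simp only [Pi.sub_apply]; ring
  have split : ∫ x, F x * wd I j t x = (∫ x, (F x - u x) * wd I j t x) - ∫ x, wd I j u x * t x := by
    rw [ibp hu ht (Or.inr hts), sub_neg_eq_add, ← integral_add i3 i2]
    congr 1; ext x; ring
  have b1 : ‖∫ x, (F x - u x) * wd I j t x‖ ≤ l * δ + l⁻¹ * T' := by
    refine (norm_integral_le_integral_norm _).trans ?_
    have : ∫ x, ‖(F x - u x) * wd I j t x‖ ≤ ∫ x, (S.indicator (fun x => l * ‖u x - F x‖ ^ 2) x + l⁻¹ * ‖wd I j t x‖ ^ 2) := by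
      apply integral_mono i3.norm
      · exact ((integrable_indicator_iff measurableSet_closedBall).2 (huFi.const_mul l)).add (hTi'.const_mul _)
      · intro x
        dsimp only
        by_cases hx : x ∈ S
        · rw [indicator_of_mem hx, norm_mul, norm_sub_rev]
          have e : l * ‖u x - F x‖ ^ 2 + l⁻¹ * ‖wd I j t x‖ ^ 2 - ‖u x - F x‖ * ‖wd I j t x‖ =
            3 / 4 * (l * ‖u x - F x‖ ^ 2) + l⁻¹ * (‖wd I j t x‖ - l * ‖u x - F x‖ / 2) ^ 2 := by
            field_simp; ring
          have : 0 ≤ 3 / 4 * (l * ‖u x - F x‖ ^ 2) + l⁻¹ * (‖wd I j t x‖ - l * ‖u x - F x‖ / 2) ^ 2 := by positivity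
          linarith
        · have h1 : wd I j t x = 0 := by
            by_contra h'
            exact hx (closedBall_subset_closedBall (by linarith) (hR0t (wd_support h')))
          rw [indicator_of_notMem hx, h1]; simp
    refine this.trans ?_
    rw [integral_add ((integrable_indicator_iff measurableSet_closedBall).2 (huFi.const_mul l)) (hTi'.const_mul _),
      integral_indicator measurableSet_closedBall, integral_const_mul, integral_const_mul]
    gcongr
  have b2 : ‖∫ x, wd I j u x * t x‖ ≤ l * J + l⁻¹ * T := by
    refine (norm_integral_le_integral_norm _).trans ?_
    rw [hJ, hT, ← integral_const_mul, ← integral_const_mul, ← integral_add (hJi.const_mul _) (hTi.const_mul _)]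
    apply integral_mono (int_cs ((wd_contDiff hu).mul ht) hts.mul_left).norm ((hJi.const_mul _).add (hTi.const_mul _))
    intro x
    show ‖wd I j u x * t x‖ ≤ l * (∑ j, ‖η x‖ ^ 2 * ‖wd I j u x‖ ^ 2 * Real.exp (-φ x)) + l⁻¹ * (‖t x‖ ^ 2 * Real.exp (φ x))
    have hs : ‖η x‖ ^ 2 * ‖wd I j u x‖ ^ 2 * Real.exp (-φ x) ≤ ∑ j, ‖η x‖ ^ 2 * ‖wd I j u x‖ ^ 2 * Real.exp (-φ x) :=
      Finset.single_le_sum (f := fun j => ‖η x‖ ^ 2 * ‖wd I j u x‖ ^ 2 * Real.exp (-φ x)) (fun i _ => by positivity) (Finset.mem_univ j)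
    by_cases hx : x ∈ closedBall (0 : EE n) R
    · rw [hηR x (by simpa using hx)] at hs ⊢
      rw [norm_mul]
      have e : l * (‖(1 : ℂ)‖ ^ 2 * ‖wd I j u x‖ ^ 2 * Real.exp (-φ x)) + l⁻¹ * (‖t x‖ ^ 2 * Real.exp (φ x)) - ‖wd I j u x‖ * ‖t x‖ =
          3 / 4 * (l * ‖wd I j u x‖ ^ 2 * Real.exp (-φ x)) + l⁻¹ * Real.exp (φ x) * (‖t x‖ - l * Real.exp (-φ x) * ‖wd I j u x‖ / 2) ^ 2 := by
        rw [Real.exp_neg]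
        have := Real.exp_pos (φ x)
        simp only [norm_one]
        field_simp; ring
      have h0 : 0 ≤ 3 / 4 * (l * ‖wd I j u x‖ ^ 2 * Real.exp (-φ x)) + l⁻¹ * Real.exp (φ x) * (‖t x‖ - l * Real.exp (-φ x) * ‖wd I j u x‖ / 2) ^ 2 := by positivity
      have := mul_le_mul_of_nonneg_left hs hl.le
      linarith
    · have h1 : t x = 0 := by
        by_contra h'
        exact hx (closedBall_subset_closedBall hR.le (hR0t (subset_tsupport _ h')))
      rw [h1]
      simp only [mul_zero, norm_zero]
      positivity
  rw [split]
  refine (norm_sub_le _ _).trans ((add_le_add b1 b2).trans ?_)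
  have h3 := mul_le_mul_of_nonneg_left hJb hl.le
  have h4 : 0 ≤ l⁻¹ * (n * (20 * C0 ^ 2 * Λ)) := by positivity
  have h5 : 0 ≤ l * ((T + T') / R ^ 2) := by positivity
  have e5 : l * ((T + T' + n * (20 * C0 ^ 2 * Λ)) / R ^ 2 + (1 + n * (4 * M + 20 * (C0 / R) ^ 2 * M')) * δ) =
    l * ((T + T') / R ^ 2) + l * δ + l * (n * (4 * M * δ + 20 * (C0 / R) ^ 2 * (M' * δ + Λ))) := by
    field_simp; ring
  rw [e5]
  linarith

theorem weak_hol (hφ : ContDiff ℝ ∞ φ) (hFm : Measurable F) (hF : MemLp (fun x => F x * hwt φ x) 2)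
    (hw : ∀ G : EE n → ℂ, ContDiff ℝ ∞ G → HasCompactSupport G →
        ∫ x, F x * ∑ j, wd I j (fun y => wgt φ y * wd (-I) j G y) x = 0)
    {t : EE n → ℂ} (ht : ContDiff ℝ ∞ t) (hts : HasCompactSupport t) (j : Fin n) :
    ∫ x, F x * wd I j t x = 0 := by
  obtain ⟨K, R0, hR0, h⟩ := weak_est hφ hFm hF hw ht hts j
  rw [← norm_eq_zero]
  set X := ‖∫ x, F x * wd I j t x‖ with hX
  have h1 : ∀ R, R0 < R → ∀ l, 0 < l → X ≤ l⁻¹ * K + l * (K / R ^ 2) := by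
    intro R hR l hl
    obtain ⟨A, hA, h2⟩ := h R hR
    have h3 : Tendsto (fun δ : ℝ => l⁻¹ * K + l * (K / R ^ 2 + A * δ)) (𝓝[>] 0) (𝓝 (l⁻¹ * K + l * (K / R ^ 2 + A * 0))) :=
      (Continuous.tendsto (by fun_prop) 0).mono_left nhdsWithin_le_nhds
    have := ge_of_tendsto h3 (eventually_nhdsWithin_of_forall fun δ hδ => h2 δ hδ l hl)
    simpa using this
  have h4 : ∀ l, 0 < l → X ≤ l⁻¹ * K := by
    intro l hl
    have h3 : Tendsto (fun R : ℝ => l⁻¹ * K + l * (K / R ^ 2)) atTop (𝓝 (l⁻¹ * K + l * 0)) := by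
      refine tendsto_const_nhds.add (Tendsto.const_mul l ?_)
      exact tendsto_const_nhds.div_atTop (tendsto_pow_atTop (by norm_num))
    have := ge_of_tendsto h3 ((eventually_gt_atTop R0).mono fun R hR => h1 R hR l hl)
    simpa using this
  have h5 : Tendsto (fun l : ℝ => l⁻¹ * K) atTop (𝓝 (0 * K)) := tendsto_inv_atTop_zero.mul_const K
  have := ge_of_tendsto h5 ((eventually_gt_atTop 0).mono fun l hl => h4 l hl)
  rw [zero_mul] at this
  exact le_antisymm this (norm_nonneg _)

end Weak2

end PartB8

section PartC1
open MeasureTheory Filter Topology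
open scoped ContDiff ComplexConjugate ENNReal

section Hol
variable {n : ℕ}

lemma hol_of_wd {f : EE n → ℂ} {x : EE n} (hf : DifferentiableAt ℝ f x) (h : ∀ j, wd I j f x = 0) :
    DifferentiableAt ℂ f x := by
  set L := fderiv ℝ f x with hL
  have h1 : ∀ j, L (I • ev j) = I * L (ev j) := by
    intro j
    have := h j
    unfold wd at this
    have h2 : L (ev j) + I * L (I • ev j) = 0 := by
      rcases mul_eq_zero.1 this with h | h
      · norm_num at h
      · exact h
    linear_combination -I * h2 + L (I • ev j) * I_sq
  have h2 : ∀ (c : ℂ) j, L (c • ev j) = c * L (ev j) := by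
    intro c j
    have e : c • (ev j : EE n) = c.re • ev j + c.im • (I • ev j) := by
      conv_lhs => rw [← re_add_im c]
      rw [add_smul, mul_smul]
      simp only [Complex.coe_smul]
    rw [e, map_add, map_smul, map_smul, h1]
    conv_rhs => rw [← re_add_im c]
    simp only [real_smul]; ring
  have hx : ∀ v : EE n, v = ∑ j, v j • ev j := by
    intro v
    ext i
    simp [ev, Pi.single_apply]
  have h3 : ∀ v : EE n, L v = ∑ j, v j * L (ev j) := by
    intro v
    conv_lhs => rw [hx v]
    rw [map_sum]
    exact Finset.sum_congr rfl fun j _ => h2 _ _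
  let L' : EE n →L[ℂ] ℂ := { toFun := L, map_add' := map_add L, map_smul' := by
                                intro c v
                                rw [h3 (c • v), h3 v, smul_eq_mul, Finset.mul_sum]
                                exact Finset.sum_congr rfl fun j _ => by simp [mul_assoc], cont := L.cont }
  have : HasFDerivAt f L' x := by
    apply hasFDerivAt_of_restrictScalars ℝ (f' := L') hf.hasFDerivAt
    ext v; rfl
  exact this.differentiableAt

/-- mean value property -/
lemma cv_mean {g β : EE n → ℂ} (hg : Differentiable ℂ g) (hβ : Continuous β) (hβs : HasCompactSupport β)
    (hβ1 : ∫ x, β x = 1) (hrad : ∀ x y, ‖x‖ = ‖y‖ → β x = β y) (x : EE n) : cv g β x = g x := by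
  have e0 : cv g β x = ∫ y, g (x - y) * β y := by
    have := integral_sub_left_eq_self (fun y => g (x - y) * β y) volume x
    simp only [sub_sub_cancel] at this
    exact this
  have e1 : ∀ θ : ℝ, ∫ y, g (x - y) * β y = ∫ y, g (x - exp (θ * I) • y) * β y := by
    intro θ
    have hn : ‖exp (θ * I)‖ = 1 := norm_exp_ofReal_mul_I θ
    let u : Circle := Circle.exp θ
    let T : EE n ≃ₗᵢ[ℝ] EE n :=
      { toFun := fun y => exp (θ * I) • y
        invFun := fun y => exp (-(θ * I)) • y
        map_add' := fun a b => smul_add _ _ _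
        map_smul' := fun c a => by simp only [RingHom.id_apply]; rw [smul_comm]
        left_inv := fun y => by simp only [smul_smul, ← Complex.exp_add]; simp
        right_inv := fun y => by simp only [smul_smul, ← Complex.exp_add]; simp
        norm_map' := fun y => by
          show ‖exp (θ * I) • y‖ = ‖y‖
          rw [norm_smul, hn, one_mul] }
    have hT := T.measurePreserving.integral_comp' (f := T.toHomeomorph.toMeasurableEquiv) (fun y => g (x - y) * β y)
    rw [← hT]
    congr 1
    ext y
    show g (x - exp (θ * I) • y) * β (exp (θ * I) • y) = _
    rw [hrad (exp (θ * I) • y) y (by rw [norm_smul, hn, one_mul])]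
  have e2 : ∀ y, (∫ θ in (0 : ℝ)..2 * Real.pi, g (x - exp (θ * I) • y)) = 2 * Real.pi * g x := by
    intro y
    have hd : Differentiable ℂ (fun l : ℂ => g (x - l • y)) := by fun_prop
    have := circleIntegral_sub_inv_smul_of_differentiable_on_off_countable (E := ℂ) (c := 0) (w := 0) (R := 1) (s := ∅) (by simp) (by simp)
      (f := fun l : ℂ => g (x - l • y)) hd.continuous.continuousOn (fun z _ => hd z)
    rw [circleIntegral] at this
    have h2 : ∀ θ : ℝ, deriv (circleMap 0 1) θ • ((circleMap 0 1 θ - 0)⁻¹ • g (x - circleMap 0 1 θ • y)) = I * g (x - exp (θ * I) • y) := by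
      intro θ
      have : circleMap 0 1 θ = exp (θ * I) := by simp [circleMap]
      rw [deriv_circleMap, this]
      simp only [smul_eq_mul, sub_zero]
      field_simp [Complex.exp_ne_zero]
    simp only [h2] at this
    rw [intervalIntegral.integral_const_mul] at this
    simp only [zero_smul, sub_zero, smul_eq_mul] at this
    have hI : I ≠ 0 := I_ne_zero
    apply mul_left_cancel₀ hI
    rw [this]; ring
  obtain ⟨r, hr⟩ := hβs.isBounded.subset_closedBall (0 : EE n)
  obtain ⟨M, hM⟩ := (isCompact_closedBall x r).exists_bound_of_continuousOn (f := g) hg.continuous.continuousOn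
  have bd : ∀ (θ : ℝ) y, ‖g (x - exp (θ * I) • y) * β y‖ ≤ 1 * (M * ‖β y‖) := by
    intro θ y
    by_cases hy : β y = 0
    · simp [hy]
    · rw [norm_mul, one_mul]
      refine mul_le_mul_of_nonneg_right (hM _ ?_) (norm_nonneg _)
      rw [mem_closedBall, dist_eq_norm]
      have := hr (subset_tsupport _ hy)
      rw [mem_closedBall_zero_iff] at this
      rw [sub_sub_cancel_left, norm_neg, norm_smul, norm_exp_ofReal_mul_I, one_mul]
      exact this
  have hIntg : Integrable (Function.uncurry fun (θ : ℝ) y => g (x - exp (θ * I) • y) * β y)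
      ((volume.restrict (Ioc 0 (2 * Real.pi))).prod volume) := by
    have i1 : Integrable (fun _ : ℝ => (1 : ℝ)) (volume.restrict (Ioc 0 (2 * Real.pi))) := by
      apply integrable_const
    have i2 : Integrable (fun y => M * ‖β y‖) := (hβ.integrable_of_hasCompactSupport hβs).norm.const_mul _
    refine (i1.mul_prod i2).mono' ?_ (Eventually.of_forall fun z => bd z.1 z.2)
    apply Continuous.aestronglyMeasurable
    have := hg.continuous
    simp only [Function.uncurry_def]
    fun_prop
  have key : ∫ θ in Ioc 0 (2 * Real.pi), ∫ y, g (x - exp (θ * I) • y) * β y = 2 * Real.pi * g x := by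
    rw [integral_integral_swap hIntg]
    have : ∀ y, ∫ θ in Ioc 0 (2 * Real.pi), g (x - exp (θ * I) • y) * β y = 2 * Real.pi * g x * β y := by
      intro y
      rw [integral_mul_const, ← intervalIntegral.integral_of_le Real.two_pi_pos.le, e2]
    simp only [this]
    rw [integral_const_mul, hβ1, mul_one]
  simp only [← e1] at key
  rw [setIntegral_const] at key
  simp only [Measure.real, Real.volume_Ioc, sub_zero, real_smul, ENNReal.toReal_ofReal Real.two_pi_pos.le] at key
  rw [e0]
  have h2 : ((2 * Real.pi : ℝ) : ℂ) ≠ 0 := by exact_mod_cast Real.two_pi_pos.ne'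
  apply mul_left_cancel₀ h2
  rw [key]; push_cast; ring

end Hol

end PartC1

section PartC2
open MeasureTheory Filter Topology
open scoped ContDiff ComplexConjugate ENNReal

section T1
variable {n : ℕ}

lemma cv_norm_le {β : EE n → ℂ} {K δ0 : ℝ} (hK : 0 ≤ K) (hb : ∀ x, ‖β x‖ ≤ K) (h0 : ∀ x, x ∉ ball 0 δ0 → β x = 0)
    (f : EE n → ℂ) (x : EE n) :
    ‖cv f β x‖ₑ ≤ ENNReal.ofReal K * ∫⁻ y in ball x δ0, ‖f y‖ₑ := by
  unfold cv
  refine (enorm_integral_le_lintegral_enorm _).trans ?_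
  rw [← lintegral_const_mul' _ _ ENNReal.ofReal_ne_top, ← lintegral_indicator measurableSet_ball]
  apply lintegral_mono
  intro y
  dsimp only
  by_cases hy : y ∈ ball x δ0
  · rw [indicator_of_mem hy, enorm_mul, mul_comm]
    gcongr
    rw [← ofReal_norm]
    exact ENNReal.ofReal_le_ofReal (hb _)
  · have hxy : x - y ∉ ball 0 δ0 := by
      rwa [mem_ball_zero_iff, ← dist_eq_norm, dist_comm, ← mem_ball]
    rw [indicator_of_notMem hy, h0 _ hxy]; simp

theorem T1 (n : ℕ) {δ0 : ℝ} (hδ0 : 0 < δ0) : ∃ C1 : ℝ, 0 < C1 ∧ ∀ (φ : EE n → ℝ) (v : EE n → ℂ) (c : ℝ),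
    ContDiff ℝ ∞ φ → ContDiff ℝ ∞ v → HasCompactSupport v → 0 < c → (∀ x t, 0 ≤ levi φ x t) →
    (∀ x ∈ tsupport v, ∀ t, c * ∑ j, ‖t j‖ ^ 2 ≤ levi φ x t) →
    ∃ f : EE n → ℂ, Differentiable ℂ f ∧
      (∀ (x : EE n) (M : ℝ), (∀ y ∈ ball x δ0, φ y ≤ M) → ∀ g : EE n → ℂ, Differentiable ℂ g →
        (∀ y ∈ ball x δ0, v y = g y) →
        ‖g x - f x‖ ^ 2 ≤ C1 * (Real.exp M * (1 / c * ∫ x, (∑ j, ‖wd I j v x‖ ^ 2) * Real.exp (-φ x)))) ∧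
      (∀ (x : EE n) (M m s : ℝ), (∀ y ∈ ball x δ0, φ y ≤ M) → (∀ y ∈ ball x δ0, ‖v y‖ ≤ m) → 0 ≤ s →
        C1 * (Real.exp M * (1 / c * ∫ x, (∑ j, ‖wd I j v x‖ ^ 2) * Real.exp (-φ x))) ≤ s ^ 2 →
        ‖f x‖ ≤ C1 * m + s) := by
  obtain ⟨C, hC, hm⟩ := exists_moll n
  obtain ⟨β, hβ, hβ0, hβs, hβ1, hβb, -, hβr⟩ := hm δ0 hδ0
  have hvb : 0 < vb n δ0 := vb_pos hδ0
  have hvbx : ∀ x : EE n, volume (ball x δ0) = ENNReal.ofReal (vb n δ0) := by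
    intro x
    rw [Measure.addHaar_ball_center, vb, ENNReal.ofReal_toReal measure_ball_lt_top.ne]
  set K := C / vb n δ0 with hKd
  have hK : 0 < K := by positivity
  refine ⟨max C (K ^ 2 * vb n δ0), by positivity, fun φ v c hφ hv hvs hc hL0 hLc => ?_⟩
  obtain ⟨F, hFm, hF, hvF, hE, hw⟩ := T1a hφ hv hvs hc hL0 hLc
  have hFl := loc_int hφ hF
  have hvl : LocallyIntegrable v := hv.continuous.locallyIntegrable
  set E := 1 / c * ∫ x, (∑ j, ‖wd I j v x‖ ^ 2) * Real.exp (-φ x) with hEd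
  have hE0 : 0 ≤ E := by
    apply mul_nonneg (by positivity)
    exact integral_nonneg fun x => by positivity
  have dif : ∀ x, cv v β x - cv F β x = cv (fun y => v y - F y) β x := by
    intro x
    unfold cv
    rw [← integral_sub (cv_int hvl hβ.continuous hβs x) (cv_int hFl hβ.continuous hβs x)]
    congr 1; ext y; ring
  have hvFi : Integrable (fun x => ‖v x - F x‖ ^ 2 * Real.exp (-φ x)) := by
    refine hvF.norm.integrable_sq.congr (Eventually.of_forall fun x => ?_)
    simp only [norm_mul, mul_pow, norm_hwt_sq]
  have main : ∀ (x : EE n) (M : ℝ), (∀ y ∈ ball x δ0, φ y ≤ M) →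
      ‖cv v β x - cv F β x‖ ^ 2 ≤ max C (K ^ 2 * vb n δ0) * (Real.exp M * E) := by
    intro x M hM
    rw [dif]
    have h1 := cv_norm_le hK.le hβb hβ0 (fun y => v y - F y) x
    have hms : Measurable (fun y => v y - F y) := hv.continuous.measurable.sub hFm
    have h2 := cs_l (μ := volume.restrict (ball x δ0)) (h := fun y => ‖v y - F y‖ₑ) hms.enorm.aemeasurable
    rw [Measure.restrict_apply_univ, hvbx] at h2
    have h3 : ∫⁻ y in ball x δ0, ‖v y - F y‖ₑ ^ 2 ≤ ENNReal.ofReal (Real.exp M * E) := by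
      have : ∫⁻ y in ball x δ0, ‖v y - F y‖ₑ ^ 2 ≤ ∫⁻ y in ball x δ0, ENNReal.ofReal (Real.exp M * (‖v y - F y‖ ^ 2 * Real.exp (-φ y))) := by
        apply setLIntegral_mono' measurableSet_ball
        intro y hy
        rw [← ofReal_norm, ← ENNReal.ofReal_pow (norm_nonneg _)]
        apply ENNReal.ofReal_le_ofReal
        have : 1 ≤ Real.exp M * Real.exp (-φ y) := by
          rw [← Real.exp_add]; exact Real.one_le_exp (by linarith [hM y hy])
        nlinarith [sq_nonneg ‖v y - F y‖]
      refine this.trans ((setLIntegral_le_lintegral _ _).trans ?_)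
      rw [← ofReal_integral_eq_lintegral_ofReal (hvFi.const_mul _) (Eventually.of_forall fun y => by positivity)]
      apply ENNReal.ofReal_le_ofReal
      rw [integral_const_mul]
      gcongr
    have h4 : ‖cv (fun y => v y - F y) β x‖ₑ ^ 2 ≤ ENNReal.ofReal (K ^ 2 * vb n δ0 * (Real.exp M * E)) := by
      calc _ ≤ (ENNReal.ofReal K * ∫⁻ y in ball x δ0, ‖v y - F y‖ₑ) ^ 2 := by gcongr
        _ = ENNReal.ofReal K ^ 2 * (∫⁻ y in ball x δ0, ‖v y - F y‖ₑ) ^ 2 := by rw [mul_pow]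
        _ ≤ ENNReal.ofReal K ^ 2 * (ENNReal.ofReal (vb n δ0) * ENNReal.ofReal (Real.exp M * E)) := by
            refine mul_le_mul_right (h2.trans (mul_le_mul_right h3 _)) _
        _ = _ := by
            rw [← ENNReal.ofReal_pow hK.le, ← ENNReal.ofReal_mul hvb.le, ← ENNReal.ofReal_mul (by positivity)]
            congr 1; ring
    rw [← ofReal_norm, ← ENNReal.ofReal_pow (norm_nonneg _), ENNReal.ofReal_le_ofReal_iff (by positivity)] at h4
    refine h4.trans ?_
    gcongr
    exact le_max_right _ _
  refine ⟨cv F β, ?_, ?_, ?_⟩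
  · intro x
    apply hol_of_wd ((cv_cd hFl hβ hβs).differentiable (by simp) x)
    intro j
    rw [cv_wd hFl hβ hβs, cv]
    have := weak_hol hφ hFm hF hw (refl_cd hβ x) (refl_cs hβs x) j
    simp only [wd_refl hβ, mul_neg, integral_neg, neg_eq_zero] at this
    exact this
  · intro x M hM g hg hvg
    have : cv v β x = g x := by
      rw [← cv_mean hg hβ.continuous hβs hβ1 hβr x]
      unfold cv
      congr 1; ext y
      by_cases hy : y ∈ ball x δ0
      · rw [hvg y hy]
      · have hxy : x - y ∉ ball 0 δ0 := by
          rwa [mem_ball_zero_iff, ← dist_eq_norm, dist_comm, ← mem_ball]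
        rw [hβ0 _ hxy]; simp
    rw [← this]
    exact main x M hM
  · intro x M m s hM hvm hs hs2
    have h1 : ‖cv v β x - cv F β x‖ ≤ s := by
      have := (main x M hM).trans hs2
      exact le_of_sq_le_sq this hs
    have hm0 : 0 ≤ m := (norm_nonneg _).trans (hvm x (mem_ball_self hδ0))
    have h2 : ‖cv v β x‖ ≤ C * m := by
      have h3 := cv_norm_le hK.le hβb hβ0 v x
      have h4 : ∫⁻ y in ball x δ0, ‖v y‖ₑ ≤ ENNReal.ofReal (m * vb n δ0) := by
        calc _ ≤ ∫⁻ y in ball x δ0, ENNReal.ofReal m := by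
              apply setLIntegral_mono' measurableSet_ball
              intro y hy
              rw [← ofReal_norm]
              exact ENNReal.ofReal_le_ofReal (hvm y hy)
          _ = _ := by rw [setLIntegral_const, hvbx, ENNReal.ofReal_mul hm0]
      have h5 := h3.trans (mul_le_mul_right h4 _)
      rw [← ofReal_norm, ← ENNReal.ofReal_mul hK.le, ENNReal.ofReal_le_ofReal_iff (by positivity)] at h5
      refine h5.trans (le_of_eq ?_)
      rw [hKd]; field_simp
    have h6 : C * m ≤ max C (K ^ 2 * vb n δ0) * m := mul_le_mul_of_nonneg_right (le_max_left _ _) hm0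
    have h7 : ‖cv F β x‖ ≤ ‖cv v β x‖ + ‖cv v β x - cv F β x‖ := by
      have := norm_sub_le (cv v β x) (cv v β x - cv F β x)
      simpa using this
    linarith

end T1

end PartC2

section PartD1
open MeasureTheory Filter Topology
open scoped ContDiff ComplexConjugate ENNReal

section Poly
variable {N : ℕ}

/-- finite sum form of a weighted homogeneous polynomial -/
lemma whp_sum {m : Fin N → ℕ} {P : (Fin N → ℂ) → ℝ} (hP : IsWHP m P) :
    ∃ (S : Finset ((Fin N → ℕ) × (Fin N → ℕ))) (a : (Fin N → ℕ) × (Fin N → ℕ) → ℂ),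
      (∀ q ∈ S, wt m q.1 = 1 / 2 ∧ wt m q.2 = 1 / 2) ∧
      ∀ z' : Fin N → ℂ, (P z' : ℂ) = ∑ q ∈ S, a q * (∏ j, z' j ^ q.1 j) * ∏ j, conj (z' j) ^ q.2 j := by
  obtain ⟨a, hfin, -, hwt, hPz⟩ := hP
  refine ⟨hfin.toFinset, fun q => a q.1 q.2, fun q hq => hwt _ _ (by simpa using hq), fun z' => ?_⟩
  rw [hPz]
  have h2 : (Function.support fun q : (Fin N → ℕ) × (Fin N → ℕ) => a q.1 q.2 * (∏ j, z' j ^ q.1 j) * ∏ j, conj (z' j) ^ q.2 j) ⊆ hfin.toFinset := by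
    intro q hq
    simp only [Finite.coe_toFinset, mem_setOf_eq]
    intro h0
    apply hq
    simp [h0]
  have h3 := finsum_curry (fun q : (Fin N → ℕ) × (Fin N → ℕ) => a q.1 q.2 * (∏ j, z' j ^ q.1 j) * ∏ j, conj (z' j) ^ q.2 j)
    (hfin.subset (by simpa using h2))
  rw [← finsum_eq_sum_of_support_subset _ h2, h3]

lemma whp_cd {m : Fin N → ℕ} {P : (Fin N → ℂ) → ℝ} (hP : IsWHP m P) : ContDiff ℝ ∞ P := by
  obtain ⟨S, a, -, h⟩ := whp_sum hP
  have e : P = fun z' => reCLM (∑ q ∈ S, a q * (∏ j, z' j ^ q.1 j) * ∏ j, conj (z' j) ^ q.2 j) := by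
    ext z'
    rw [← h]; simp
  rw [e]
  apply reCLM.contDiff.comp
  have hc : ∀ j : Fin N, ContDiff ℝ ∞ (fun z' : Fin N → ℂ => z' j) := fun j => contDiff_apply ℝ ℂ j
  refine ContDiff.sum fun q _ => ?_
  refine (contDiff_const.mul (contDiff_prod fun j _ => (hc j).pow _)).mul (contDiff_prod fun j _ => ?_)
  exact (conjCLE.contDiff.comp (hc j)).pow _

/-- weighted dilation by a complex parameter -/
def dil (m : Fin N → ℕ) (w : ℂ) (z : Fin N → ℂ) : Fin N → ℂ := fun j => exp (w / (2 * m j)) * z j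

lemma whp_dil {m : Fin N → ℕ} {P : (Fin N → ℂ) → ℝ} (hP : IsWHP m P) (w : ℂ) (z : Fin N → ℂ) :
    P (dil m w z) = Real.exp w.re * P z := by
  obtain ⟨S, a, hwt, h⟩ := whp_sum hP
  have key : ((P (dil m w z) : ℝ) : ℂ) = ((Real.exp w.re * P z : ℝ) : ℂ) := by
    rw [ofReal_mul, h, h, Finset.mul_sum]
    refine Finset.sum_congr rfl fun q hq => ?_
    have e1 : ∀ K : Fin N → ℕ, wt m K = 1 / 2 → ∏ j, (dil m w z j) ^ K j = exp (w / 2) * ∏ j, z j ^ K j := by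
      intro K hK
      simp only [dil, mul_pow, Finset.prod_mul_distrib, ← Complex.exp_nat_mul, ← Complex.exp_sum]
      congr 2
      have : ∑ j, (K j : ℂ) * (w / (2 * m j)) = w * ((wt m K : ℝ) : ℂ) := by
        rw [wt, ofReal_sum, Finset.mul_sum]
        refine Finset.sum_congr rfl fun j _ => ?_
        push_cast; ring
      rw [this, hK]; push_cast; ring
    have e2 : ∏ j, conj (dil m w z j) ^ q.2 j = exp (conj w / 2) * ∏ j, conj (z j) ^ q.2 j := by
      have := congrArg conj (e1 q.2 (hwt q hq).2)
      simp only [map_prod, map_pow, map_mul, ← Complex.exp_conj, map_div₀, Complex.conj_ofNat] at this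
      exact this
    rw [e1 _ (hwt q hq).1, e2]
    have e3 : ((Real.exp w.re : ℝ) : ℂ) = exp (w / 2) * exp (conj w / 2) := by
      rw [← Complex.exp_add, ofReal_exp]; congr 1
      rw [← add_div, add_conj]; push_cast; ring
    rw [e3]; ring
  exact_mod_cast key

lemma whp_zero {m : Fin N → ℕ} {P : (Fin N → ℂ) → ℝ} (hP : IsWHP m P) : P 0 = 0 := by
  have h := whp_dil hP (Real.log 2 : ℝ) 0
  have : dil m (Real.log 2 : ℝ) (0 : Fin N → ℂ) = 0 := by ext j; simp [dil]
  rw [this, ofReal_re, Real.exp_log (by norm_num)] at h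
  linarith

end Poly

end PartD1

section PartD2
open MeasureTheory Filter Topology
open scoped ContDiff ComplexConjugate ENNReal

/-- Laplacian form of the Levi form -/
def Lv {V : Type*} [NormedAddCommGroup V] [NormedSpace ℂ V] [NormedSpace ℝ V] (g : V → ℝ) (x t : V) : ℝ :=
  fderiv ℝ (fderiv ℝ g) x t t + fderiv ℝ (fderiv ℝ g) x (I • t) (I • t)

section LV
variable {n : ℕ}

lemma ee_decomp (t : EE n) : t = ∑ j, ((t j).re • ev j + (t j).im • (I • ev j)) := by
  ext k
  simp only [WithLp.ofLp_sum, Finset.sum_apply, PiLp.add_apply, PiLp.smul_apply, ev, EuclideanSpace.single_apply]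
  rw [Finset.sum_eq_single k]
  · simp only [if_true, real_smul, smul_eq_mul, mul_one]
    exact (re_add_im (t k)).symm
  · intro b _ hb
    simp [hb.symm]
  · simp

lemma ee_decomp_I (t : EE n) : I • t = ∑ j, ((t j).re • (I • ev j) - (t j).im • ev j) := by
  conv_lhs => rw [ee_decomp t]
  rw [Finset.smul_sum]
  refine Finset.sum_congr rfl fun j _ => ?_
  ext k
  simp only [PiLp.add_apply, PiLp.sub_apply, PiLp.smul_apply, real_smul, smul_eq_mul]
  linear_combination ((t j).im : ℂ) * (ev j k) * I_mul_I

lemma wd_wd_phc {φ : EE n → ℝ} (hφ : ContDiff ℝ ∞ φ) (x : EE n) (j k : Fin n) :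
    wd I k (wd (-I) j (phc φ)) x = (1 / 4) * ((fderiv ℝ (fderiv ℝ φ) x (ev k) (ev j) : ℝ)
      - I * (fderiv ℝ (fderiv ℝ φ) x (ev k) (I • ev j) : ℝ)
      + I * (fderiv ℝ (fderiv ℝ φ) x (I • ev k) (ev j) : ℝ)
      + (fderiv ℝ (fderiv ℝ φ) x (I • ev k) (I • ev j) : ℝ)) := by
  have h1 : ∀ y u, fderiv ℝ (phc φ) y u = ((fderiv ℝ φ y u : ℝ) : ℂ) := by
    intro y u
    have := (ofRealCLM.hasFDerivAt.comp y (hφ.differentiable (by simp) y).hasFDerivAt)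
    have e : phc φ = ofRealCLM ∘ φ := by ext; simp [phc]
    rw [e, this.fderiv]; simp
  have h2 : wd (-I) j (phc φ) = fun y => (1 / 2 : ℂ) * (((fderiv ℝ φ y (ev j) : ℝ) : ℂ) + (-I) * ((fderiv ℝ φ y (I • ev j) : ℝ) : ℂ)) := by
    ext y; simp only [wd, h1]
  have hd : ContDiff ℝ ∞ (fderiv ℝ φ) := hφ.fderiv_right (by simp)
  have h3 : ∀ v : EE n, HasFDerivAt (fun y => ((fderiv ℝ φ y v : ℝ) : ℂ))
      (ofRealCLM.comp ((fderiv ℝ (fderiv ℝ φ) x).flip v)) x := by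
    intro v
    have a := (hd.differentiable (by simp) x).hasFDerivAt.clm_apply (hasFDerivAt_const v x)
    have b := ofRealCLM.hasFDerivAt.comp x a
    refine HasFDerivAt.congr_fderiv (f := fun y => ((fderiv ℝ φ y v : ℝ) : ℂ)) b ?_
    ext u; simp
  have h4 := (((h3 (ev j)).add ((h3 (I • ev j)).const_mul (-I))).const_mul (1/2 : ℂ))
  have h5 : ∀ u, fderiv ℝ (wd (-I) j (phc φ)) x u = (1 / 2 : ℂ) * (((fderiv ℝ (fderiv ℝ φ) x u (ev j) : ℝ) : ℂ)
      + (-I) * ((fderiv ℝ (fderiv ℝ φ) x u (I • ev j) : ℝ) : ℂ)) := by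
    intro u
    rw [h2]
    refine (congrArg (fun L => L u) h4.fderiv).trans ?_
    simp [mul_add]
  rw [wd, h5, h5]
  linear_combination (-1/4 : ℂ) * (fderiv ℝ (fderiv ℝ φ) x (I • ev k) (I • ev j) : ℝ) * I_mul_I

lemma levi_eq {φ : EE n → ℝ} (hφ : ContDiff ℝ ∞ φ) (x : EE n) (t : EE n) :
    levi φ x (fun j => t j) = (1 / 4) * Lv φ x t := by
  unfold levi Lv
  set H := fderiv ℝ (fderiv ℝ φ) x with hH
  have e1 : H t t = ∑ j, ∑ k, ((t k).re * (t j).re * H (ev k) (ev j) + (t k).re * (t j).im * H (ev k) (I • ev j)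
      + (t k).im * (t j).re * H (I • ev k) (ev j) + (t k).im * (t j).im * H (I • ev k) (I • ev j)) := by
    conv_lhs => rw [ee_decomp t]
    rw [map_sum]
    refine Finset.sum_congr rfl fun j _ => ?_
    rw [map_sum, sum_apply]
    refine Finset.sum_congr rfl fun k _ => ?_
    simp only [map_add, map_smul, add_apply, smul_apply, smul_eq_mul]
    ring
  have e2 : H (I • t) (I • t) = ∑ j, ∑ k, ((t k).re * (t j).re * H (I • ev k) (I • ev j) - (t k).re * (t j).im * H (I • ev k) (ev j)
      - (t k).im * (t j).re * H (ev k) (I • ev j) + (t k).im * (t j).im * H (ev k) (ev j)) := by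
    conv_lhs => rw [ee_decomp_I t]
    rw [map_sum]
    refine Finset.sum_congr rfl fun j _ => ?_
    rw [map_sum, sum_apply]
    refine Finset.sum_congr rfl fun k _ => ?_
    simp only [map_sub, map_smul, sub_apply, smul_apply, smul_eq_mul]
    ring
  rw [e1, e2, ← Finset.sum_add_distrib, re_sum, Finset.mul_sum]
  refine Finset.sum_congr rfl fun j _ => ?_
  rw [← Finset.sum_add_distrib, re_sum, Finset.mul_sum]
  refine Finset.sum_congr rfl fun k _ => ?_
  rw [wd_wd_phc hφ]
  simp only [mul_re, mul_im, add_re, add_im, sub_re, sub_im, I_re, I_im, ofReal_re, ofReal_im, conj_re, conj_im, ← hH]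
  have : ((1 : ℂ)/4).re = 1/4 ∧ ((1 : ℂ)/4).im = 0 := by
    constructor <;> norm_num [div_re, div_im]
  rw [this.1, this.2]
  ring

end LV

end PartD2

section PartD3
open MeasureTheory Filter Topology
open scoped ContDiff ComplexConjugate ENNReal

section LVgen
set_option linter.unusedSectionVars false
variable {V W : Type*} [NormedAddCommGroup V] [NormedSpace ℂ V] [NormedSpace ℝ V] [IsScalarTower ℝ ℂ V]
  [NormedAddCommGroup W] [NormedSpace ℂ W] [NormedSpace ℝ W] [IsScalarTower ℝ ℂ W]

lemma fderiv2_apply {g : V → ℝ} (hg : ContDiff ℝ ∞ g) (x s t : V) :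
    fderiv ℝ (fun y => fderiv ℝ g y t) x s = fderiv ℝ (fderiv ℝ g) x s t := by
  have hd : ContDiff ℝ ∞ (fderiv ℝ g) := hg.fderiv_right (by simp)
  have a := (hd.differentiable (by simp) x).hasFDerivAt.clm_apply (hasFDerivAt_const t x)
  have := congrArg (fun L => L s) a.fderiv
  simpa using this

lemma fderiv_aff {g : W → ℝ} (hg : ContDiff ℝ ∞ g) (c : W) (S : V →L[ℝ] W) (x s : V) :
    fderiv ℝ (fun y => g (c + S y)) x s = fderiv ℝ g (c + S x) (S s) := by
  have a := (hg.differentiable (by simp) (c + S x)).hasFDerivAt.comp x (S.hasFDerivAt.const_add c)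
  have := congrArg (fun L => L s) a.fderiv
  simpa [Function.comp_def] using this

lemma fderiv2_aff {g : W → ℝ} (hg : ContDiff ℝ ∞ g) (c : W) (S : V →L[ℝ] W) (x s t : V) :
    fderiv ℝ (fderiv ℝ (fun y => g (c + S y))) x s t = fderiv ℝ (fderiv ℝ g) (c + S x) (S s) (S t) := by
  have h1 : ContDiff ℝ ∞ (fun y => g (c + S y)) := hg.comp (contDiff_const.add S.contDiff)
  rw [← fderiv2_apply h1, ← fderiv2_apply hg]
  have hd : ContDiff ℝ ∞ (fun y => fderiv ℝ g y (S t)) := (hg.fderiv_right (by simp)).clm_apply contDiff_const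
  rw [← fderiv_aff hd]
  congr 2
  ext y
  exact fderiv_aff hg c S y t

lemma Lv_aff {g : W → ℝ} (hg : ContDiff ℝ ∞ g) (c : W) (S : V →L[ℂ] W) (x t : V) :
    Lv (fun y => g (c + S y)) x t = Lv g (c + S x) (S t) := by
  have h := fderiv2_aff hg c (S.restrictScalars ℝ) x
  simp only [ContinuousLinearMap.coe_restrictScalars'] at h
  unfold Lv
  rw [h, h, map_smul]

lemma Lv_add {f g : V → ℝ} (hf : ContDiff ℝ ∞ f) (hg : ContDiff ℝ ∞ g) (x t : V) :
    Lv (fun y => f y + g y) x t = Lv f x t + Lv g x t := by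
  have h : ∀ s t, fderiv ℝ (fderiv ℝ (fun y => f y + g y)) x s t = fderiv ℝ (fderiv ℝ f) x s t + fderiv ℝ (fderiv ℝ g) x s t := by
    intro s t
    have e : fderiv ℝ (fun y => f y + g y) = fun y => fderiv ℝ f y + fderiv ℝ g y := by
      ext1 y
      exact fderiv_fun_add (hf.differentiable (by simp) y) (hg.differentiable (by simp) y)
    have hd : ContDiff ℝ ∞ (fderiv ℝ f) := hf.fderiv_right (by simp)
    have hd' : ContDiff ℝ ∞ (fderiv ℝ g) := hg.fderiv_right (by simp)
    rw [e, fderiv_fun_add (hd.differentiable (by simp) x) (hd'.differentiable (by simp) x)]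
    simp
  unfold Lv
  rw [h, h]; ring

lemma Lv_const_mul {f : V → ℝ} (hf : ContDiff ℝ ∞ f) (c : ℝ) (x t : V) :
    Lv (fun y => c * f y) x t = c * Lv f x t := by
  have h : ∀ s t, fderiv ℝ (fderiv ℝ (fun y => c * f y)) x s t = c * fderiv ℝ (fderiv ℝ f) x s t := by
    intro s t
    have e : fderiv ℝ (fun y => c * f y) = fun y => c • fderiv ℝ f y := by
      ext1 y
      exact fderiv_const_mul (hf.differentiable (by simp) y) c
    have hd : ContDiff ℝ ∞ (fderiv ℝ f) := hf.fderiv_right (by simp)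
    rw [e, fderiv_fun_const_smul (hd.differentiable (by simp) x)]
    simp
  unfold Lv
  rw [h, h]; ring

lemma Lv_sub_const {f : V → ℝ} (c : ℝ) (x t : V) :
    Lv (fun y => f y - c) x t = Lv f x t := by
  unfold Lv
  have e : fderiv ℝ (fun y => f y - c) = fderiv ℝ f := by
    ext1 y; exact fderiv_sub_const c
  rw [e]

lemma Lv_cont {f : V → ℝ} (hf : ContDiff ℝ ∞ f) (t : V) : Continuous (fun x => Lv f x t) := by
  unfold Lv
  have hd : ContDiff ℝ ∞ (fderiv ℝ f) := hf.fderiv_right (by simp)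
  have hd2 : ContDiff ℝ ∞ (fderiv ℝ (fderiv ℝ f)) := hd.fderiv_right (by simp)
  have h : ∀ s u, Continuous (fun x => fderiv ℝ (fderiv ℝ f) x s u) := fun s u =>
    ((hd2.clm_apply contDiff_const).clm_apply contDiff_const).continuous
  exact (h _ _).add (h _ _)

lemma cd_normsq : ContDiff ℝ ∞ (fun u : ℂ => ‖u‖ ^ 2) := contDiff_norm_sq ℝ

lemma fderiv_normsq (w e : ℂ) : fderiv ℝ (fun u : ℂ => ‖u‖ ^ 2) w e = 2 * (w.re * e.re + w.im * e.im) := by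
  have h : (fun u : ℂ => ‖u‖ ^ 2) = fun u => reCLM u * reCLM u + imCLM u * imCLM u := by
    ext u; rw [← normSq_eq_norm_sq, normSq_apply]; rfl
  have a := ((reCLM.hasFDerivAt (x := w)).mul (reCLM.hasFDerivAt (x := w))).add
    ((imCLM.hasFDerivAt (x := w)).mul (imCLM.hasFDerivAt (x := w)))
  rw [h]
  refine (congrArg (fun L => L e) a.fderiv).trans ?_
  simp; ring

lemma Lv_normsq (x t : ℂ) : Lv (fun u : ℂ => ‖u‖ ^ 2) x t = 4 * ‖t‖ ^ 2 := by
  unfold Lv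
  have h : ∀ s t : ℂ, fderiv ℝ (fderiv ℝ (fun u : ℂ => ‖u‖ ^ 2)) x s t = 2 * (s.re * t.re + s.im * t.im) := by
    intro s t
    rw [← fderiv2_apply cd_normsq]
    have e : (fun y => fderiv ℝ (fun u : ℂ => ‖u‖ ^ 2) y t) = fun y => (2 : ℝ) * (reCLM y * t.re + imCLM y * t.im) := by
      ext y; exact fderiv_normsq y t
    have a := ((reCLM.hasFDerivAt (x := x)).mul_const t.re).add ((imCLM.hasFDerivAt (x := x)).mul_const t.im) |>.const_mul (2 : ℝ)
    rw [e]
    refine (congrArg (fun L => L s) a.fderiv).trans ?_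
    simp; ring
  rw [h, h, ← normSq_eq_norm_sq, normSq_apply]
  simp; ring
end LVgen

end PartD3

section PartD4
open MeasureTheory Filter Topology
open scoped ContDiff ComplexConjugate ENNReal

section Lev
variable {N : ℕ}

/-- weighted Euler field -/
def wa (m : Fin N → ℕ) : (Fin N → ℂ) →L[ℂ] (Fin N → ℂ) :=
  ContinuousLinearMap.pi fun j => ((m j : ℂ)⁻¹) • ContinuousLinearMap.proj j

lemma wa_apply (m : Fin N → ℕ) (z) (j : Fin N) : wa m z j = (m j : ℂ)⁻¹ * z j := by simp [wa]

/-- dilation as a continuous linear map -/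
def dilL (m : Fin N → ℕ) (w : ℂ) : (Fin N → ℂ) →L[ℂ] (Fin N → ℂ) :=
  ContinuousLinearMap.pi fun j => (exp (w / (2 * m j))) • ContinuousLinearMap.proj j

lemma dilL_apply (m : Fin N → ℕ) (w : ℂ) (z : Fin N → ℂ) : dilL m w z = dil m w z := by
  ext j; simp [dilL, dil]

lemma dil_hasDeriv (m : Fin N → ℕ) (z : Fin N → ℂ) (e : ℂ) :
    HasDerivAt (fun r : ℝ => dil m (r * e) z) ((1/2 : ℝ) • (e • wa m z)) 0 := by
  rw [hasDerivAt_pi]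
  intro j
  have h1 : HasDerivAt (fun r : ℝ => ((r : ℂ) * e) / (2 * m j)) ((1 * e) / (2 * m j)) 0 :=
    (((ofRealCLM.hasDerivAt (x := (0:ℝ))).mul_const e).div_const (2 * (m j : ℂ)))
  have h2 := (h1.cexp).mul_const (z j)
  refine h2.congr_deriv ?_
  simp [wa_apply]
  ring

lemma euler {m : Fin N → ℕ} {P : (Fin N → ℂ) → ℝ} (hP : IsWHP m P) (z : Fin N → ℂ) (e : ℂ) :
    fderiv ℝ P z (e • wa m z) = 2 * e.re * P z := by
  have hd0 : dil m (((0 : ℝ) : ℂ) * e) z = z := by ext j; simp [dil]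
  have h1 : HasFDerivAt P (fderiv ℝ P z) (dil m (((0 : ℝ) : ℂ) * e) z) := by
    rw [hd0]; exact ((whp_cd hP).differentiable (by simp) z).hasFDerivAt
  have h2 := h1.comp_hasDerivAt (0 : ℝ) (dil_hasDeriv m z e)
  have h3 : HasDerivAt (fun r : ℝ => Real.exp (r * e.re) * P z) (e.re * P z) 0 := by
    have := (((hasDerivAt_id (0:ℝ)).mul_const e.re).exp).mul_const (P z)
    simpa using this
  have h4 : (P ∘ fun r : ℝ => dil m (r * e) z) = fun r : ℝ => Real.exp (r * e.re) * P z := by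
    ext r
    simp [Function.comp, whp_dil hP]
  rw [h4] at h2
  have := h2.unique h3
  rw [map_smul, smul_eq_mul] at this
  linarith

lemma euler2 {m : Fin N → ℕ} {P : (Fin N → ℂ) → ℝ} (hP : IsWHP m P) (z s : Fin N → ℂ) (e : ℂ) :
    fderiv ℝ (fderiv ℝ P) z s (e • wa m z) = 2 * e.re * fderiv ℝ P z s - fderiv ℝ P z (e • wa m s) := by
  have hc := whp_cd hP
  have hd : ContDiff ℝ ∞ (fderiv ℝ P) := hc.fderiv_right (by simp)
  have h1 := (hd.differentiable (by simp) z).hasFDerivAt.clm_apply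
    (((e • wa m).restrictScalars ℝ).hasFDerivAt (x := z))
  have h2 : HasFDerivAt (fun z => 2 * e.re * P z) ((2 * e.re) • fderiv ℝ P z) z :=
    ((hc.differentiable (by simp) z).hasFDerivAt).const_mul _
  have h3 : (fun z => fderiv ℝ P z (((e • wa m).restrictScalars ℝ) z)) = fun z => 2 * e.re * P z := by
    ext z; exact euler hP z e
  rw [h3] at h1
  have := congrArg (fun L => L s) (h1.unique h2)
  simp at this
  linarith

lemma Lv_decomp {m : Fin N → ℕ} {P : (Fin N → ℂ) → ℝ} (hP : IsWHP m P) (z : Fin N → ℂ) (hz : P z ≠ 0)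
    (t : Fin N → ℂ) : ∃ c : ℂ, ∃ τ, t = c • wa m z + τ ∧ fderiv ℝ P z τ = 0 ∧ fderiv ℝ P z (I • τ) = 0 ∧
      Lv P z t = 4 * ‖c‖ ^ 2 * P z + Lv P z τ := by
  have hsymm : ∀ u v, fderiv ℝ (fderiv ℝ P) z u v = fderiv ℝ (fderiv ℝ P) z v u := by
    intro u v
    exact ((whp_cd hP).contDiffAt (x := z)).isSymmSndFDerivAt (by simp; exact WithTop.coe_le_coe.2 (le_top : (2:ℕ∞) ≤ ⊤)) u v
  set a := fderiv ℝ P z t / (2 * P z) with ha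
  set b := - fderiv ℝ P z (I • t) / (2 * P z) with hb
  set E := wa m z with hE
  set c : ℂ := ⟨a, b⟩ with hc
  set τ := t - c • E with hτ
  have hIA : ∀ u, wa m (I • u) = I • wa m u := fun u => map_smul _ _ _
  have hD : ∀ e : ℂ, fderiv ℝ P z (e • E) = 2 * e.re * P z := euler hP z
  have ha' : fderiv ℝ P z t = a * (2 * P z) := by rw [ha]; field_simp
  have hb' : fderiv ℝ P z (I • t) = - b * (2 * P z) := by rw [hb]; field_simp
  have t1 : fderiv ℝ P z τ = 0 := by
    rw [hτ, map_sub, hD, ha']; simp [hc]; ring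
  have t2 : fderiv ℝ P z (I • τ) = 0 := by
    rw [hτ, smul_sub, map_sub, smul_smul, hD, hb']; simp [hc]; ring
  have hM : ∀ (e : ℂ) (s : Fin N → ℂ), fderiv ℝ (fderiv ℝ P) z s (e • E) + fderiv ℝ (fderiv ℝ P) z (I • s) (I • e • E)
      = 2 * e.re * fderiv ℝ P z s - 2 * e.im * fderiv ℝ P z (I • s) := by
    intro e s
    rw [smul_smul, euler2 hP, euler2 hP, hIA, smul_smul]
    have : I * e * I = -e := by linear_combination e * I_mul_I
    rw [this, neg_smul, map_neg]
    simp
    ring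
  refine ⟨c, τ, by rw [hτ]; abel, t1, t2, ?_⟩
  have ht : t = τ + c • E := by rw [hτ]; abel
  have k1 := hM c τ
  rw [t1, t2] at k1
  have k2 := hM c (c • E)
  rw [smul_smul, hD, hD] at k2
  have hn : ‖c‖ ^ 2 = c.re * c.re + c.im * c.im := by rw [← normSq_eq_norm_sq, normSq_apply]
  have k3 : (I * c).re = - c.im := by simp
  rw [k3] at k2
  unfold Lv
  conv_lhs => rw [ht]
  rw [smul_add]
  simp only [map_add, add_apply]
  rw [hsymm (c • E) τ, hsymm (I • c • E) (I • τ), hn]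
  rw [← smul_smul] at k2
  linarith

lemma Lv_P_pos1 {m : Fin N → ℕ} {P : (Fin N → ℂ) → ℝ} (hP : IsWHP m P)
    (hPpos : ∀ z' : Fin N → ℂ, z' ≠ 0 → 0 < P z')
    (h : ∀ z, P z = 1 → ∀ τ, τ ≠ 0 → fderiv ℝ P z τ = 0 → fderiv ℝ P z (I • τ) = 0 → 0 < Lv P z τ)
    (z : Fin N → ℂ) (hz : z ≠ 0) (t : Fin N → ℂ) (ht : t ≠ 0) : 0 < Lv P z t := by
  have h1 : ∀ z, P z = 1 → ∀ t, t ≠ 0 → 0 < Lv P z t := by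
    intro z hz t ht
    obtain ⟨c, τ, e1, e2, e3, e4⟩ := Lv_decomp hP z (by rw [hz]; norm_num) t
    rw [e4, hz]
    by_cases h0 : τ = 0
    · have hc : c ≠ 0 := by
        rintro rfl; apply ht; rw [e1, h0]; simp
      have : Lv P z 0 = 0 := by simp [Lv]
      rw [h0, this]
      have := norm_pos_iff.2 hc
      positivity
    · have := h z hz τ h0 e2 e3
      positivity
  have hp := hPpos z hz
  set w : ℂ := ((-Real.log (P z) : ℝ) : ℂ) with hw
  have hw1 : Real.exp w.re = (P z)⁻¹ := by rw [hw, ofReal_re, Real.exp_neg, Real.exp_log hp]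
  have e1 : (fun y => P (0 + dilL m w y)) = fun y => Real.exp w.re * P y := by
    ext y; rw [zero_add, dilL_apply, whp_dil hP]
  have e2 := Lv_aff (whp_cd hP) 0 (dilL m w) z t
  rw [e1, Lv_const_mul (whp_cd hP), zero_add] at e2
  have h3 := h1 (dilL m w z) (by rw [dilL_apply, whp_dil hP, hw1]; field_simp) (dilL m w t) (by
    intro h0
    apply ht
    ext j
    have := congrFun h0 j
    simpa [dilL_apply, dil, exp_ne_zero] using this)
  rw [← e2] at h3
  exact pos_of_mul_pos_right h3 (Real.exp_pos _).le

lemma Lv_P_nonneg {P : (Fin N → ℂ) → ℝ} (hP : ContDiff ℝ ∞ P)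
    (h : ∀ z, z ≠ 0 → ∀ t, t ≠ 0 → 0 < Lv P z t) (z t : Fin N → ℂ) : 0 ≤ Lv P z t := by
  by_cases ht : t = 0
  · simp [Lv, ht]
  have : Nontrivial (Fin N → ℂ) := ⟨t, 0, ht⟩
  have : NeBot (𝓝[≠] (0 : Fin N → ℂ)) := Module.punctured_nhds_neBot ℂ _ 0
  have hd : Dense ({0}ᶜ : Set (Fin N → ℂ)) := dense_compl_singleton _
  have hcl : IsClosed {z | 0 ≤ Lv P z t} := isClosed_le continuous_const (Lv_cont hP t)
  have : ({0}ᶜ : Set (Fin N → ℂ)) ⊆ {z | 0 ≤ Lv P z t} := fun z hz => (h z hz t ht).le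
  have h2 := hcl.closure_subset_iff.2 this
  rw [hd.closure_eq] at h2
  exact h2 (mem_univ z)

end Lev

end PartD4

section PartD5
open MeasureTheory Filter Topology
open scoped ContDiff ComplexConjugate ENNReal

section Rho
variable {N : ℕ}

/-- last coordinate as a linear map -/
def lastL : CSp N →L[ℂ] ℂ := EuclideanSpace.proj (Fin.last N)
/-- first coordinates as a linear map -/
def initL : CSp N →L[ℂ] (Fin N → ℂ) := ContinuousLinearMap.pi fun j => EuclideanSpace.proj j.castSucc

lemma lastL_apply (z : CSp N) : lastL z = lastC z := rfl
lemma initL_apply (z : CSp N) : initL z = initC z := rfl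

lemma initC_mk (a : Fin N → ℂ) (b : ℂ) : initC (mkPt a b) = a := by
  ext j; simp [initC, mkPt]
lemma lastC_mk (a : Fin N → ℂ) (b : ℂ) : lastC (mkPt a b) = b := by
  simp [lastC, mkPt]
lemma pt_ext {z w : CSp N} (h1 : initC z = initC w) (h2 : lastC z = lastC w) : z = w := by
  ext j
  refine Fin.lastCases h2 (fun i => ?_) j
  exact congrFun h1 i
lemma mk_eta (z : CSp N) : mkPt (initC z) (lastC z) = z :=
  pt_ext (initC_mk _ _) (lastC_mk _ _)

lemma mk_cont : Continuous (fun p : (Fin N → ℂ) × ℂ => mkPt p.1 p.2) := by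
  unfold mkPt
  refine (PiLp.continuous_toLp 2 _).comp ?_
  refine continuous_pi fun j => ?_
  refine Fin.lastCases ?_ (fun i => ?_) j
  · simpa using continuous_snd
  · simp only [Fin.snoc_castSucc]; fun_prop

/-- defining function -/
def rh (P : (Fin N → ℂ) → ℝ) (z : CSp N) : ℝ := ‖lastC z‖ ^ 2 + P (initC z) - 1

lemma rh_eq (P : (Fin N → ℂ) → ℝ) : rh P = fun z => (‖(0 : ℂ) + lastL z‖ ^ 2 + P (0 + initL z)) - 1 := by
  ext z; simp [rh, lastL_apply, initL_apply]

lemma mem_DP {P : (Fin N → ℂ) → ℝ} {z : CSp N} : z ∈ DP P ↔ rh P z < 0 := by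
  simp only [DP, rh, mem_setOf_eq]; constructor <;> intro h <;> linarith

lemma lastC_cd : ContDiff ℝ ∞ (lastC (N := N)) := (lastL.restrictScalars ℝ).contDiff
lemma initC_cd : ContDiff ℝ ∞ (initC (N := N)) := (initL.restrictScalars ℝ).contDiff

lemma rh_cd {P : (Fin N → ℂ) → ℝ} (hP : ContDiff ℝ ∞ P) : ContDiff ℝ ∞ (rh P) := by
  unfold rh
  exact ((cd_normsq.comp lastC_cd).add (hP.comp initC_cd)).sub contDiff_const

lemma Lv_rh {P : (Fin N → ℂ) → ℝ} (hP : ContDiff ℝ ∞ P) (z t : CSp N) :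
    Lv (rh P) z t = 4 * ‖lastC t‖ ^ 2 + Lv P (initC z) (initC t) := by
  rw [rh_eq, Lv_sub_const, Lv_add (f := fun z => ‖(0 : ℂ) + lastL z‖ ^ 2) (g := fun z => P (0 + initL z)),
    Lv_aff (g := fun u => ‖u‖ ^ 2) cd_normsq, Lv_aff hP, Lv_normsq, zero_add]
  · rfl
  · exact cd_normsq.comp (contDiff_const.add (lastL.restrictScalars ℝ).contDiff)
  · exact hP.comp (contDiff_const.add (initL.restrictScalars ℝ).contDiff)

lemma fderiv_rh {P : (Fin N → ℂ) → ℝ} (hP : ContDiff ℝ ∞ P) (z t : CSp N) :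
    fderiv ℝ (rh P) z t = 2 * ((lastC z).re * (lastC t).re + (lastC z).im * (lastC t).im)
      + fderiv ℝ P (initC z) (initC t) := by
  have h1 := fderiv_aff (g := fun u : ℂ => ‖u‖ ^ 2) cd_normsq 0 (lastL.restrictScalars ℝ) z t
  have h2 := fderiv_aff hP 0 (initL.restrictScalars ℝ) z t
  have d1 : DifferentiableAt ℝ (fun z : CSp N => ‖(0 : ℂ) + lastL z‖ ^ 2) z :=
    (cd_normsq.comp (contDiff_const.add (lastL.restrictScalars ℝ).contDiff)).differentiable (by simp) z
  have d2 : DifferentiableAt ℝ (fun z : CSp N => P (0 + initL z)) z :=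
    (hP.comp (contDiff_const.add (initL.restrictScalars ℝ).contDiff)).differentiable (by simp) z
  rw [rh_eq, fderiv_sub_const, fderiv_fun_add d1 d2, add_apply]
  refine (congrArg₂ (· + ·) h1 h2).trans ?_
  rw [fderiv_normsq, zero_add, zero_add]
  rfl

/-- hypothesis of the theorem gives tangential positivity on `P = 1`. -/
lemma wb_use {m : Fin N → ℕ} {P : (Fin N → ℂ) → ℝ} (hP : IsWHP m P)
    (hWB : ∀ q ∈ frontier (DP P), initC q ≠ 0 → ∀ t : CSp N, t ≠ 0 →
      fderiv ℝ (fun z : CSp N => ‖lastC z‖ ^ 2 + P (initC z) - 1) q t = 0 →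
      fderiv ℝ (fun z : CSp N => ‖lastC z‖ ^ 2 + P (initC z) - 1) q
        (Complex.I • t) = 0 →
      0 < fderiv ℝ (fun w : ℂ => fderiv ℝ (fun u : ℂ =>
              ‖lastC (q + u • t)‖ ^ 2 + P (initC (q + u • t)) - 1) w 1) 0 1
        + fderiv ℝ (fun w : ℂ => fderiv ℝ (fun u : ℂ =>
              ‖lastC (q + u • t)‖ ^ 2 + P (initC (q + u • t)) - 1) w Complex.I) 0
            Complex.I)
    (z : Fin N → ℂ) (hz : P z = 1) (τ : Fin N → ℂ) (hτ : τ ≠ 0) (h1 : fderiv ℝ P z τ = 0)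
    (h2 : fderiv ℝ P z (I • τ) = 0) : 0 < Lv P z τ := by
  have hc := whp_cd hP
  have hq : mkPt z 0 ∈ frontier (DP P) := by
    constructor
    · have ht : Tendsto (fun r : ℝ => mkPt (dil m r z) 0) (𝓝[<] 0) (𝓝 (mkPt z 0)) := by
        have hcont : Continuous (fun r : ℝ => mkPt (dil m r z) 0) := by
          refine mk_cont.comp (Continuous.prodMk ?_ continuous_const)
          refine continuous_pi fun j => ?_
          show Continuous fun r : ℝ => exp ((r : ℂ) / (2 * m j)) * z j
          fun_prop
        have := hcont.tendsto 0
        have e : dil m ((0 : ℝ) : ℂ) z = z := by ext j; simp [dil]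
        rw [e] at this
        exact this.mono_left nhdsWithin_le_nhds
      refine mem_closure_of_tendsto ht ?_
      filter_upwards [self_mem_nhdsWithin] with r hr
      simp only [DP, mem_setOf_eq, initC_mk, lastC_mk, whp_dil hP, hz, ofReal_re]
      have := Real.exp_lt_one_iff.2 (show r < 0 from hr)
      simpa using this
    · intro h
      have := interior_subset h
      simp [DP, initC_mk, lastC_mk, hz] at this
  have hz0 : z ≠ 0 := by
    rintro rfl; rw [whp_zero hP] at hz; norm_num at hz
  have ht0 : mkPt τ 0 ≠ (0 : CSp N) := by
    intro h; apply hτ; rw [← initC_mk τ 0, h]; rfl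
  have hI : I • mkPt τ 0 = mkPt (I • τ) (0 : ℂ) := by
    apply pt_ext
    · rw [initC_mk, ← initL_apply, map_smul, initL_apply, initC_mk]
    · rw [lastC_mk, ← lastL_apply, map_smul, lastL_apply, lastC_mk, smul_zero]
  have key := hWB _ hq (by rwa [initC_mk]) (mkPt τ 0) ht0
    (by refine (fderiv_rh hc _ _).trans ?_; simp [initC_mk, lastC_mk, h1])
    (by rw [hI]; refine (fderiv_rh hc _ _).trans ?_; simp [initC_mk, lastC_mk, h2])
  set S : ℂ →L[ℂ] CSp N := (ContinuousLinearMap.id ℂ ℂ).smulRight (mkPt τ 0) with hS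
  have e1 := Lv_aff (rh_cd hc) (mkPt z 0) S 0 1
  have hcd : ContDiff ℝ ∞ (fun y => rh P (mkPt z 0 + S y)) :=
    (rh_cd hc).comp (contDiff_const.add (S.restrictScalars ℝ).contDiff)
  have e2 : 0 < Lv (fun y => rh P (mkPt z 0 + S y)) 0 1 := by
    unfold Lv
    rw [← fderiv2_apply hcd, ← fderiv2_apply hcd]
    have : (I • 1 : ℂ) = I := by simp
    rw [this]
    exact key
  rw [e1, Lv_rh hc] at e2
  simpa [hS, initC_mk, lastC_mk] using e2

end Rho

end PartD5

section PartD6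
open MeasureTheory Filter Topology
open scoped ContDiff ComplexConjugate ENNReal

section Bdd
variable {N : ℕ}

lemma P_bdd {m : Fin N → ℕ} (hm : ∀ j, 0 < m j) {P : (Fin N → ℂ) → ℝ} (hP : IsWHP m P)
    (hPpos : ∀ z' : Fin N → ℂ, z' ≠ 0 → 0 < P z') : ∃ R : ℝ, ∀ z, P z ≤ 1 → ‖z‖ ≤ R := by
  obtain ⟨μ, hμ, hmin⟩ := (isCompact_sphere (0 : Fin N → ℂ) 1).exists_forall_le' (f := P)
    (whp_cd hP).continuous.continuousOn (a := 0) (fun u hu => hPpos u (by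
      rintro rfl; simp at hu))
  refine ⟨max 1 (1 / μ), fun z hz => ?_⟩
  by_cases h1 : ‖z‖ ≤ 1
  · exact h1.trans (le_max_left _ _)
  push Not at h1
  have hcont : Continuous (fun w : ℝ => ‖dil m ((-w : ℝ) : ℂ) z‖) := by
    refine continuous_norm.comp (continuous_pi fun j => ?_)
    show Continuous fun w : ℝ => exp (((-w : ℝ) : ℂ) / (2 * m j)) * z j
    fun_prop
  have hnorm : ∀ (w : ℝ) j, ‖dil m (w : ℂ) z j‖ = Real.exp (w / (2 * m j)) * ‖z j‖ := by
    intro w j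
    rw [dil, norm_mul, norm_exp]
    have : ((w : ℂ) / (2 * m j)) = ((w / (2 * m j) : ℝ) : ℂ) := by push_cast; rfl
    rw [this, ofReal_re]
  have hlim : Tendsto (fun w : ℝ => ‖dil m ((-w : ℝ) : ℂ) z‖) atTop (𝓝 0) := by
    refine tendsto_zero_iff_norm_tendsto_zero.1 (tendsto_pi_nhds.2 fun j => ?_)
    refine tendsto_zero_iff_norm_tendsto_zero.2 ?_
    simp only [hnorm]
    have hmj : (0 : ℝ) < m j := by exact_mod_cast hm j
    have : Tendsto (fun w : ℝ => Real.exp (-(w * (1 / (2 * m j)))) * ‖z j‖) atTop (𝓝 (0 * ‖z j‖)) :=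
      (Real.tendsto_exp_neg_atTop_nhds_zero.comp (tendsto_id.atTop_mul_const (by positivity))).mul_const _
    rw [zero_mul] at this
    refine this.congr fun w => ?_
    congr 2; ring
  obtain ⟨W, hW1, hW0⟩ := ((hlim.eventually (gt_mem_nhds one_pos)).and (eventually_ge_atTop 0)).exists
  obtain ⟨w, hw, hw1⟩ := intermediate_value_Icc' hW0 hcont.continuousOn
    (show (1 : ℝ) ∈ Icc _ _ from ⟨hW1.le, by
      have : dil m ((-0 : ℝ) : ℂ) z = z := by ext j; simp [dil]
      rw [this]; exact h1.le⟩)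
  have h2 := hmin (dil m ((-w : ℝ) : ℂ) z) (by simpa using hw1)
  rw [whp_dil hP, ofReal_re] at h2
  have h3 : Real.exp w ≤ 1 / μ := by
    rw [le_div_iff₀ hμ]
    have : Real.exp w * (Real.exp (-w) * P z) = P z := by rw [← mul_assoc, ← Real.exp_add]; simp
    have := mul_le_mul_of_nonneg_left h2 (Real.exp_pos w).le
    linarith
  refine le_trans ?_ (h3.trans (le_max_right _ _))
  refine (pi_norm_le_iff_of_nonneg (Real.exp_pos w).le).2 fun j => ?_
  have h4 := norm_le_pi_norm (dil m ((-w : ℝ) : ℂ) z) j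
  simp only at hw1
  rw [hw1, hnorm] at h4
  have hmj : (1 : ℝ) ≤ m j := by exact_mod_cast hm j
  have h5 : ‖z j‖ = Real.exp (w / (2 * m j)) * (Real.exp (-w / (2 * m j)) * ‖z j‖) := by
    rw [← mul_assoc, ← Real.exp_add, neg_div, add_neg_cancel, Real.exp_zero, one_mul]
  calc ‖z j‖ ≤ Real.exp (w / (2 * m j)) * 1 := by rw [h5]; gcongr
    _ ≤ Real.exp w := by
      rw [mul_one]; gcongr
      exact div_le_self hw.1 (by linarith)

lemma rh_cpt {m : Fin N → ℕ} (hm : ∀ j, 0 < m j) {P : (Fin N → ℂ) → ℝ} (hP : IsWHP m P)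
    (hPpos : ∀ z' : Fin N → ℂ, z' ≠ 0 → 0 < P z') : IsCompact {z : CSp N | rh P z ≤ 0} := by
  obtain ⟨R, hR⟩ := P_bdd hm hP hPpos
  have hP0 : ∀ z, 0 ≤ P z := fun z => by
    by_cases h : z = 0
    · rw [h, whp_zero hP]
    · exact (hPpos z h).le
  refine (((isCompact_closedBall (0 : Fin N → ℂ) R).prod (isCompact_closedBall (0 : ℂ) 1)).image mk_cont).of_isClosed_subset
    (isClosed_le (rh_cd (whp_cd hP)).continuous continuous_const) ?_
  intro z hz
  have hz' : ‖lastC z‖ ^ 2 + P (initC z) - 1 ≤ 0 := hz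
  refine ⟨(initC z, lastC z), ⟨?_, ?_⟩, mk_eta z⟩
  · rw [mem_closedBall_zero_iff]; exact hR _ (by nlinarith [sq_nonneg ‖lastC z‖])
  · rw [mem_closedBall_zero_iff]
    have := hP0 (initC z)
    have : ‖lastC z‖ ^ 2 ≤ 1 ^ 2 := by linarith
    exact abs_le_of_sq_le_sq' this zero_le_one |>.2

end Bdd

end PartD6

section PartE1
open MeasureTheory Filter Topology
open scoped ContDiff ComplexConjugate ENNReal

section HL
variable {n : ℕ}

/-- linear part of the Levi polynomial -/
def lpo (ρ : EE n → ℝ) (q t : EE n) : ℂ :=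
  ∑ j, ((fderiv ℝ ρ q (ev j) : ℂ) - I * (fderiv ℝ ρ q (I • ev j) : ℂ)) * t j

/-- quadratic part of the Levi polynomial -/
def qpo (ρ : EE n → ℝ) (q t : EE n) : ℂ :=
  ∑ j, ∑ k, ((1 / 2 : ℝ) : ℂ) * ((fderiv ℝ (fderiv ℝ ρ) q (ev k) (ev j) : ℂ) - (fderiv ℝ (fderiv ℝ ρ) q (I • ev k) (I • ev j) : ℂ)
    - I * ((fderiv ℝ (fderiv ℝ ρ) q (ev k) (I • ev j) : ℂ) + (fderiv ℝ (fderiv ℝ ρ) q (I • ev k) (ev j) : ℂ))) * t j * t k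

/-- the negative of the Levi polynomial -/
def hl (ρ : EE n → ℝ) (q t : EE n) : ℂ := -(lpo ρ q t + (1 / 2) * qpo ρ q t)

lemma lpo_re (ρ : EE n → ℝ) (q t : EE n) : (lpo ρ q t).re = fderiv ℝ ρ q t := by
  conv_rhs => rw [ee_decomp t, map_sum]
  rw [lpo, re_sum]
  refine Finset.sum_congr rfl fun j _ => ?_
  simp
  ring

lemma qpo_re (ρ : EE n → ℝ) (q t : EE n) : (qpo ρ q t).re =
    (1 / 2) * (fderiv ℝ (fderiv ℝ ρ) q t t - fderiv ℝ (fderiv ℝ ρ) q (I • t) (I • t)) := by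
  unfold qpo
  set H := fderiv ℝ (fderiv ℝ ρ) q with hH
  have e1 : H t t = ∑ j, ∑ k, ((t k).re * (t j).re * H (ev k) (ev j) + (t k).re * (t j).im * H (ev k) (I • ev j)
      + (t k).im * (t j).re * H (I • ev k) (ev j) + (t k).im * (t j).im * H (I • ev k) (I • ev j)) := by
    conv_lhs => rw [ee_decomp t]
    rw [map_sum]
    refine Finset.sum_congr rfl fun j _ => ?_
    rw [map_sum, sum_apply]
    refine Finset.sum_congr rfl fun k _ => ?_
    simp only [map_add, map_smul, add_apply, smul_apply, smul_eq_mul]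
    ring
  have e2 : H (I • t) (I • t) = ∑ j, ∑ k, ((t k).re * (t j).re * H (I • ev k) (I • ev j) - (t k).re * (t j).im * H (I • ev k) (ev j)
      - (t k).im * (t j).re * H (ev k) (I • ev j) + (t k).im * (t j).im * H (ev k) (ev j)) := by
    conv_lhs => rw [ee_decomp_I t]
    rw [map_sum]
    refine Finset.sum_congr rfl fun j _ => ?_
    rw [map_sum, sum_apply]
    refine Finset.sum_congr rfl fun k _ => ?_
    simp only [map_sub, map_smul, sub_apply, smul_apply, smul_eq_mul]
    ring
  rw [e1, e2, ← Finset.sum_sub_distrib, re_sum, Finset.mul_sum]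
  refine Finset.sum_congr rfl fun j _ => ?_
  rw [← Finset.sum_sub_distrib, re_sum, Finset.mul_sum]
  refine Finset.sum_congr rfl fun k _ => ?_
  simp only [mul_re, mul_im, add_re, add_im, sub_re, sub_im, I_re, I_im, ofReal_re, ofReal_im]
  ring

lemma hl_re (ρ : EE n → ℝ) (q t : EE n) : (hl ρ q t).re =
    -(fderiv ℝ ρ q t + (1 / 2) * fderiv ℝ (fderiv ℝ ρ) q t t) + (1 / 4) * Lv ρ q t := by
  have h : ((1 / 2 : ℂ) * qpo ρ q t).re = (1 / 2) * (qpo ρ q t).re := by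
    have : (1 / 2 : ℂ) = ((1 / 2 : ℝ) : ℂ) := by push_cast; rfl
    rw [this, re_ofReal_mul]
  rw [hl, neg_re, add_re, h, lpo_re, qpo_re, Lv]
  ring

lemma hl_zero (ρ : EE n → ℝ) (q : EE n) : hl ρ q 0 = 0 := by simp [hl, lpo, qpo]

lemma coord_diff (j : Fin n) : Differentiable ℂ (fun t : EE n => t j) :=
  (EuclideanSpace.proj (𝕜 := ℂ) j).differentiable

lemma lpo_diff (ρ : EE n → ℝ) (q : EE n) : Differentiable ℂ (lpo ρ q) := by
  unfold lpo
  exact Differentiable.fun_sum fun j _ => (coord_diff j).const_mul _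

lemma qpo_diff (ρ : EE n → ℝ) (q : EE n) : Differentiable ℂ (qpo ρ q) := by
  unfold qpo
  exact Differentiable.fun_sum fun j _ => Differentiable.fun_sum fun k _ => ((coord_diff j).const_mul _).mul (coord_diff k)

lemma hl_diff (ρ : EE n → ℝ) (q : EE n) : Differentiable ℂ (hl ρ q) := by
  unfold hl
  exact ((lpo_diff ρ q).add ((qpo_diff ρ q).const_mul _)).neg

lemma lpo_smul (ρ : EE n → ℝ) (q t : EE n) (c : ℂ) : lpo ρ q (c • t) = c * lpo ρ q t := by
  simp only [lpo, Finset.mul_sum, PiLp.smul_apply, smul_eq_mul]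
  exact Finset.sum_congr rfl fun j _ => by ring

lemma qpo_smul (ρ : EE n → ℝ) (q t : EE n) (c : ℂ) : qpo ρ q (c • t) = c ^ 2 * qpo ρ q t := by
  simp only [qpo, Finset.mul_sum, PiLp.smul_apply, smul_eq_mul]
  exact Finset.sum_congr rfl fun j _ => Finset.sum_congr rfl fun k _ => by ring

lemma hl_fderiv (ρ : EE n → ℝ) (q t : EE n) : fderiv ℂ (hl ρ q) 0 t = - lpo ρ q t := by
  have h1 : HasDerivAt (fun c : ℂ => hl ρ q (c • t)) (fderiv ℂ (hl ρ q) 0 t) 0 := by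
    have a : HasFDerivAt (hl ρ q) (fderiv ℂ (hl ρ q) 0) ((0 : ℂ) • t) := by
      rw [zero_smul]; exact (hl_diff ρ q 0).hasFDerivAt
    have b : HasDerivAt (fun c : ℂ => c • t) ((1 : ℂ) • t) 0 := (hasDerivAt_id (0 : ℂ)).smul_const t
    have := a.comp_hasDerivAt (0 : ℂ) b
    simpa [Function.comp_def] using this
  have h2 : HasDerivAt (fun c : ℂ => hl ρ q (c • t)) (- lpo ρ q t) 0 := by
    have e : (fun c : ℂ => hl ρ q (c • t)) = fun c => -(c * lpo ρ q t + (1/2) * (c ^ 2 * qpo ρ q t)) := by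
      ext c; rw [hl, lpo_smul, qpo_smul]
    rw [e]
    have := (((hasDerivAt_id (0 : ℂ)).mul_const (lpo ρ q t)).add ((((hasDerivAt_id (0:ℂ)).pow 2).mul_const (qpo ρ q t)).const_mul (1/2))).neg
    refine this.congr_deriv ?_
    simp
  exact h1.unique h2

lemma hl_cont {ρ : EE n → ℝ} (hρ : ContDiff ℝ ∞ ρ) : Continuous (fun p : EE n × EE n => hl ρ p.1 p.2) := by
  have hd : ContDiff ℝ ∞ (fderiv ℝ ρ) := hρ.fderiv_right (by simp)
  have hd2 : ContDiff ℝ ∞ (fderiv ℝ (fderiv ℝ ρ)) := hd.fderiv_right (by simp)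
  have c1 : ∀ v, Continuous (fun p : EE n × EE n => ((fderiv ℝ ρ p.1 v : ℝ) : ℂ)) := fun v =>
    continuous_ofReal.comp ((hd.clm_apply contDiff_const).continuous.comp continuous_fst)
  have c2 : ∀ u v, Continuous (fun p : EE n × EE n => ((fderiv ℝ (fderiv ℝ ρ) p.1 u v : ℝ) : ℂ)) := fun u v =>
    continuous_ofReal.comp (((hd2.clm_apply contDiff_const).clm_apply contDiff_const).continuous.comp continuous_fst)
  have c3 : ∀ j, Continuous (fun p : EE n × EE n => p.2 j) := fun j => (coord_diff j).continuous.comp continuous_snd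
  unfold hl lpo qpo
  refine ((continuous_finsetSum _ fun j _ => ?_).add (continuous_const.mul (continuous_finsetSum _ fun j _ => continuous_finsetSum _ fun k _ => ?_))).neg
  · exact ((c1 _).sub (continuous_const.mul (c1 _))).mul (c3 j)
  · exact ((continuous_const.mul (((c2 _ _).sub (c2 _ _)).sub (continuous_const.mul ((c2 _ _).add (c2 _ _))))).mul (c3 j)).mul (c3 k)

end HL

end PartE1

section PartE2
open MeasureTheory Filter Topology
open scoped ContDiff ComplexConjugate ENNReal

section Cauchy
variable {n : ℕ}

lemma cauchy1 {f : EE n → ℂ} (hf : Differentiable ℂ f) {x : EE n} {δ F : ℝ} (hδ : 0 < δ)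
    (h : ∀ y ∈ ball x δ, ‖f y‖ ≤ F) : ‖fderiv ℂ f x‖ ≤ 2 * F / δ := by
  have hF : 0 ≤ F := (norm_nonneg _).trans (h x (mem_ball_self hδ))
  refine ContinuousLinearMap.opNorm_le_of_unit_norm (𝕜 := ℂ) (by positivity) fun v hv => ?_
  have hd : HasDerivAt (fun c : ℂ => f (x + c • v)) (fderiv ℂ f x v) 0 := by
    have a : HasFDerivAt f (fderiv ℂ f x) (x + (0 : ℂ) • v) := by
      rw [zero_smul, add_zero]; exact (hf x).hasFDerivAt
    have b : HasDerivAt (fun c : ℂ => x + c • v) ((1 : ℂ) • v) 0 := ((hasDerivAt_id (0 : ℂ)).smul_const v).const_add x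
    have := a.comp_hasDerivAt (0 : ℂ) b
    simpa [Function.comp_def] using this
  have hdiff : Differentiable ℂ (fun c : ℂ => f (x + c • v)) := by
    refine hf.comp ?_
    exact (differentiable_const _).add (differentiable_id.smul_const v)
  have := norm_deriv_le_of_forall_mem_sphere_norm_le (c := 0) (R := δ / 2) (C := F) (by positivity) hdiff.diffContOnCl
    (fun z hz => h _ (by
      rw [mem_ball, dist_eq_norm, add_sub_cancel_left, norm_smul, hv, mul_one]
      rw [mem_sphere_zero_iff_norm] at hz
      rw [hz]; linarith))
  rw [hd.deriv] at this
  calc _ ≤ _ := this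
    _ = _ := by field_simp

lemma cauchy2 {f : EE n → ℂ} (hf : Differentiable ℂ f) {q : EE n} {δ F : ℝ} (hδ : 0 < δ)
    (h : ∀ y ∈ ball q (3 * δ), ‖f y‖ ≤ F) {z : EE n} (hz : z ∈ ball q δ) :
    ‖fderiv ℂ f z - fderiv ℂ f q‖ ≤ 4 * F / δ ^ 2 * ‖z - q‖ := by
  have hz' : ‖z - q‖ < δ := by rwa [mem_ball, dist_eq_norm] at hz
  have hF : 0 ≤ F := (norm_nonneg _).trans (h q (mem_ball_self (by positivity)))
  have hd : ∀ x ∈ ball q (2 * δ), ‖fderiv ℂ f x‖ ≤ 2 * F / δ := by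
    intro x hx
    refine cauchy1 hf hδ fun y hy => h y ?_
    rw [mem_ball] at *
    linarith [dist_triangle y x q]
  have hg : Differentiable ℂ (fun y => f (y + (z - q)) - f y) :=
    (hf.comp (differentiable_id.add_const _)).sub hf
  have h1 : ∀ y ∈ ball q δ, ‖f (y + (z - q)) - f y‖ ≤ 2 * F / δ * ‖z - q‖ := by
    intro y hy
    rw [mem_ball, dist_eq_norm] at hy
    have := (convex_ball q (2 * δ)).norm_image_sub_le_of_norm_fderiv_le (fun x _ => hf x) hd
      (x := y) (y := y + (z - q)) (by rw [mem_ball, dist_eq_norm]; linarith)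
      (by
        rw [mem_ball, dist_eq_norm]
        have e : y + (z - q) - q = (y - q) + (z - q) := by abel
        rw [e]; linarith [norm_add_le (y - q) (z - q)])
    rwa [add_sub_cancel_left] at this
  have h2 := cauchy1 hg hδ h1
  have h3 : fderiv ℂ (fun y => f (y + (z - q)) - f y) q = fderiv ℂ f z - fderiv ℂ f q := by
    have a : HasFDerivAt f (fderiv ℂ f z) (q + (z - q)) := by
      rw [add_sub_cancel]; exact (hf z).hasFDerivAt
    have b := (a.comp q ((hasFDerivAt_id q).add_const (z - q))).sub (hf q).hasFDerivAt
    refine b.fderiv.trans ?_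
    simp
  rw [h3] at h2
  calc _ ≤ _ := h2
    _ = _ := by field_simp; ring

/-- second order estimate from a Lipschitz bound of the derivative -/
lemma taylor1 {f : EE n → ℂ} (hf : Differentiable ℂ f) {q : EE n} {δ L : ℝ}
    (h : ∀ z ∈ ball q δ, ‖fderiv ℂ f z - fderiv ℂ f q‖ ≤ L * ‖z - q‖) (hL : 0 ≤ L) {z : EE n} (hz : z ∈ ball q δ) :
    ‖f z - f q - fderiv ℂ f q (z - q)‖ ≤ L * ‖z - q‖ ^ 2 := by
  rw [mem_ball, dist_eq_norm] at hz
  have := (convex_closedBall q ‖z - q‖).norm_image_sub_le_of_norm_fderiv_le' (𝕜 := ℂ) (f := f) (φ := fderiv ℂ f q)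
    (C := L * ‖z - q‖) (fun x _ => hf x) (fun x hx => by
      rw [mem_closedBall, dist_eq_norm] at hx
      refine (h x (by rw [mem_ball, dist_eq_norm]; linarith)).trans ?_
      gcongr) (x := q) (y := z) (mem_closedBall_self (norm_nonneg _)) (by rw [mem_closedBall, dist_eq_norm])
  calc _ ≤ _ := this
    _ = _ := by ring

lemma taylor2 {g : EE n → ℝ} (hg : ContDiff ℝ ∞ g) {q : EE n} {R ε : ℝ} (hε : 0 ≤ ε)
    (h : ∀ x ∈ ball q R, ‖fderiv ℝ (fderiv ℝ g) x - fderiv ℝ (fderiv ℝ g) q‖ ≤ ε) {t : EE n} (ht : ‖t‖ < R) :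
    |g (q + t) - g q - fderiv ℝ g q t - (1 / 2) * fderiv ℝ (fderiv ℝ g) q t t| ≤ ε * ‖t‖ ^ 2 := by
  have hsymm : ∀ u v, fderiv ℝ (fderiv ℝ g) q u v = fderiv ℝ (fderiv ℝ g) q v u := by
    intro u v
    exact (hg.contDiffAt (x := q)).isSymmSndFDerivAt (by simp; exact WithTop.coe_le_coe.2 (le_top : (2:ℕ∞) ≤ ⊤)) u v
  set B := fderiv ℝ (fderiv ℝ g) q with hB
  have hd : ContDiff ℝ ∞ (fderiv ℝ g) := hg.fderiv_right (by simp)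
  have h1 : ∀ y ∈ ball q R, ‖fderiv ℝ g y - fderiv ℝ g q - B (y - q)‖ ≤ ε * ‖y - q‖ := by
    intro y hy
    exact (convex_ball q R).norm_image_sub_le_of_norm_fderiv_le' (𝕜 := ℝ) (fun x _ => hd.differentiable (by simp) x) h
      (mem_ball_self ((dist_nonneg).trans_lt hy)) hy
  have hφ : ∀ y, HasFDerivAt (fun y => g y - fderiv ℝ g q (y - q) - (1 / 2) * B (y - q) (y - q))
      (fderiv ℝ g y - fderiv ℝ g q - B (y - q)) y := by
    intro y
    have a1 := (hg.differentiable (by simp) y).hasFDerivAt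
    have a0 : HasFDerivAt (fun y : EE n => y - q) (ContinuousLinearMap.id ℝ (EE n)) y := (hasFDerivAt_id y).sub_const q
    have a2 := (fderiv ℝ g q).hasFDerivAt.comp y a0
    have a3 := ((B.hasFDerivAt.comp y a0).clm_apply a0).const_mul (1 / 2)
    refine ((a1.sub a2).sub a3).congr_fderiv ?_
    ext u
    simp
    rw [hsymm u y, hsymm u q]
    ring
  have h2 := (convex_closedBall q ‖t‖).norm_image_sub_le_of_norm_hasFDerivWithin_le (C := ε * ‖t‖)
    (fun y _ => (hφ y).hasFDerivWithinAt) (fun y hy => by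
      rw [mem_closedBall, dist_eq_norm] at hy
      refine (h1 y (by rw [mem_ball, dist_eq_norm]; linarith)).trans ?_
      gcongr) (x := q) (y := q + t) (mem_closedBall_self (norm_nonneg _)) (by rw [mem_closedBall, dist_eq_norm]; simp)
  simp only [add_sub_cancel_left, sub_self, map_zero, Real.norm_eq_abs, mul_zero, sub_zero] at h2
  calc _ = _ := by congr 1; ring
    _ ≤ _ := h2
    _ = _ := by ring

lemma exp_lower {u : ℝ} (hu : 0 ≤ u) : u / (1 + u) ≤ 1 - Real.exp (-u) := by
  have h := Real.add_one_le_exp u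
  have h2 : Real.exp (-u) ≤ 1 / (1 + u) := by
    rw [Real.exp_neg, inv_eq_one_div]
    apply one_div_le_one_div_of_le <;> linarith
  have : u / (1 + u) = 1 - 1 / (1 + u) := by field_simp; ring
  linarith

end Cauchy

end PartE2

section PartE3
open MeasureTheory Filter Topology
open scoped ContDiff ComplexConjugate ENNReal

section Unif
variable {n : ℕ}

lemma unif_near {X Y : Type*} [PseudoMetricSpace X] [PseudoMetricSpace Y] {f : X → Y} (hf : Continuous f) {S : Set X} (hS : IsCompact S)
    {ε : ℝ} (hε : 0 < ε) : ∃ r > 0, ∀ q ∈ S, ∀ x ∈ ball q r, dist (f x) (f q) ≤ ε := by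
  have := hS.uniformContinuousAt_of_continuousAt f (fun x _ => hf.continuousAt) (dist_mem_uniformity hε)
  obtain ⟨r, hr, h⟩ := mem_uniformity_dist.1 this
  refine ⟨r, hr, fun q hq x hx => ?_⟩
  have := h (a := q) (b := x) (by rwa [dist_comm]) hq
  rw [dist_comm]; exact le_of_lt this

lemma unif_data {ρ : EE n → ℝ} (hρ : ContDiff ℝ ∞ ρ) {S : Set (EE n)} (hS : IsCompact S)
    (hpos : ∀ q ∈ S, ∀ t, t ≠ 0 → 0 < Lv ρ q t) :
    ∃ c > 0, ∃ r > 0, ∀ q ∈ S, ∀ x ∈ ball q (3 * r), (∀ t, c * ‖t‖ ^ 2 ≤ Lv ρ x t) ∧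
      c * ‖x - q‖ ^ 2 ≤ (hl ρ q (x - q)).re + ρ x - ρ q := by
  have hd : ContDiff ℝ ∞ (fderiv ℝ ρ) := hρ.fderiv_right (by simp)
  have hd2 : ContDiff ℝ ∞ (fderiv ℝ (fderiv ℝ ρ)) := hd.fderiv_right (by simp)
  have hcont : Continuous (fun p : EE n × EE n => Lv ρ p.1 p.2) := by
    unfold Lv
    have h1 : Continuous (fun p : EE n × EE n => fderiv ℝ (fderiv ℝ ρ) p.1) := hd2.continuous.comp continuous_fst
    have h2 : Continuous (fun p : EE n × EE n => I • p.2) := continuous_snd.const_smul I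
    exact ((h1.clm_apply continuous_snd).clm_apply continuous_snd).add ((h1.clm_apply h2).clm_apply h2)
  obtain ⟨c4, hc4, hmin⟩ := (hS.prod (isCompact_sphere (0 : EE n) 1)).exists_forall_le' hcont.continuousOn (a := 0)
    (fun p hp => hpos p.1 hp.1 p.2 (by
      have := mem_sphere_zero_iff_norm.1 hp.2
      intro h0; rw [h0, norm_zero] at this; norm_num at this))
  have hq : ∀ q ∈ S, ∀ t, c4 * ‖t‖ ^ 2 ≤ Lv ρ q t := by
    intro q hq t
    by_cases ht : t = 0
    · simp [ht, Lv]
    have hn : 0 < ‖t‖ := norm_pos_iff.2 ht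
    have h1 := hmin (q, ‖t‖⁻¹ • t) ⟨hq, by
      rw [mem_sphere_zero_iff_norm, norm_smul, norm_inv, norm_norm]; field_simp⟩
    have h2 : Lv ρ q (‖t‖⁻¹ • t) = ‖t‖⁻¹ ^ 2 * Lv ρ q t := by
      unfold Lv
      rw [smul_comm I]
      simp only [map_smul, smul_apply, smul_eq_mul]
      ring
    simp only [h2] at h1
    calc c4 * ‖t‖ ^ 2 ≤ (‖t‖⁻¹ ^ 2 * Lv ρ q t) * ‖t‖ ^ 2 := by gcongr
      _ = _ := by field_simp
  obtain ⟨r, hr, hB⟩ := unif_near hd2.continuous hS (show 0 < c4 / 8 by positivity)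
  refine ⟨c4 / 8, by positivity, r / 3, by positivity, fun q hqS x hx => ?_⟩
  have e3 : 3 * (r / 3) = r := by ring
  rw [e3] at hx
  have hx' : ‖x - q‖ < r := by rwa [mem_ball, dist_eq_norm] at hx
  constructor
  · intro t
    have hb := hB q hqS x hx
    rw [dist_eq_norm] at hb
    have h1 : ∀ u, |fderiv ℝ (fderiv ℝ ρ) x u u - fderiv ℝ (fderiv ℝ ρ) q u u| ≤ c4 / 8 * ‖u‖ ^ 2 := by
      intro u
      have := ContinuousLinearMap.le_opNorm₂ (fderiv ℝ (fderiv ℝ ρ) x - fderiv ℝ (fderiv ℝ ρ) q) u u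
      simp only [sub_apply, Real.norm_eq_abs] at this
      refine this.trans ?_
      rw [mul_assoc, ← sq]
      gcongr
    have h2 := abs_le.1 (h1 t)
    have h3 := abs_le.1 (h1 (I • t))
    have h4 : ‖I • t‖ = ‖t‖ := by rw [norm_smul]; simp
    rw [h4] at h3
    have h5 := hq q hqS t
    unfold Lv at h5 ⊢
    nlinarith [h2.1, h3.1, sq_nonneg ‖t‖]
  · have h1 := taylor2 hρ (q := q) (R := r) (ε := c4 / 8) (by positivity) (fun y hy => by
      have := hB q hqS y hy
      rwa [dist_eq_norm] at this) hx'
    rw [add_sub_cancel] at h1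
    rw [hl_re]
    have h2 := hq q hqS (x - q)
    have := (abs_le.1 h1).1
    nlinarith [sq_nonneg ‖x - q‖]

end Unif

end PartE3

section PartE4
open MeasureTheory Filter Topology
open scoped ContDiff ComplexConjugate ENNReal

section Peak
variable {n : ℕ}

lemma hl_cd (ρ : EE n → ℝ) (q : EE n) : ContDiff ℝ ∞ (hl ρ q) := by
  have hc : ∀ j, ContDiff ℝ ∞ (fun t : EE n => t j) := fun j => ((EuclideanSpace.proj (𝕜 := ℂ) j).restrictScalars ℝ).contDiff
  unfold hl lpo qpo
  exact ((ContDiff.sum fun j _ => contDiff_const.mul (hc j)).add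
    (contDiff_const.mul (ContDiff.sum fun j _ => ContDiff.sum fun k _ => (contDiff_const.mul (hc j)).mul (hc k)))).neg

lemma wd_hol {g : EE n → ℂ} (hg : Differentiable ℂ g) (j : Fin n) (x : EE n) : wd I j g x = 0 := by
  have h : fderiv ℝ g x = (fderiv ℂ g x).restrictScalars ℝ := ((hg x).hasFDerivAt.restrictScalars ℝ).fderiv
  rw [wd, h]
  simp only [ContinuousLinearMap.coe_restrictScalars', map_smul, smul_eq_mul]
  linear_combination (1 / 2) * fderiv ℂ g x (ev j) * I_mul_I

/-- the local exponential -/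
def gq (ρ : EE n → ℝ) (k : ℝ) (q z : EE n) : ℂ := exp (-((k : ℂ) * hl ρ q (z - q)))

lemma gq_diff (ρ : EE n → ℝ) (k : ℝ) (q : EE n) : Differentiable ℂ (gq ρ k q) := by
  unfold gq
  exact (((hl_diff ρ q).comp (differentiable_id.sub_const q)).const_mul _).neg.cexp

lemma gq_cd (ρ : EE n → ℝ) (k : ℝ) (q : EE n) : ContDiff ℝ ∞ (gq ρ k q) := by
  unfold gq
  exact (contDiff_const.mul ((hl_cd ρ q).comp (contDiff_id.sub contDiff_const))).neg.cexp

lemma gq_norm (ρ : EE n → ℝ) (k : ℝ) (q z : EE n) : ‖gq ρ k q z‖ = Real.exp (-(k * (hl ρ q (z - q)).re)) := by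
  rw [gq, norm_exp, neg_re, re_ofReal_mul]

lemma rough_int {ρ : EE n → ℝ} {c r k : ℝ} (hr : 0 < r) (hc : 0 < c) (hk : 1 ≤ k) {q : EE n}
    (hq0 : ρ q = 0)
    (h : ∀ x ∈ ball q (3 * r), c * ‖x - q‖ ^ 2 ≤ (hl ρ q (x - q)).re + ρ x - ρ q)
    {η : EE n → ℂ} {C0 : ℝ} (hη : ContDiff ℝ ∞ η) (h1 : ∀ x, ‖x‖ ≤ r → η x = 1) (h0 : ∀ x, 2 * r ≤ ‖x‖ → η x = 0)
    (hηd : ∀ x, ‖fderiv ℝ η x‖ ≤ C0 / r) :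
    ∫ x, (∑ j, ‖wd I j (fun z => η (z - q) * gq ρ k q z) x‖ ^ 2) * Real.exp (-(2 * k * ρ x)) ≤
      (n * (C0 / r) ^ 2 * Real.exp (-(2 * k * (c * r ^ 2)))) * (volume (closedBall (0 : EE n) (2 * r))).toReal := by
  have hχ : ContDiff ℝ ∞ (fun z => η (z - q)) := hη.comp (contDiff_id.sub contDiff_const)
  have hfd : ∀ x, fderiv ℝ (fun z => η (z - q)) x = fderiv ℝ η (x - q) := fun x => fderiv_comp_sub q
  have hwd : ∀ j x, wd I j (fun z => η (z - q) * gq ρ k q z) x = wd I j (fun z => η (z - q)) x * gq ρ k q x := by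
    intro j x
    rw [wd_mul (hχ.differentiable (by simp) x) ((gq_cd ρ k q).differentiable (by simp) x), wd_hol (gq_diff ρ k q)]
    ring
  have hz : ∀ x, (‖x - q‖ < r ∨ 2 * r < ‖x - q‖) → fderiv ℝ η (x - q) = 0 := by
    rintro x (hx | hx)
    · have : η =ᶠ[𝓝 (x - q)] fun _ => 1 := by
        filter_upwards [continuous_norm.continuousAt.eventually_lt continuousAt_const hx] with y hy
        exact h1 y (le_of_lt hy)
      rw [this.fderiv_eq]; simp
    · have : η =ᶠ[𝓝 (x - q)] fun _ => 0 := by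
        filter_upwards [continuousAt_const.eventually_lt continuous_norm.continuousAt hx] with y hy
        exact h0 y (le_of_lt hy)
      rw [this.fderiv_eq]; simp
  set A : ℝ := n * (C0 / r) ^ 2 * Real.exp (-(2 * k * (c * r ^ 2))) with hA
  have hA0 : 0 ≤ A := by positivity
  have hpt : ∀ x, (∑ j, ‖wd I j (fun z => η (z - q) * gq ρ k q z) x‖ ^ 2) * Real.exp (-(2 * k * ρ x)) ≤
      (closedBall q (2 * r)).indicator (fun _ => A) x := by
    intro x
    by_cases hx : r ≤ ‖x - q‖ ∧ ‖x - q‖ ≤ 2 * r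
    · rw [indicator_of_mem (by rw [mem_closedBall, dist_eq_norm]; exact hx.2)]
      have e1 : ∀ j, ‖wd I j (fun z => η (z - q) * gq ρ k q z) x‖ ^ 2 ≤ (C0 / r) ^ 2 * ‖gq ρ k q x‖ ^ 2 := by
        intro j
        rw [hwd, norm_mul, mul_pow]
        have := (wd_norm_le I (by simp) j (fun z => η (z - q)) x).trans ((congrArg norm (hfd x)).le.trans (hηd _))
        gcongr
      have e2 : ‖gq ρ k q x‖ ^ 2 * Real.exp (-(2 * k * ρ x)) ≤ Real.exp (-(2 * k * (c * r ^ 2))) := by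
        rw [gq_norm, ← Real.exp_nat_mul, ← Real.exp_add]
        apply Real.exp_le_exp.2
        have := h x (by rw [mem_ball, dist_eq_norm]; linarith)
        rw [hq0] at this
        have h3 : c * r ^ 2 ≤ c * ‖x - q‖ ^ 2 := by
          have := hx.1
          gcongr
        have h4 : k * (c * r ^ 2) ≤ k * ((hl ρ q (x - q)).re + ρ x) := by
          apply mul_le_mul_of_nonneg_left _ (by linarith)
          linarith
        push_cast
        linarith
      calc _ ≤ (∑ j : Fin n, (C0 / r) ^ 2 * ‖gq ρ k q x‖ ^ 2) * Real.exp (-(2 * k * ρ x)) := by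
            gcongr with j _
            exact e1 j
        _ = n * (C0 / r) ^ 2 * (‖gq ρ k q x‖ ^ 2 * Real.exp (-(2 * k * ρ x))) := by
            simp; ring
        _ ≤ _ := by rw [hA]; gcongr
    · have hx' : ‖x - q‖ < r ∨ 2 * r < ‖x - q‖ := by
        by_contra hcon
        push Not at hcon
        exact hx hcon
      have e1 : ∀ j, wd I j (fun z => η (z - q) * gq ρ k q z) x = 0 := by
        intro j
        rw [hwd, wd, hfd, hz x hx']; simp
      simp only [e1]
      simp
      exact indicator_nonneg (fun _ _ => hA0) x
  have hfin : volume (closedBall q (2 * r)) < ⊤ := measure_closedBall_lt_top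
  have hIntg : Integrable ((closedBall q (2 * r)).indicator (fun _ => A)) (volume : Measure (EE n)) :=
    (integrable_indicator_iff measurableSet_closedBall).2 (integrableOn_const hfin.ne)
  refine (integral_mono_of_nonneg (Eventually.of_forall fun x => ?_) hIntg (Eventually.of_forall hpt)).trans ?_
  · simp only [Pi.zero_apply]; positivity
  · rw [integral_indicator measurableSet_closedBall, setIntegral_const, smul_eq_mul, Measure.real, mul_comm]
    have : volume (closedBall q (2 * r)) = volume (closedBall (0 : EE n) (2 * r)) :=
      Measure.addHaar_closedBall_center volume q _
    rw [this]

end Peak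

end PartE4

section PartE5
open MeasureTheory Filter Topology
open scoped ContDiff ComplexConjugate ENNReal

section Peak2
variable {n : ℕ}

set_option maxHeartbeats 2000000 in
lemma rough_peak {ρ : EE n → ℝ} (hρ : ContDiff ℝ ∞ ρ) (hL : ∀ x t, 0 ≤ Lv ρ x t)
    (hT : IsCompact {x | ρ x ≤ 0}) {S : Set (EE n)} (hS : IsCompact S) (hS0 : ∀ q ∈ S, ρ q = 0)
    (hpos : ∀ q ∈ S, ∀ t, t ≠ 0 → 0 < Lv ρ q t) :
    ∃ δ > 0, ∃ γ > 0, ∃ c > 0, ∃ K > 0, (∀ q ∈ S, ∀ x ∈ ball q (3 * δ), ρ x ≤ 0 → c * ‖x - q‖ ^ 2 ≤ (hl ρ q (x - q)).re) ∧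
      ∀ k : ℝ, 1 ≤ k → ∃ F : ℝ, ∀ q ∈ S, ∃ f : EE n → ℂ, Differentiable ℂ f ∧
        (∀ x, ρ x ≤ 0 → δ ≤ ‖x - q‖ → ‖f x‖ ≤ K * Real.exp (-(k * γ))) ∧
        (∀ x ∈ ball q (3 * δ), ‖gq ρ k q x - f x‖ ≤ K * Real.exp (-(k * γ))) ∧
        (∀ x y, ρ y ≤ 0 → dist x y < 3 * δ → ‖f x‖ ≤ F) := by
  obtain ⟨c, hc, r, hr, hdata⟩ := unif_data hρ hS hpos
  set ε := c * r ^ 2 / 8 with hε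
  have hε0 : 0 < ε := by positivity
  obtain ⟨δ1, hδ1, hnear⟩ := unif_near hρ.continuous hT hε0
  set δ := min (δ1 / 4) (r / 8) with hδ
  have hδ0 : 0 < δ := by positivity
  have hδa : 4 * δ ≤ δ1 := by have := min_le_left (δ1 / 4) (r / 8); linarith
  have hδb : δ ≤ r / 8 := min_le_right _ _
  have hnear' : ∀ x y, ρ y ≤ 0 → dist x y < 4 * δ → ρ x ≤ ε := by
    intro x y hy hxy
    have := hnear y hy x (by rw [mem_ball]; linarith)
    rw [Real.dist_eq] at this
    linarith [(abs_le.1 this).2]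
  obtain ⟨C1, hC1, hT1⟩ := T1 n hδ0
  obtain ⟨C0, hC0, hcut⟩ := cutoff n
  obtain ⟨η, hη, hηs, -, hη1, hηr, hη0, hηd, hηt⟩ := hcut r hr
  set Vb := (volume (closedBall (0 : EE n) (2 * r))).toReal with hVb
  set K1 : ℝ := C1 * (2 / c) * (n * (C0 / r) ^ 2) * Vb with hK1
  have hVb0 : 0 ≤ Vb := ENNReal.toReal_nonneg
  have hK10 : 0 ≤ K1 := by positivity
  set γ := min ε (c * δ ^ 2) with hγ
  have hγ0 : 0 < γ := by positivity
  obtain ⟨H, hH⟩ := ((hS.prod (isCompact_closedBall (0 : EE n) (2 * r))).image (hl_cont hρ)).isBounded.exists_norm_le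
  have hH' : ∀ q ∈ S, ∀ x, ‖x - q‖ ≤ 2 * r → ‖hl ρ q (x - q)‖ ≤ H := by
    intro q hq x hx
    exact hH _ ⟨(q, x - q), ⟨hq, by rwa [mem_closedBall_zero_iff]⟩, rfl⟩
  refine ⟨δ, hδ0, γ, hγ0, c, hc, C1 + K1 + 2, by positivity, ?_, ?_⟩
  · intro q hq x hx hρx
    have := (hdata q hq x (by rw [mem_ball] at *; linarith)).2
    rw [hS0 q hq] at this
    linarith
  intro k hk
  have hk0 : 0 < k := by linarith
  refine ⟨C1 * Real.exp (k * H) + (K1 + 1), fun q hq => ?_⟩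
  set v : EE n → ℂ := fun z => η (z - q) * gq ρ k q z with hv
  have hvc : ContDiff ℝ ∞ v := (hη.comp (contDiff_id.sub contDiff_const)).mul (gq_cd ρ k q)
  have hvt : tsupport v ⊆ closedBall q (2 * r) := by
    refine closure_minimal (fun x hx => ?_) isClosed_closedBall
    rw [mem_closedBall, dist_eq_norm]
    by_contra hcon
    push Not at hcon
    apply hx
    simp [hv, hη0 _ hcon.le]
  have hvs : HasCompactSupport v := (isCompact_closedBall q (2 * r)).of_isClosed_subset (isClosed_tsupport v) hvt
  have hφc : ContDiff ℝ ∞ (fun x => 2 * k * ρ x) := contDiff_const.mul hρ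
  have hlev : ∀ x (t : Fin n → ℂ), levi (fun x => 2 * k * ρ x) x t = (k / 2) * Lv ρ x (WithLp.toLp 2 t) := by
    intro x t
    have := levi_eq hφc x (WithLp.toLp 2 t)
    rw [Lv_const_mul hρ] at this
    refine this.trans (by ring)
  obtain ⟨f, hf, hf1, hf2⟩ := hT1 (fun x => 2 * k * ρ x) v (c / 2) hφc hvc hvs (by positivity)
    (fun x t => by rw [hlev]; have := hL x (WithLp.toLp 2 t); positivity)
    (fun x hx t => by
      rw [hlev]
      have h1 := (hdata q hq x (by have := hvt hx; rw [mem_closedBall] at this; rw [mem_ball]; linarith)).1 (WithLp.toLp 2 t)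
      have h2 : ‖WithLp.toLp 2 t‖ ^ 2 = ∑ j, ‖t j‖ ^ 2 := by rw [EuclideanSpace.norm_sq_eq]
      rw [h2] at h1
      have h4 : 0 ≤ Lv ρ x (WithLp.toLp 2 t) := hL x _
      have h5 := mul_le_mul_of_nonneg_right hk h4
      linarith)
  have hIntg := rough_int (k := k) hr hc hk (hS0 q hq) (fun x hx => (hdata q hq x hx).2) hη hηr hη0 hηd
  set J := ∫ x, (∑ j, ‖wd I j v x‖ ^ 2) * Real.exp (-(2 * k * ρ x)) with hJ
  set s := (K1 + 1) * Real.exp (-(k * ε)) with hs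
  have hs0 : 0 ≤ s := by positivity
  have hsle : C1 * (Real.exp (2 * k * ε) * (1 / (c / 2) * J)) ≤ s ^ 2 := by
    calc C1 * (Real.exp (2 * k * ε) * (1 / (c / 2) * J)) ≤ C1 * (Real.exp (2 * k * ε) * (1 / (c / 2) *
            ((n * (C0 / r) ^ 2 * Real.exp (-(2 * k * (c * r ^ 2)))) * Vb))) := by gcongr
      _ = K1 * (Real.exp (2 * k * ε) * Real.exp (-(2 * k * (c * r ^ 2)))) := by
            rw [hK1]; field_simp
      _ ≤ (K1 + 1) ^ 2 * Real.exp (-(2 * (k * ε))) := by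
            rw [← Real.exp_add]
            gcongr
            · nlinarith
            · have : c * r ^ 2 = 8 * ε := by rw [hε]; ring
              rw [this]; nlinarith [mul_pos hk0 hε0]
      _ = s ^ 2 := by
            rw [hs, mul_pow, ← Real.exp_nat_mul]; push_cast; ring_nf
  have hve : ∀ x, ‖x - q‖ ≤ r → v x = gq ρ k q x := fun x hx => by simp [hv, hηr _ hx]
  have hexp1 : Real.exp (-(k * ε)) ≤ Real.exp (-(k * γ)) := by
    gcongr; exact min_le_left _ _
  have hexp2 : Real.exp (-(k * (c * δ ^ 2))) ≤ Real.exp (-(k * γ)) := by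
    gcongr; exact min_le_right _ _
  have hclose : ∀ x y, ρ y ≤ 0 → dist x y < 3 * δ → ‖x - q‖ + δ ≤ r → ‖gq ρ k q x - f x‖ ≤ s := by
    intro x y hy hxy hxq
    have := hf1 x (2 * k * ε) (fun z hz => by
      have := hnear' z y hy (by rw [mem_ball] at hz; linarith [dist_triangle z x y])
      gcongr) (gq ρ k q) (gq_diff ρ k q) (fun z hz => hve z (by
        rw [mem_ball, dist_eq_norm] at hz
        have : z - q = (z - x) + (x - q) := by abel
        rw [this]
        linarith [norm_add_le (z - x) (x - q)]))
    exact abs_le_of_sq_le_sq' (this.trans hsle) hs0 |>.2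
  refine ⟨f, hf, ?_, ?_, ?_⟩
  · intro x hx hxq
    by_cases hfar : ‖x - q‖ + δ ≤ r
    · have h1 := hclose x x hx (by simpa using hδ0) hfar
      have h2 : ‖gq ρ k q x‖ ≤ Real.exp (-(k * (c * δ ^ 2))) := by
        rw [gq_norm]
        have := (hdata q hq x (by rw [mem_ball, dist_eq_norm]; linarith)).2
        rw [hS0 q hq] at this
        have h3 : c * δ ^ 2 ≤ (hl ρ q (x - q)).re := by
          have : c * δ ^ 2 ≤ c * ‖x - q‖ ^ 2 := by gcongr
          linarith
        gcongr
      have h4 : ‖f x‖ ≤ ‖gq ρ k q x‖ + ‖gq ρ k q x - f x‖ := by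
        have := norm_sub_le (gq ρ k q x) (gq ρ k q x - f x)
        simpa using this
      have h5 : s ≤ (K1 + 1) * Real.exp (-(k * γ)) := by rw [hs]; gcongr
      have h8 := Real.exp_pos (-(k * γ))
      have h9 : 0 < C1 * Real.exp (-(k * γ)) := by positivity
      linarith [add_mul (C1 + K1) 2 (Real.exp (-(k * γ))), add_mul C1 K1 (Real.exp (-(k * γ))), add_mul K1 1 (Real.exp (-(k * γ)))]
    · push Not at hfar
      have h1 := hf2 x (2 * k * ε) (Real.exp (-(k * ε))) s (fun z hz => by
        have := hnear' z x hx (by rw [mem_ball] at hz; linarith)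
        gcongr) (fun z hz => by
          rw [mem_ball, dist_eq_norm] at hz
          by_cases hz2 : 2 * r ≤ ‖z - q‖
          · simp only [hv, hη0 _ hz2, zero_mul, norm_zero]; positivity
          push Not at hz2
          have e1 : ‖v z‖ ≤ ‖gq ρ k q z‖ := by
            rw [hv]; simp only [norm_mul]
            exact mul_le_of_le_one_left (norm_nonneg _) (hη1 _)
          refine e1.trans ?_
          rw [gq_norm]
          have e2 := (hdata q hq z (by rw [mem_ball, dist_eq_norm]; linarith)).2
          rw [hS0 q hq] at e2
          have e3 : r * (3 / 4) ≤ ‖z - q‖ := by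
            have : x - q = (z - q) - (z - x) := by abel
            have h6 := norm_sub_le (z - q) (z - x)
            rw [← this] at h6
            linarith
          have e4 : ρ z ≤ ε := hnear' z x hx (by rw [dist_eq_norm]; linarith)
          have e5 : ε ≤ (hl ρ q (z - q)).re := by
            have : c * (r * (3 / 4)) ^ 2 ≤ c * ‖z - q‖ ^ 2 := by gcongr
            have e6 : c * (r * (3 / 4)) ^ 2 = 9 / 2 * ε := by rw [hε]; ring
            linarith
          gcongr) hs0 hsle
      have h5 : s ≤ (K1 + 1) * Real.exp (-(k * γ)) := by rw [hs]; gcongr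
      have h7 := mul_le_mul_of_nonneg_left hexp1 hC1.le
      have h8 := Real.exp_pos (-(k * γ))
      linarith [h1, h5, h7, h8, add_mul (C1 + K1) 2 (Real.exp (-(k * γ))), add_mul C1 K1 (Real.exp (-(k * γ))), add_mul K1 1 (Real.exp (-(k * γ)))]
  · intro x hx
    rw [mem_ball] at hx
    have h1 := hclose x q (hS0 q hq).le hx (by rw [← dist_eq_norm]; linarith)
    have h5 : s ≤ (K1 + 1) * Real.exp (-(k * γ)) := by rw [hs]; gcongr
    have h8 := Real.exp_pos (-(k * γ))
    have h9 : 0 < C1 * Real.exp (-(k * γ)) := by positivity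
    linarith [add_mul (C1 + K1) 2 (Real.exp (-(k * γ))), add_mul C1 K1 (Real.exp (-(k * γ))), add_mul K1 1 (Real.exp (-(k * γ)))]
  · intro x y hy hxy
    have h1 := hf2 x (2 * k * ε) (Real.exp (k * H)) s (fun z hz => by
        have := hnear' z y hy (by rw [mem_ball] at hz; linarith [dist_triangle z x y])
        gcongr) (fun z hz => by
          by_cases hz2 : 2 * r ≤ ‖z - q‖
          · simp only [hv, hη0 _ hz2, zero_mul, norm_zero]; positivity
          push Not at hz2
          have e1 : ‖v z‖ ≤ ‖gq ρ k q z‖ := by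
            rw [hv]; simp only [norm_mul]
            exact mul_le_of_le_one_left (norm_nonneg _) (hη1 _)
          refine e1.trans ?_
          rw [gq_norm]
          have e2 := hH' q hq z hz2.le
          have e3 := (abs_le.1 ((abs_re_le_norm _).trans e2)).1
          apply Real.exp_le_exp.2
          nlinarith) hs0 hsle
    refine h1.trans ?_
    have : Real.exp (-(k * ε)) ≤ 1 := Real.exp_le_one_iff.2 (by nlinarith [mul_pos hk0 hε0])
    have : s ≤ K1 + 1 := by rw [hs]; exact mul_le_of_le_one_right (by positivity) this
    linarith

end Peak2

end PartE5

section PartE6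
open MeasureTheory Filter Topology
open scoped ContDiff ComplexConjugate ENNReal

section Peak3
variable {n : ℕ}

set_option maxHeartbeats 2000000 in
lemma peak {ρ : EE n → ℝ} (hρ : ContDiff ℝ ∞ ρ) (hL : ∀ x t, 0 ≤ Lv ρ x t)
    (hT : IsCompact {x | ρ x ≤ 0}) {S : Set (EE n)} (hS : IsCompact S) (hS0 : ∀ q ∈ S, ρ q = 0)
    (hpos : ∀ q ∈ S, ∀ t, t ≠ 0 → 0 < Lv ρ q t) :
    ∃ k : ℝ, 1 ≤ k ∧ ∃ c > 0, ∃ C > 0, ∃ δ > 0, ∀ q ∈ S, ∃ h : EE n → ℂ, Differentiable ℂ h ∧ h q = 0 ∧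
      (∀ t, fderiv ℂ h q t = -(k * lpo ρ q t)) ∧ (∀ z, ρ z ≤ 0 → c * ‖z - q‖ ^ 2 ≤ (h z).re) ∧
      (∀ z, ρ z ≤ 0 ∨ z ∈ ball q δ → ‖fderiv ℂ h z - fderiv ℂ h q‖ ≤ C * ‖z - q‖) := by
  obtain ⟨δ, hδ, γ, hγ, c, hc, K, hK, hnear, hk⟩ := rough_peak hρ hL hT hS hS0 hpos
  obtain ⟨R, hR⟩ := hT.isBounded.exists_norm_le
  set D := 2 * |R| + 1 with hD
  have hD0 : 0 < D := by positivity
  have hdiam : ∀ x y, ρ x ≤ 0 → ρ y ≤ 0 → ‖x - y‖ ≤ D := by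
    intro x y hx hy
    have := hR x hx
    have := hR y hy
    have := norm_sub_le x y
    have := le_abs_self R
    linarith
  set c1 := c / (1 + c * δ ^ 2) with hc1
  have hc10 : 0 < c1 := by positivity
  set s0 := min (1 / (2 * (2 + 2 * D / δ))) (c1 * δ ^ 2 / 8) with hs0
  have hs00 : 0 < s0 := by positivity
  obtain ⟨k, hk1, hks⟩ : ∃ k : ℝ, 1 ≤ k ∧ K * Real.exp (-(k * γ)) ≤ s0 := by
    have h1 : Tendsto (fun k : ℝ => K * Real.exp (-(k * γ))) atTop (𝓝 (K * 0)) :=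
      (Real.tendsto_exp_neg_atTop_nhds_zero.comp (tendsto_id.atTop_mul_const hγ)).const_mul K
    rw [mul_zero] at h1
    obtain ⟨k, h2, h3⟩ := ((h1.eventually (gt_mem_nhds hs00)).and (eventually_ge_atTop 1)).exists
    exact ⟨k, h3, h2.le⟩
  obtain ⟨F, hF⟩ := hk k hk1
  set s := K * Real.exp (-(k * γ)) with hs
  have hsp : 0 < s := by positivity
  have hs1 : s * (2 + 2 * D / δ) ≤ 1 / 2 := by
    have := hks.trans (min_le_left _ _)
    rw [le_div_iff₀ (by positivity)] at this
    linarith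
  have hs2 : 4 * s / δ ^ 2 ≤ c1 / 2 := by
    have := hks.trans (min_le_right _ _)
    rw [div_le_iff₀ (by positivity)]
    linarith
  refine ⟨k, hk1, min (c1 / 2) (1 / (2 * D ^ 2)), by positivity, 4 * |F| / δ ^ 2 + 1, by positivity, δ, hδ, fun q hq => ?_⟩
  obtain ⟨f, hf, hfar, hcl, hbd⟩ := hF q hq
  have hF0 : 0 ≤ |F| := abs_nonneg F
  have hbd' : ∀ x y, ρ y ≤ 0 → dist x y < 3 * δ → ‖f x‖ ≤ |F| := fun x y h1 h2 => (hbd x y h1 h2).trans (le_abs_self F)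
  set w : EE n → ℂ := fun z => gq ρ k q z - f z with hw
  have hwd : Differentiable ℂ w := (gq_diff ρ k q).sub hf
  set h : EE n → ℂ := fun z => 1 - (f z + w q + fderiv ℂ w q (z - q)) with hh
  have hgq : gq ρ k q q = 1 := by simp [gq, hl_zero]
  have hwb : ‖fderiv ℂ w q‖ ≤ 2 * s / δ := cauchy1 hwd hδ fun y hy => hcl y (by rw [mem_ball] at *; linarith)
  have hdh : ∀ z, fderiv ℂ h z = -(fderiv ℂ f z + fderiv ℂ w q) := by
    intro z
    have a0 : HasFDerivAt (fun z : EE n => z - q) (ContinuousLinearMap.id ℂ (EE n)) z := (hasFDerivAt_id z).sub_const q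
    have a1 := (((hf z).hasFDerivAt.add_const (w q)).add ((fderiv ℂ w q).hasFDerivAt.comp z a0)).const_sub 1
    refine a1.fderiv.trans ?_
    ext u; simp
  have hdw : fderiv ℂ w q = fderiv ℂ (gq ρ k q) q - fderiv ℂ f q :=
    ((gq_diff ρ k q q).hasFDerivAt.sub (hf q).hasFDerivAt).fderiv
  refine ⟨h, ?_, ?_, ?_, ?_, ?_⟩
  · exact (differentiable_const _).sub ((hf.add_const _).add ((fderiv ℂ w q).differentiable.comp (differentiable_id.sub_const q)))
  · simp [hh, hw, hgq]
  · intro t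
    rw [hdh, hdw]
    have a0 : HasFDerivAt (fun z : EE n => z - q) (ContinuousLinearMap.id ℂ (EE n)) q := (hasFDerivAt_id q).sub_const q
    have a1 : HasFDerivAt (hl ρ q) (fderiv ℂ (hl ρ q) 0) (q - q) := by
      rw [sub_self]; exact (hl_diff ρ q 0).hasFDerivAt
    have a2 := ((HasFDerivAt.comp (f := fun z : EE n => z - q) q a1 a0).const_mul (k : ℂ)).neg.cexp
    have a3 : fderiv ℂ (gq ρ k q) q = _ := a2.fderiv
    rw [a3]
    simp [hl_zero, hl_fderiv]
  · intro z hz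
    by_cases hzq : δ ≤ ‖z - q‖
    · have h1 := hfar z hz hzq
      have h2 := hcl q (mem_ball_self (by positivity))
      have h3 : ‖fderiv ℂ w q (z - q)‖ ≤ 2 * s / δ * D :=
        (ContinuousLinearMap.le_opNorm _ _).trans (mul_le_mul hwb (hdiam z q hz (hS0 q hq).le) (norm_nonneg _) (by positivity))
      have h4 : ‖f z + w q + fderiv ℂ w q (z - q)‖ ≤ 1 / 2 := by
        refine (norm_add₃_le).trans ?_
        have : s + s + 2 * s / δ * D = s * (2 + 2 * D / δ) := by field_simp; ring
        change ‖w q‖ ≤ _ at h2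
        linarith
      have h5 : 1 / 2 ≤ (h z).re := by
        have := (abs_le.1 ((abs_re_le_norm _).trans h4)).2
        simp only [hh, sub_re, one_re]
        linarith
      refine le_trans ?_ h5
      have h6 := hdiam z q hz (hS0 q hq).le
      calc _ ≤ 1 / (2 * D ^ 2) * D ^ 2 := by gcongr; exact min_le_right _ _
        _ = 1 / 2 := by field_simp
    · push Not at hzq
      have h1 := hnear q hq z (by rw [mem_ball, dist_eq_norm]; linarith) hz
      have h2 : ‖gq ρ k q z‖ ≤ Real.exp (-(c * ‖z - q‖ ^ 2)) := by
        rw [gq_norm]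
        apply Real.exp_le_exp.2
        have : 0 ≤ c * ‖z - q‖ ^ 2 := by positivity
        nlinarith
      have h3 := exp_lower (u := c * ‖z - q‖ ^ 2) (by positivity)
      have h4 : c1 * ‖z - q‖ ^ 2 ≤ c * ‖z - q‖ ^ 2 / (1 + c * ‖z - q‖ ^ 2) := by
        rw [hc1, div_mul_eq_mul_div]
        gcongr
      have h5 := taylor1 hwd (q := q) (δ := δ) (L := 4 * s / δ ^ 2) (fun z hz => cauchy2 hwd hδ hcl hz) (by positivity)
        (z := z) (by rw [mem_ball, dist_eq_norm]; linarith)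
      have h6 : h z = (1 - gq ρ k q z) + (w z - w q - fderiv ℂ w q (z - q)) := by
        simp only [hh, hw]; ring
      have h7 := (abs_le.1 ((abs_re_le_norm _).trans h5)).1
      have h8 := (abs_le.1 ((abs_re_le_norm _).trans h2)).2
      have h9 : 4 * s / δ ^ 2 * ‖z - q‖ ^ 2 ≤ c1 / 2 * ‖z - q‖ ^ 2 := by gcongr
      have h10 : min (c1 / 2) (1 / (2 * D ^ 2)) * ‖z - q‖ ^ 2 ≤ c1 / 2 * ‖z - q‖ ^ 2 := by gcongr; exact min_le_left _ _
      rw [h6, add_re, sub_re, one_re]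
      linarith
  · intro z hz
    have e : fderiv ℂ h z - fderiv ℂ h q = -(fderiv ℂ f z - fderiv ℂ f q) := by rw [hdh, hdh]; abel
    rw [e, norm_neg]
    by_cases hzq : z ∈ ball q δ
    · refine (cauchy2 hf hδ (F := |F|) (fun y hy => hbd' y q (hS0 q hq).le hy) hzq).trans ?_
      gcongr; linarith
    · have hz' := hz.resolve_right hzq
      rw [mem_ball, dist_eq_norm] at hzq
      push Not at hzq
      have h1 := cauchy1 hf hδ (x := z) (F := |F|) (fun y hy => hbd' y z hz' (by rw [mem_ball] at hy; linarith))
      have h2 := cauchy1 hf hδ (x := q) (F := |F|) (fun y hy => hbd' y q (hS0 q hq).le (by rw [mem_ball] at hy; linarith))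
      have h3 := norm_sub_le (fderiv ℂ f z) (fderiv ℂ f q)
      have h4 : 2 * |F| / δ + 2 * |F| / δ = 4 * |F| / δ ^ 2 * δ := by field_simp; ring
      have h5 : 4 * |F| / δ ^ 2 * δ ≤ (4 * |F| / δ ^ 2 + 1) * ‖z - q‖ := by gcongr; linarith
      linarith

end Peak3

end PartE6

section PartF1
open MeasureTheory Filter Topology
open scoped ContDiff ComplexConjugate ENNReal

section Solve
variable {n : ℕ}

set_option maxHeartbeats 2000000 in
lemma solve {C δ A B : ℝ} (hC : 0 < C) (hδ : 0 < δ) (hA : 0 < A) (hB : 0 < B) :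
    ∃ s0 > 0, ∃ ε1 > 0, s0 ≤ 1 ∧ ε1 ≤ 1 / 8 ∧ ∀ (ρ : EE n → ℝ) (k κ : ℝ) (q e : EE n) (h : EE n → ℂ), 0 < k → 1 ≤ κ → ‖e‖ = 1 →
      Differentiable ℂ h → h q = 0 → fderiv ℂ h q e = -κ → ‖fderiv ℂ h q‖ ≤ B →
      (∀ z ∈ ball q δ, ‖fderiv ℂ h z - fderiv ℂ h q‖ ≤ C * ‖z - q‖) →
      (∀ z ∈ ball q δ, k * ρ z + (h z).re ≤ C * ‖z - q‖ ^ 2) →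
      ∀ s : ℝ, 0 < s → s ≤ s0 → ‖s + h (q - (s : ℂ) • e)‖ ≤ (2 + B) * s ∧ ∀ (t : EE n) (η : ℂ), ‖t‖ ≤ ε1 * √s → ‖η‖ ≤ ε1 →
        ∃ ζ : ℂ, A * ‖ζ‖ + ‖η‖ ≤ 1 ∧ ρ (q - (s : ℂ) • e + t + ζ • e) < 0 ∧
          s + h (q - (s : ℂ) • e + t + ζ • e) = (s + h (q - (s : ℂ) • e)) * exp (A * ζ - η) := by
  obtain ⟨ε, hε, hε1, hεδ, hεC, hε3, hε4⟩ : ∃ ε : ℝ, 0 < ε ∧ ε ≤ 1 ∧ 4 * ε ≤ δ ∧ 36 * C * ε ≤ 1 / 4 ∧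
      ε * (3 * C + 6 * (2 + B) * A) ≤ 1 / 2 ∧ ε * (2 * (2 + B) * (A + 1)) ≤ 1 / 4 := by
    have key : ∀ a b : ℝ, 0 < a → 0 < b → ∀ ε ≤ b / a, ε * a ≤ b := fun a b ha hb ε h => by
      rwa [le_div_iff₀ ha] at h
    refine ⟨min 1 (min (δ / 4) (min (1 / 4 / (36 * C)) (min (1 / 2 / (3 * C + 6 * (2 + B) * A)) (1 / 4 / (2 * (2 + B) * (A + 1)))))), by positivity,
      min_le_left _ _, ?_, ?_, ?_, ?_⟩
    · have := (min_le_right 1 _).trans (min_le_left (δ / 4) (min (1 / 4 / (36 * C)) (min (1 / 2 / (3 * C + 6 * (2 + B) * A)) (1 / 4 / (2 * (2 + B) * (A + 1))))))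
      linarith
    · rw [mul_comm]
      exact key _ _ (by positivity) (by positivity) _ (((min_le_right _ _).trans (min_le_right _ _)).trans (min_le_left _ _))
    · exact key _ _ (by positivity) (by positivity) _ ((((min_le_right _ _).trans (min_le_right _ _)).trans (min_le_right _ _)).trans (min_le_left _ _))
    · exact key _ _ (by positivity) (by positivity) _ ((((min_le_right _ _).trans (min_le_right _ _)).trans (min_le_right _ _)).trans (min_le_right _ _))
  set ε1 := ε / (8 * (3 * B + 3 * C + 4)) with hε1d
  have hε10 : 0 < ε1 := by positivity
  have hε1e : ε1 * (3 * B + 3 * C + 4) = ε / 8 := by rw [hε1d]; field_simp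
  have hε18 : ε1 ≤ ε / 8 := by nlinarith
  refine ⟨ε ^ 2, by positivity, ε1, hε10, by nlinarith, by linarith, ?_⟩
  intro ρ k κ q e h hk hκ he hh hq hdq hBq hLip hρ s hs hs0
  set σ := √s with hσ
  have hσ0 : 0 < σ := Real.sqrt_pos.2 hs
  have hσs : σ ^ 2 = s := Real.sq_sqrt hs.le
  have hσε : σ ≤ ε := by rw [hσ, Real.sqrt_le_left hε.le]; exact hs0
  have hsε : s ≤ ε * σ := by nlinarith
  have hsε2 : s ≤ ε := by nlinarith
  have hsσ : s ≤ σ := by nlinarith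
  set p := q - (s : ℂ) • e with hp
  have hpq : ‖p - q‖ = s := by
    rw [hp, sub_sub_cancel_left, norm_neg, norm_smul, he, mul_one, norm_real, Real.norm_of_nonneg hs.le]
  have hεσ : ε * σ ≤ ε := by nlinarith
  have hεσ0 : 0 < ε * σ := by positivity
  have h1 : ‖h p - κ * s‖ ≤ 1 / 4 * s := by
    have := taylor1 hh hLip hC.le (z := p) (by rw [mem_ball, dist_eq_norm, hpq]; linarith)
    rw [hpq, hq, sub_zero] at this
    have e1 : fderiv ℂ h q (p - q) = κ * s := by
      rw [hp, sub_sub_cancel_left, map_neg, map_smul, hdq, smul_eq_mul]; ring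
    rw [e1] at this
    refine this.trans ?_
    have h5 : C * s ≤ C * ε := by gcongr
    have h6 : C * s ≤ 1 / 4 := by linarith [mul_pos hC hε]
    have := mul_le_mul_of_nonneg_right h6 hs.le
    linarith
  have hκB : κ ≤ B := by
    have := (fderiv ℂ h q).le_opNorm e
    rw [hdq, he, mul_one, norm_neg, norm_real, Real.norm_of_nonneg (by linarith)] at this
    linarith
  have h2 : ‖s + h p‖ ≤ (2 + B) * s := by
    have e1 : (s + h p : ℂ) = (h p - κ * s) + ((1 + κ) * s : ℝ) := by push_cast; ring
    rw [e1]
    refine (norm_add_le _ _).trans ?_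
    rw [norm_real, Real.norm_of_nonneg (by positivity)]
    have := mul_le_mul_of_nonneg_right hκB hs.le
    linarith
  have h3 : 3 / 4 * s ≤ (h p).re := by
    have := (abs_le.1 ((abs_re_le_norm _).trans h1)).1
    rw [sub_re, ← ofReal_mul, ofReal_re] at this
    have := mul_le_mul_of_nonneg_right hκ hs.le
    linarith
  refine ⟨h2, fun t η ht hη => ?_⟩
  have hL : ∀ x ∈ closedBall q (3 * (ε * σ)), ‖fderiv ℂ h x - fderiv ℂ h q‖ ≤ C * (3 * (ε * σ)) := by
    intro x hx
    rw [mem_closedBall] at hx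
    refine (hLip x (by rw [mem_ball]; linarith)).trans ?_
    rw [← dist_eq_norm]; gcongr
  have hbt : ‖t‖ ≤ ε * σ := ht.trans (by gcongr; linarith)
  have hm : ∀ ζ : ℂ, ‖ζ‖ ≤ ε * σ → ‖p + t + ζ • e - q‖ ≤ 3 * (ε * σ) := by
    intro ζ hζ
    have e1 : p + t + ζ • e - q = (p - q) + t + ζ • e := by abel
    rw [e1]
    refine norm_add₃_le.trans ?_
    rw [hpq, norm_smul, he]; linarith
  have hm0 : p + t ∈ closedBall q (3 * (ε * σ)) := by
    have := hm 0 (by simpa using hεσ0.le)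
    rw [zero_smul, add_zero] at this
    rwa [mem_closedBall, dist_eq_norm]
  set G : ℂ → ℂ := fun ζ => s + h (p + t + ζ • e) - (s + h p) * exp (A * ζ - η) with hG
  have hGd : Differentiable ℂ G := by
    have a1 : Differentiable ℂ (fun ζ : ℂ => p + t + ζ • e) := (differentiable_id.smul_const e).const_add _
    have a2 : Differentiable ℂ (fun ζ : ℂ => h (p + t + ζ • e)) := hh.comp a1
    have a3 : Differentiable ℂ (fun ζ : ℂ => exp (A * ζ - η)) := by fun_prop
    exact (a2.const_add _).sub (a3.const_mul _)
  have hη1 : ‖η‖ ≤ 1 := by linarith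
  have hexpη : ‖exp (-η)‖ ≤ 3 := by
    rw [norm_exp]
    have : (-η).re ≤ 1 := ((re_le_norm _).trans (by rw [norm_neg]; exact hη1))
    have := Real.exp_le_exp.2 this
    have := Real.exp_one_lt_d9
    linarith
  have hAζ : ∀ ζ : ℂ, ‖ζ‖ ≤ ε * σ → A * ‖ζ‖ + ‖η‖ ≤ ε * (A + 1) := by
    intro ζ hζ
    have : A * ‖ζ‖ ≤ A * ε := by gcongr; linarith
    linarith
  have hεA : ε * (A + 1) ≤ 1 / 16 := by nlinarith [mul_pos hε hA, mul_pos (mul_pos hε hA) hB, mul_pos hε hB]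
  have hgrow : ∀ ζ : ℂ, ‖ζ‖ ≤ ε * σ → ‖ζ‖ / 2 ≤ ‖G ζ - G 0‖ := by
    intro ζ hζ
    have e1 : ‖h (p + t + ζ • e) - h (p + t) - fderiv ℂ h q (ζ • e)‖ ≤ C * (3 * (ε * σ)) * ‖ζ‖ := by
      have := (convex_closedBall q (3 * (ε * σ))).norm_image_sub_le_of_norm_fderiv_le' (fun x _ => hh x) hL hm0
        (y := p + t + ζ • e) (by rw [mem_closedBall, dist_eq_norm]; exact hm ζ hζ)
      rwa [add_sub_cancel_left, norm_smul, he, mul_one] at this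
    have e2 : ‖exp (A * ζ) - 1‖ ≤ 2 * (A * ‖ζ‖) := by
      have := norm_exp_sub_one_le (x := A * ζ) (by
        rw [norm_mul, norm_real, Real.norm_of_nonneg hA.le]; linarith [hAζ ζ hζ, norm_nonneg η])
      rwa [norm_mul, norm_real, Real.norm_of_nonneg hA.le] at this
    have e3 : ‖(s + h p) * exp (-η) * (exp (A * ζ) - 1)‖ ≤ (2 + B) * s * 3 * (2 * (A * ‖ζ‖)) := by
      rw [norm_mul, norm_mul]; gcongr
    have e4 : G ζ - G 0 = -(κ * ζ) + (h (p + t + ζ • e) - h (p + t) - fderiv ℂ h q (ζ • e)) - (s + h p) * exp (-η) * (exp (A * ζ) - 1) := by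
      simp only [hG, map_smul, hdq, zero_smul, add_zero, mul_zero, zero_sub, smul_eq_mul]
      rw [sub_eq_add_neg ((A : ℂ) * ζ) η, exp_add]; ring
    have e5 : ‖(κ : ℂ) * ζ‖ ≤ ‖G ζ - G 0‖ + ‖h (p + t + ζ • e) - h (p + t) - fderiv ℂ h q (ζ • e)‖ + ‖(s + h p) * exp (-η) * (exp (A * ζ) - 1)‖ := by
      have : (κ : ℂ) * ζ = -(G ζ - G 0) + (h (p + t + ζ • e) - h (p + t) - fderiv ℂ h q (ζ • e)) + -((s + h p) * exp (-η) * (exp (A * ζ) - 1)) := by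
        rw [e4]; ring
      rw [this]
      refine norm_add₃_le.trans ?_
      rw [norm_neg, norm_neg]
    rw [norm_mul, norm_real, Real.norm_of_nonneg (by linarith)] at e5
    have e6 : ‖ζ‖ ≤ κ * ‖ζ‖ := le_mul_of_one_le_left (norm_nonneg _) hκ
    have e7 : C * (3 * (ε * σ)) * ‖ζ‖ ≤ C * (3 * ε) * ‖ζ‖ := by gcongr
    have e8 : (2 + B) * s * 3 * (2 * (A * ‖ζ‖)) ≤ (2 + B) * ε * 3 * (2 * (A * ‖ζ‖)) := by gcongr
    have e9 := mul_le_mul_of_nonneg_right hε3 (norm_nonneg ζ)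
    linarith
  have hG0 : ‖G 0‖ ≤ ε * σ / 8 := by
    have e1 : ‖h (p + t) - h p‖ ≤ (B + 3 * C) * ‖t‖ := by
      have := (convex_closedBall q (3 * (ε * σ))).norm_image_sub_le_of_norm_fderiv_le (𝕜 := ℂ) (fun x _ => hh x) (C := B + 3 * C) (fun x hx => by
        have a1 := hL x hx
        have a2 := norm_sub_norm_le (fderiv ℂ h x) (fderiv ℂ h q)
        have a3 : C * (3 * (ε * σ)) ≤ C * (3 * 1) := by gcongr; linarith
        linarith) (x := p) (y := p + t) (by rw [mem_closedBall, dist_eq_norm, hpq]; linarith) hm0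
      rwa [add_sub_cancel_left] at this
    have e2 : ‖exp (-η) - 1‖ ≤ 2 * ‖η‖ := by
      have := norm_exp_sub_one_le (x := -η) (by rwa [norm_neg])
      rwa [norm_neg] at this
    have e3 : G 0 = (h (p + t) - h p) - (s + h p) * (exp (-η) - 1) := by
      simp only [hG, zero_smul, add_zero, mul_zero, zero_sub]; ring
    have e4 : ‖(s + h p) * (exp (-η) - 1)‖ ≤ (2 + B) * σ * (2 * ε1) := by
      rw [norm_mul]
      calc _ ≤ (2 + B) * s * (2 * ‖η‖) := by gcongr
        _ ≤ _ := by gcongr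
    rw [e3]
    refine (norm_sub_le _ _).trans ?_
    have e5 : (B + 3 * C) * ‖t‖ ≤ (B + 3 * C) * (ε1 * σ) := by gcongr
    have e6 : (B + 3 * C) * (ε1 * σ) + (2 + B) * σ * (2 * ε1) = ε1 * (3 * B + 3 * C + 4) * σ := by ring
    rw [hε1e] at e6
    linarith
  have hfreq : ∃ᶠ z in 𝓝 (0 : ℂ), G z ≠ G 0 := by
    have a1 : ∀ᶠ z in 𝓝[≠] (0 : ℂ), G z ≠ G 0 := by
      filter_upwards [self_mem_nhdsWithin, nhdsWithin_le_nhds (closedBall_mem_nhds (0 : ℂ) hεσ0)] with z hz hz2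
      intro hz3
      have := hgrow z (by simpa using hz2)
      rw [hz3, sub_self, norm_zero] at this
      have := norm_pos_iff.2 hz
      linarith
    exact a1.frequently.filter_mono nhdsWithin_le_nhds
  have himg := hGd.diffContOnCl.ball_subset_image_closedBall (z₀ := 0) (r := ε * σ) (ε := ε * σ / 2) hεσ0
    (fun z hz => by
      rw [mem_sphere_zero_iff_norm] at hz
      have := hgrow z hz.le
      rwa [hz] at this) hfreq
  obtain ⟨ζ, hζ, hζ0⟩ := himg (show (0 : ℂ) ∈ _ by
    rw [mem_ball, dist_eq_norm, zero_sub, norm_neg]; linarith)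
  rw [mem_closedBall_zero_iff] at hζ
  have hAz := hAζ ζ hζ
  have heq : s + h (p + t + ζ • e) = (s + h p) * exp (A * ζ - η) := sub_eq_zero.1 hζ0
  refine ⟨ζ, by linarith, ?_, heq⟩
  have f1 : ‖exp (A * ζ - η) - 1‖ ≤ 2 * (ε * (A + 1)) := by
    have a1 : ‖A * ζ - η‖ ≤ ε * (A + 1) := by
      refine (norm_sub_le _ _).trans ?_
      rwa [norm_mul, norm_real, Real.norm_of_nonneg hA.le]
    have := norm_exp_sub_one_le (x := A * ζ - η) (by linarith)
    linarith
  have f2 : ‖h (p + t + ζ • e) - h p‖ ≤ 1 / 4 * s := by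
    have a1 : h (p + t + ζ • e) - h p = (s + h p) * (exp (A * ζ - η) - 1) := by
      linear_combination heq
    rw [a1, norm_mul]
    calc _ ≤ (2 + B) * s * (2 * (ε * (A + 1))) := by gcongr
      _ = ε * (2 * (2 + B) * (A + 1)) * s := by ring
      _ ≤ _ := by gcongr
  have f3 := (abs_le.1 ((abs_re_le_norm _).trans f2)).1
  rw [sub_re] at f3
  have f4 := hm ζ hζ
  have f5 := hρ (p + t + ζ • e) (by rw [mem_ball, dist_eq_norm]; linarith)
  have f6 : C * ‖p + t + ζ • e - q‖ ^ 2 ≤ 1 / 4 * s := by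
    calc _ ≤ C * (3 * (ε * σ)) ^ 2 := by gcongr
      _ = 9 * C * ε * ε * s := by rw [← hσs]; ring
      _ ≤ 1 / 4 * s := by
        gcongr
        nlinarith [mul_pos hC hε]
  have f7 : k * ρ (p + t + ζ • e) < 0 := by linarith
  by_contra hcon
  push Not at hcon
  have := mul_nonneg hk.le hcon
  linarith

end Solve

end PartF1

section PartF2
open MeasureTheory Filter Topology
open scoped ContDiff ComplexConjugate ENNReal

section Full
variable {n : ℕ}

lemma rho_taylor {ρ : EE n → ℝ} (hρ : ContDiff ℝ ∞ ρ) {S : Set (EE n)} (hS : IsCompact S) :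
    ∃ C > 0, ∃ B > 0, ∀ q ∈ S, ‖fderiv ℝ ρ q‖ ≤ B ∧
      ∀ z ∈ ball q 1, |ρ z - ρ q - fderiv ℝ ρ q (z - q)| ≤ C * ‖z - q‖ ^ 2 := by
  have hd : ContDiff ℝ ∞ (fderiv ℝ ρ) := hρ.fderiv_right (by simp)
  have hd2 : ContDiff ℝ ∞ (fderiv ℝ (fderiv ℝ ρ)) := hd.fderiv_right (by simp)
  obtain ⟨B, hB⟩ := (hS.image hd.continuous).isBounded.exists_norm_le
  obtain ⟨C, hC⟩ := ((hS.cthickening (r := 1)).image hd2.continuous).isBounded.exists_norm_le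
  refine ⟨|C| + 1, by positivity, |B| + 1, by positivity, fun q hq => ⟨?_, fun z hz => ?_⟩⟩
  · have := hB _ ⟨q, hq, rfl⟩
    linarith [le_abs_self B]
  have h1 : ∀ x ∈ ball q 1, ‖fderiv ℝ ρ x - fderiv ℝ ρ q‖ ≤ (|C| + 1) * ‖x - q‖ := by
    intro x hx
    refine (convex_ball q 1).norm_image_sub_le_of_norm_fderiv_le (𝕜 := ℝ) (fun x _ => hd.differentiable (by simp) x)
      (fun y hy => ?_) (mem_ball_self one_pos) hx
    have := hC _ ⟨y, mem_cthickening_of_dist_le y q 1 S hq (mem_ball.1 hy).le, rfl⟩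
    linarith [le_abs_self C]
  have hz' : ‖z - q‖ < 1 := by rwa [mem_ball, dist_eq_norm] at hz
  have := (convex_closedBall q ‖z - q‖).norm_image_sub_le_of_norm_fderiv_le' (𝕜 := ℝ) (f := ρ) (φ := fderiv ℝ ρ q)
    (C := (|C| + 1) * ‖z - q‖) (fun x _ => hρ.differentiable (by simp) x) (fun x hx => by
      rw [mem_closedBall, dist_eq_norm] at hx
      refine (h1 x (by rw [mem_ball, dist_eq_norm]; linarith)).trans ?_
      gcongr) (x := q) (y := z) (mem_closedBall_self (norm_nonneg _)) (by rw [mem_closedBall, dist_eq_norm])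
  rw [Real.norm_eq_abs] at this
  calc _ ≤ _ := this
    _ = _ := by ring

set_option maxHeartbeats 1000000 in
lemma peak_full {ρ : EE n → ℝ} (hρ : ContDiff ℝ ∞ ρ) (hL : ∀ x t, 0 ≤ Lv ρ x t)
    (hT : IsCompact {x | ρ x ≤ 0}) {S : Set (EE n)} (hS : IsCompact S) (hS0 : ∀ q ∈ S, ρ q = 0)
    (hpos : ∀ q ∈ S, ∀ t, t ≠ 0 → 0 < Lv ρ q t) :
    ∃ k : ℝ, 1 ≤ k ∧ ∃ c > 0, ∃ C > 0, ∃ δ > 0, ∃ B > 0, ∀ q ∈ S, ∃ h : EE n → ℂ, Differentiable ℂ h ∧ h q = 0 ∧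
      (∀ t, fderiv ℂ h q t = -(k * lpo ρ q t)) ∧ ‖fderiv ℂ h q‖ ≤ B ∧ (∀ z, ρ z ≤ 0 → c * ‖z - q‖ ^ 2 ≤ (h z).re) ∧
      (∀ z, ρ z ≤ 0 → ‖fderiv ℂ h z - fderiv ℂ h q‖ ≤ C * ‖z - q‖) ∧
      (∀ z ∈ ball q δ, ‖fderiv ℂ h z - fderiv ℂ h q‖ ≤ C * ‖z - q‖) ∧
      (∀ z ∈ ball q δ, k * ρ z + (h z).re ≤ C * ‖z - q‖ ^ 2) := by
  obtain ⟨k, hk, c, hc, C, hC, δ, hδ, H⟩ := peak hρ hL hT hS hS0 hpos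
  obtain ⟨C', hC', B, hB, HT⟩ := rho_taylor hρ hS
  refine ⟨k, hk, c, hc, C + k * C', by positivity, min δ 1, by positivity, k * (2 * B), by positivity, fun q hq => ?_⟩
  obtain ⟨h, h1, h2, h3, h4, h5⟩ := H q hq
  obtain ⟨t1, t2⟩ := HT q hq
  have hkC : 0 ≤ k * C' := by positivity
  refine ⟨h, h1, h2, h3, ?_, h4, fun z hz => ?_, fun z hz => ?_, fun z hz => ?_⟩
  · refine ContinuousLinearMap.opNorm_le_bound _ (by positivity) fun t => ?_
    rw [h3, norm_neg, norm_mul, norm_real, Real.norm_of_nonneg (by linarith), mul_assoc]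
    gcongr
    have e1 : ∀ t, |(lpo ρ q t).re| ≤ B * ‖t‖ := fun t => by
      rw [lpo_re]; exact ((fderiv ℝ ρ q).le_opNorm t).trans (by gcongr)
    have e2 : (lpo ρ q t).im = (lpo ρ q ((-I) • t)).re := by rw [lpo_smul]; simp
    have e3 := e1 ((-I) • t)
    rw [norm_smul, norm_neg, norm_I, one_mul, ← e2] at e3
    have := norm_le_abs_re_add_abs_im (lpo ρ q t)
    linarith [e1 t]
  · refine (h5 z (Or.inl hz)).trans ?_
    gcongr; linarith
  · refine (h5 z (Or.inr (ball_subset_ball (min_le_left _ _) hz))).trans ?_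
    gcongr; linarith
  · have a1 := taylor1 h1 (fun z hz => h5 z (Or.inr hz)) hC.le (z := z) (ball_subset_ball (min_le_left _ _) hz)
    have a2 := t2 z (ball_subset_ball (min_le_right _ _) hz)
    rw [h2, sub_zero, h3, sub_neg_eq_add] at a1
    have a3 := (abs_le.1 ((abs_re_le_norm _).trans a1)).2
    rw [add_re, re_ofReal_mul, lpo_re] at a3
    have a4 := (abs_le.1 a2).2
    rw [hS0 q hq, sub_zero] at a4
    have a5 := mul_le_mul_of_nonneg_left a4 (by linarith : 0 ≤ k)
    linarith [mul_assoc k C' (‖z - q‖ ^ 2), mul_sub k (ρ z) (fderiv ℝ ρ q (z - q)), add_mul C (k * C') (‖z - q‖ ^ 2)]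

end Full

end PartF2

section PartF3
open MeasureTheory Filter Topology
open scoped ContDiff ComplexConjugate ENNReal

section Fib
variable {N : ℕ}

/-- last unit vector -/
def en : CSp N := mkPt 0 1

lemma mk_norm_sq (a : Fin N → ℂ) (b : ℂ) : ‖mkPt a b‖ ^ 2 = ‖mkPt a 0‖ ^ 2 + ‖b‖ ^ 2 := by
  rw [EuclideanSpace.norm_sq_eq, EuclideanSpace.norm_sq_eq, Fin.sum_univ_castSucc, Fin.sum_univ_castSucc]
  simp [mkPt]

lemma en_norm : ‖(en : CSp N)‖ = 1 := by
  have := mk_norm_sq (N := N) 0 1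
  have h0 : mkPt (0 : Fin N → ℂ) 0 = 0 := pt_ext (by rw [initC_mk]; rfl) (by rw [lastC_mk]; rfl)
  rw [h0] at this
  simp at this
  refine this.resolve_right fun h => ?_
  have := norm_nonneg (mkPt (0 : Fin N → ℂ) 1)
  linarith

lemma en_last : lastC (en : CSp N) = 1 := lastC_mk _ _
lemma en_init : initC (en : CSp N) = 0 := initC_mk _ _
lemma last_add (z w : CSp N) : lastC (z + w) = lastC z + lastC w := rfl
lemma init_add (z w : CSp N) : initC (z + w) = initC z + initC w := rfl
lemma last_smul (c : ℂ) (z : CSp N) : lastC (c • z) = c * lastC z := rfl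
lemma init_smul (c : ℂ) (z : CSp N) : initC (c • z) = c • initC z := rfl

/-- the logarithmic coordinate -/
def Yf (A s : ℝ) (h : CSp N → ℂ) (z : CSp N) : ℂ := A * lastC z - log (s + h z)

lemma quad_pos {A c C x : ℝ} (hc : 0 < c) (hA : A = C ^ 2 / (4 * c) + 1) : 0 < A + c * x ^ 2 - C * x := by
  have : A + c * x ^ 2 - C * x = 1 + c * (x - C / (2 * c)) ^ 2 := by
    rw [hA]; field_simp; ring
  rw [this]; positivity

lemma fib_inj {P : (Fin N → ℂ) → ℝ} {A s c C κ : ℝ} {h : CSp N → ℂ} {q : CSp N} (hs : 0 < s) (hc : 0 < c) (hκ : 1 ≤ κ)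
    (hA : A = C ^ 2 / (4 * c) + 1) (hh : Differentiable ℂ h) (hdq : fderiv ℂ h q en = -κ)
    (hre : ∀ z ∈ DP P, c * ‖z - q‖ ^ 2 ≤ (h z).re)
    (hL : ∀ z ∈ DP P, ‖fderiv ℂ h z - fderiv ℂ h q‖ ≤ C * ‖z - q‖) {z w : CSp N} (hz : z ∈ DP P) (hw : w ∈ DP P)
    (hzw : initC z = initC w) (hY : Yf A s h z = Yf A s h w) : z = w := by
  by_contra hne
  set ζ := lastC w - lastC z with hζ
  have hζ0 : ζ ≠ 0 := fun h0 => hne (pt_ext hzw (sub_eq_zero.1 h0).symm)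
  have hwz : w = z + ((1 : ℝ) : ℂ) • ζ • en := by
    apply pt_ext
    · rw [init_add, init_smul, init_smul, en_init]; simp [hzw]
    · rw [last_add, last_smul, last_smul, en_last, hζ]; simp
  have hmem : ∀ τ ∈ Icc (0 : ℝ) 1, z + (τ : ℂ) • ζ • en ∈ DP P := by
    intro τ hτ
    have e1 : initC (z + (τ : ℂ) • ζ • en) = initC z := by
      rw [init_add, init_smul, init_smul, en_init]; simp
    have e2 : lastC (z + (τ : ℂ) • ζ • en) = (1 - τ : ℝ) • lastC z + τ • lastC w := by
      rw [last_add, last_smul, last_smul, en_last, hζ]; simp only [real_smul]; push_cast; ring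
    simp only [DP, mem_setOf_eq] at hz hw ⊢
    rw [e1, e2]
    rw [← hzw] at hw
    have hcv := (convex_ball (0 : ℂ) (√(1 - P (initC z))))
    have key : ∀ u : ℂ, ‖u‖ ^ 2 + P (initC z) < 1 ↔ u ∈ ball (0 : ℂ) (√(1 - P (initC z))) := by
      intro u
      rw [mem_ball_zero_iff, Real.lt_sqrt (norm_nonneg u)]
      constructor <;> intro h <;> linarith
    rw [key] at hz hw ⊢
    exact hcv hz hw (by linarith [hτ.2]) hτ.1 (by ring)
  have hpos : ∀ x ∈ DP P, 0 < (s + h x).re := by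
    intro x hx
    rw [add_re, ofReal_re]
    have := hre x hx
    have : 0 ≤ c * ‖x - q‖ ^ 2 := by positivity
    linarith
  have hder : ∀ τ ∈ Icc (0 : ℝ) 1, HasDerivAt (fun τ : ℝ => (Yf A s h (z + (τ : ℂ) • ζ • en) / ζ).re)
      ((A - fderiv ℂ h (z + (τ : ℂ) • ζ • en) en / (s + h (z + (τ : ℂ) • ζ • en))).re) τ := by
    intro τ hτ
    have hx := hpos _ (hmem τ hτ)
    have b : HasDerivAt (fun u : ℂ => z + u • ζ • en) ((1 : ℂ) • ζ • en) (τ : ℂ) := ((hasDerivAt_id (τ : ℂ)).smul_const (ζ • (en : CSp N))).const_add z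
    have a1 := (hh (z + (τ : ℂ) • ζ • en)).hasFDerivAt.comp_hasDerivAt (τ : ℂ) b
    have a2 := (lastL.hasFDerivAt (x := z + (τ : ℂ) • ζ • en)).comp_hasDerivAt (τ : ℂ) b
    have a3 := (a1.const_add (s : ℂ)).clog (Or.inl hx)
    have a4 := ((a2.const_mul (A : ℂ)).sub a3).div_const ζ
    refine (HasDerivAt.real_of_complex a4).congr_deriv ?_
    congr 1
    simp only [Function.comp_apply, map_smul, one_smul, smul_eq_mul, lastL_apply, en_last]
    have : (s + h (z + (τ : ℂ) • ζ • en)) ≠ 0 := fun h0 => by rw [h0] at hx; simp at hx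
    field_simp
  obtain ⟨τ, hτ, hτ0⟩ := exists_hasDerivAt_eq_zero (zero_lt_one' ℝ) (fun τ hτ => (hder τ hτ).continuousAt.continuousWithinAt)
    (by
      have e0 : z + ((0 : ℝ) : ℂ) • ζ • (en : CSp N) = z := by simp
      rw [e0, ← hwz, hY]) (fun τ hτ => hder τ (Ioo_subset_Icc_self hτ))
  have hx := hmem τ (Ioo_subset_Icc_self hτ)
  set x := z + (τ : ℂ) • ζ • (en : CSp N) with hxd
  have hHx := hpos x hx
  set H := (s : ℂ) + h x with hH
  have hH0 : H ≠ 0 := fun h0 => by rw [h0] at hHx; simp at hHx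
  have hHn : 0 < ‖H‖ := norm_pos_iff.2 hH0
  set E := fderiv ℂ h x en - fderiv ℂ h q en with hE
  have hEb : ‖E‖ ≤ C * ‖x - q‖ := by
    have := (fderiv ℂ h x - fderiv ℂ h q).le_opNorm en
    rw [en_norm, mul_one] at this
    exact this.trans (hL x hx)
  have e1 : (A - fderiv ℂ h x en / H : ℂ) = A + κ * H⁻¹ - E / H := by
    rw [hE, hdq]; field_simp; ring
  rw [e1, sub_re, add_re, ofReal_re, re_ofReal_mul] at hτ0
  have e2 : (E / H).re ≤ C * (‖x - q‖ / ‖H‖) := by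
    refine (re_le_norm _).trans ?_
    rw [norm_div, ← mul_div_assoc]
    gcongr
  have e3 : c * (‖x - q‖ / ‖H‖) ^ 2 ≤ (H⁻¹).re := by
    rw [inv_re, normSq_eq_norm_sq, div_pow, ← mul_div_assoc]
    gcongr
    have := hre x hx
    rw [hH, add_re, ofReal_re]; linarith
  have e4 : (H⁻¹).re ≤ κ * (H⁻¹).re := le_mul_of_one_le_left (le_trans (by positivity) e3) hκ
  have e5 := quad_pos (x := ‖x - q‖ / ‖H‖) hc hA
  linarith

end Fib

end PartF3

section PartF4
open MeasureTheory Filter Topology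
open scoped ContDiff ComplexConjugate ENNReal

section Emb
variable {N : ℕ}

lemma mk_smul0 (c : ℂ) (a : Fin N → ℂ) : mkPt (c • a) 0 = c • mkPt a 0 :=
  pt_ext (by rw [initC_mk, init_smul, initC_mk]) (by rw [lastC_mk, last_smul, lastC_mk, mul_zero])

lemma mk_init_le (z : CSp N) : ‖mkPt (initC z) 0‖ ≤ ‖z‖ := by
  have := mk_norm_sq (initC z) (lastC z)
  rw [mk_eta] at this
  exact abs_le_of_sq_le_sq' (by nlinarith [sq_nonneg ‖lastC z‖]) (norm_nonneg _) |>.2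

lemma last_le (z : CSp N) : ‖lastC z‖ ≤ ‖z‖ := by
  have := mk_norm_sq (initC z) (lastC z)
  rw [mk_eta] at this
  exact abs_le_of_sq_le_sq' (by nlinarith [sq_nonneg ‖mkPt (initC z) 0‖]) (norm_nonneg _) |>.2

lemma mk_norm_le (a : Fin N → ℂ) (b : ℂ) : ‖mkPt a b‖ ≤ ‖mkPt a 0‖ + ‖b‖ := by
  have := mk_norm_sq a b
  exact abs_le_of_sq_le_sq' (by nlinarith [mul_nonneg (norm_nonneg (mkPt a 0)) (norm_nonneg b)]) (by positivity) |>.2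

lemma mk_diffOn {Ω : Set (CSp N)} {a : CSp N → Fin N → ℂ} {b : CSp N → ℂ} (ha : DifferentiableOn ℂ a Ω)
    (hb : DifferentiableOn ℂ b Ω) : DifferentiableOn ℂ (fun z => mkPt (a z) (b z)) Ω := by
  rw [differentiableOn_euclidean]
  intro i
  refine Fin.lastCases ?_ (fun j => ?_) i
  · simpa [mkPt] using hb
  · simpa [mkPt] using differentiableOn_pi.1 ha j

lemma Y_exp {A s : ℝ} {h : CSp N → ℂ} {z : CSp N} (hz : (s + h z) ≠ 0) : exp (Yf A s h z) = exp (A * lastC z) / (s + h z) := by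
  rw [Yf, exp_sub, exp_log hz]

lemma Y_re {A s : ℝ} {h : CSp N → ℂ} {z : CSp N} : (Yf A s h z).re = A * (lastC z).re - Real.log ‖s + h z‖ := by
  rw [Yf, sub_re, re_ofReal_mul, log_re]

lemma Y_im {A s : ℝ} (hA : 0 < A) {h : CSp N → ℂ} {z : CSp N} (hz : 0 < (s + h z).re) (h1 : ‖lastC z‖ ≤ 1) :
    |(Yf A s h z).im| ≤ A + 2 := by
  rw [Yf, sub_im, im_ofReal_mul, log_im]
  have e1 := abs_arg_lt_pi_div_two_iff.2 (Or.inl hz)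
  have e2 : |A * (lastC z).im| ≤ A := by
    rw [abs_mul, abs_of_pos hA]
    exact mul_le_of_le_one_right hA.le ((abs_im_le_norm _).trans h1)
  have e3 := Real.pi_lt_four
  have e4 := abs_sub (A * (lastC z).im) (arg (s + h z))
  linarith

/-- the embedding before normalization -/
def F0 (A s M : ℝ) (q : CSp N) (h : CSp N → ℂ) (z : CSp N) : CSp N :=
  mkPt (exp (Yf A s h z / 2) • (initC z - initC q)) (exp ((Yf A s h z + Real.log s) / M))

lemma F0_diff {A s M : ℝ} {q : CSp N} {h : CSp N → ℂ} {Ω : Set (CSp N)} (hh : Differentiable ℂ h)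
    (hpos : ∀ z ∈ Ω, 0 < (s + h z).re) : DifferentiableOn ℂ (F0 A s M q h) Ω := by
  have hY : DifferentiableOn ℂ (Yf A s h) Ω := by
    refine DifferentiableOn.sub ?_ ?_
    · exact (lastL.differentiable.const_mul _).differentiableOn
    · exact (hh.const_add _).differentiableOn.clog fun z hz => Or.inl (hpos z hz)
  have hY2 : DifferentiableOn ℂ (fun z => Yf A s h z / 2) Ω := by
    simp only [div_eq_mul_inv]; exact hY.mul_const _
  have hY3 : DifferentiableOn ℂ (fun z => (Yf A s h z + Real.log s) / M) Ω := by
    simp only [div_eq_mul_inv]; exact (hY.add_const _).mul_const _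
  refine mk_diffOn ?_ ?_
  · exact hY2.cexp.smul (initL.differentiable.sub_const _).differentiableOn
  · exact hY3.cexp

lemma F0_bdd {A s M c : ℝ} {q : CSp N} {h : CSp N → ℂ} (hA : 0 < A) (hs : 0 < s) (hM : 1 ≤ M) (hc : 0 < c) {z : CSp N}
    (hre : c * ‖z - q‖ ^ 2 ≤ (h z).re) (h1 : ‖lastC z‖ ≤ 1) :
    ‖F0 A s M q h z‖ ≤ (1 + Real.exp A / c) + Real.exp A := by
  have hH : s + c * ‖z - q‖ ^ 2 ≤ ‖s + h z‖ := by
    refine le_trans ?_ (re_le_norm _)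
    rw [add_re, ofReal_re]; linarith
  have hq0 : 0 ≤ c * ‖z - q‖ ^ 2 := by positivity
  have hHp : 0 < ‖s + h z‖ := by linarith
  have hre1 : (lastC z).re ≤ 1 := (re_le_norm _).trans h1
  have hArz : A * (lastC z).re ≤ A := mul_le_of_le_one_right hA.le hre1
  refine (mk_norm_le _ _).trans (add_le_add ?_ ?_)
  · have e0 : initC z - initC q = initC (z - q) := rfl
    rw [mk_smul0, norm_smul, e0]
    have e1 : ‖exp (Yf A s h z / 2)‖ ^ 2 * (c * ‖z - q‖ ^ 2) ≤ Real.exp A := by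
      rw [← norm_pow, ← exp_nat_mul]
      have : ((2 : ℕ) : ℂ) * (Yf A s h z / 2) = Yf A s h z := by push_cast; ring
      rw [this, Y_exp (norm_pos_iff.1 hHp), norm_div, norm_exp, re_ofReal_mul, div_mul_eq_mul_div, div_le_iff₀ hHp]
      refine mul_le_mul (Real.exp_le_exp.2 hArz) (by linarith) hq0 (Real.exp_pos _).le
    set x := ‖exp (Yf A s h z / 2)‖ * ‖mkPt (initC (z - q)) 0‖ with hx
    have e2 : x ≤ ‖exp (Yf A s h z / 2)‖ * ‖z - q‖ := by
      rw [hx]; gcongr; exact mk_init_le _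
    set y := ‖exp (Yf A s h z / 2)‖ * ‖z - q‖ with hy
    have e3 : y ^ 2 ≤ Real.exp A / c := by
      rw [le_div_iff₀ hc, hy]; linarith [e1]
    nlinarith [sq_nonneg (y - 1)]
  · rw [norm_exp]
    apply Real.exp_le_exp.2
    rw [div_ofReal_re, add_re, Y_re, ofReal_re, div_le_iff₀ (by linarith)]
    have : Real.log s ≤ Real.log ‖s + h z‖ := Real.log_le_log hs (by linarith)
    nlinarith

lemma F0_inj {P : (Fin N → ℂ) → ℝ} {A s c C κ : ℝ} {h : CSp N → ℂ} {q : CSp N} (hs : 0 < s) (hc : 0 < c) (hκ : 1 ≤ κ)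
    (hA : A = C ^ 2 / (4 * c) + 1) (hh : Differentiable ℂ h) (hdq : fderiv ℂ h q en = -κ)
    (hre : ∀ z ∈ DP P, c * ‖z - q‖ ^ 2 ≤ (h z).re)
    (hL : ∀ z ∈ DP P, ‖fderiv ℂ h z - fderiv ℂ h q‖ ≤ C * ‖z - q‖) (h1 : ∀ z ∈ DP P, ‖lastC z‖ ≤ 1) :
    InjOn (F0 A s (A + 2) q h) (DP P) := by
  have hA0 : 0 < A := by rw [hA]; positivity
  have hpos : ∀ x ∈ DP P, 0 < (s + h x).re := by
    intro x hx
    rw [add_re, ofReal_re]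
    have := hre x hx
    have : 0 ≤ c * ‖x - q‖ ^ 2 := by positivity
    linarith
  intro z hz w hw hzw
  have e1 := congrArg lastC hzw
  have e2 := congrArg initC hzw
  rw [F0, F0, lastC_mk, lastC_mk] at e1
  rw [F0, F0, initC_mk, initC_mk] at e2
  have him : ∀ z ∈ DP P, |((Yf A s h z + Real.log s) / (A + 2 : ℝ)).im| ≤ 1 := by
    intro z hz
    rw [div_ofReal_im, add_im, ofReal_im, add_zero, abs_div, abs_of_pos (show 0 < A + 2 by linarith)]
    exact (div_le_one (by linarith)).2 (Y_im hA0 (hpos z hz) (h1 z hz))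
  have hpi := Real.pi_gt_three
  have e3 := exp_inj_of_neg_pi_lt_of_le_pi (by linarith [(abs_le.1 (him z hz)).1]) (by linarith [(abs_le.1 (him z hz)).2])
    (by linarith [(abs_le.1 (him w hw)).1]) (by linarith [(abs_le.1 (him w hw)).2]) e1
  have hne : ((A + 2 : ℝ) : ℂ) ≠ 0 := by rw [ofReal_ne_zero]; linarith
  rw [div_left_inj' hne, add_left_inj] at e3
  rw [e3] at e2
  have e4 := smul_right_injective _ (exp_ne_zero (Yf A s h w / 2)) e2
  exact fib_inj hs hc hκ hA hh hdq hre hL hz hw (sub_left_inj.1 e4) e3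

end Emb

end PartF4

section PartF5
open MeasureTheory Filter Topology
open scoped ContDiff ComplexConjugate ENNReal

section Emb2
variable {N : ℕ}

set_option maxHeartbeats 2000000 in
lemma emb {c C δ B : ℝ} (hc : 0 < c) (hC : 0 < C) (hδ : 0 < δ) (hB : 0 < B) :
    ∃ s0 > 0, ∃ r0 > 0, ∀ (P : (Fin N → ℂ) → ℝ) (k κ x0 : ℝ) (q : CSp N) (h : CSp N → ℂ), (∀ z ∈ DP P, ‖lastC z‖ ≤ 1) →
      0 < k → 1 ≤ κ → lastC q = x0 → 1 / 2 ≤ x0 →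
      Differentiable ℂ h → h q = 0 → fderiv ℂ h q en = -κ → ‖fderiv ℂ h q‖ ≤ B →
      (∀ z ∈ DP P, c * ‖z - q‖ ^ 2 ≤ (h z).re) →
      (∀ z ∈ DP P, ‖fderiv ℂ h z - fderiv ℂ h q‖ ≤ C * ‖z - q‖) →
      (∀ z ∈ ball q δ, ‖fderiv ℂ h z - fderiv ℂ h q‖ ≤ C * ‖z - q‖) →
      (∀ z ∈ ball q δ, k * rh P z + (h z).re ≤ C * ‖z - q‖ ^ 2) →
      ∀ s : ℝ, 0 < s → s ≤ s0 → q - (s : ℂ) • en ∈ DP P →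
      ∃ f : CSp N → CSp N, DifferentiableOn ℂ f (DP P) ∧ InjOn f (DP P) ∧ f '' (DP P) ⊆ ball 0 1 ∧
        f (q - (s : ℂ) • en) = 0 ∧ ball 0 r0 ⊆ f '' (DP P) := by
  set A := C ^ 2 / (4 * c) + 1 with hA
  have hA0 : 0 < A := by positivity
  obtain ⟨s0, hs0, ε1, hε1, hs01, hε18, hsolve⟩ := solve (n := N + 1) hC hδ hA0 hB
  set M := A + 2 with hM
  set R1 := (1 + Real.exp A / c) + Real.exp A with hR1
  have hR10 : 0 < R1 := by positivity
  set r := ε1 / (4 * M * (2 + B)) with hr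
  have hM0 : 0 < M := by linarith
  have hr0 : 0 < r := by positivity
  refine ⟨min s0 (1 / 2), by positivity, r / (2 * R1 + 1), by positivity, ?_⟩
  intro P k κ x0 q h hlast hk hκ hx0 hx02 hh hq hdq hBq hre hL1 hL2 hρ s hs hss hp
  have hs1 := hss.trans (min_le_left _ _)
  have hs2 := hss.trans (min_le_right _ _)
  obtain ⟨hHp, hsol⟩ := hsolve (rh P) k κ q en h hk hκ en_norm hh hq hdq hBq hL2 hρ s hs hs1
  set p := q - (s : ℂ) • en with hpd
  have hpos : ∀ x ∈ DP P, s ≤ (s + h x).re := by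
    intro x hx
    rw [add_re, ofReal_re]
    have := hre x hx
    have : 0 ≤ c * ‖x - q‖ ^ 2 := by positivity
    linarith
  have hbd : ∀ z ∈ DP P, ‖F0 A s M q h z‖ ≤ R1 := fun z hz =>
    F0_bdd hA0 hs (by linarith) hc (hre z hz) (hlast z hz)
  set a : ℂ := ((2 * R1 + 1 : ℝ) : ℂ)⁻¹ with ha
  have ha0 : a ≠ 0 := by
    rw [ha]; apply inv_ne_zero; rw [ofReal_ne_zero]; positivity
  have han : ‖a‖ = (2 * R1 + 1)⁻¹ := by rw [ha, norm_inv, norm_real, Real.norm_of_nonneg (by positivity)]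
  refine ⟨fun z => a • (F0 A s M q h z - F0 A s M q h p), ?_, ?_, ?_, ?_, ?_⟩
  · exact ((F0_diff hh fun z hz => hs.trans_le (hpos z hz)).sub_const _).const_smul a
  · intro z hz w hw hzw
    have := smul_right_injective _ ha0 hzw
    exact F0_inj hs hc hκ hA hh hdq hre hL1 hlast hz hw (sub_left_inj.1 this)
  · rintro _ ⟨z, hz, rfl⟩
    rw [mem_ball_zero_iff, norm_smul, han, inv_mul_lt_iff₀ (by positivity)]
    have := norm_sub_le (F0 A s M q h z) (F0 A s M q h p)
    linarith [hbd z hz, hbd p hp]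
  · simp
  · intro y hy
    rw [mem_ball_zero_iff, lt_div_iff₀ (by positivity)] at hy
    set v := a⁻¹ • y with hv
    have hvn : ‖v‖ < r := by
      rw [hv, norm_smul, norm_inv, han, inv_inv]; linarith
    set b := initC v with hb
    set x := lastC v with hx
    set Yp := Yf A s h p with hYp
    set Xp := exp ((Yp + Real.log s) / M) with hXp
    have hHp0 : 0 < ‖s + h p‖ := hs.trans_le ((hpos p hp).trans (re_le_norm _))
    have hpre : 0 ≤ (lastC p).re := by
      have : lastC p = ((x0 - s : ℝ) : ℂ) := by
        rw [hpd, sub_eq_add_neg, last_add]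
        have : lastC (-((s : ℂ) • (en : CSp N))) = -(s * lastC (en : CSp N)) := rfl
        rw [this, en_last, hx0]; push_cast; ring
      rw [this, ofReal_re]; linarith
    have hXpn : 1 / (2 + B) ≤ ‖Xp‖ := by
      rw [hXp, norm_exp]
      have e1 : (1 / (2 + B) : ℝ) = Real.exp (-Real.log (2 + B)) := by
        rw [Real.exp_neg, Real.exp_log (by positivity), one_div]
      rw [e1]
      apply Real.exp_le_exp.2
      rw [div_ofReal_re, add_re, Y_re, ofReal_re, le_div_iff₀ hM0]
      have e2 : Real.log ‖s + h p‖ ≤ Real.log (2 + B) + Real.log s := by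
        rw [← Real.log_mul (by positivity) hs.ne']
        exact Real.log_le_log hHp0 hHp
      have e3 : 0 ≤ Real.log (2 + B) := Real.log_nonneg (by linarith)
      have e4 : 0 ≤ A * (lastC p).re := by positivity
      nlinarith
    have hXp0 : Xp ≠ 0 := exp_ne_zero _
    have hxX : ‖x / Xp‖ ≤ r * (2 + B) := by
      rw [norm_div, div_le_iff₀ (norm_pos_iff.2 hXp0)]
      have e1 : 1 ≤ (2 + B) * ‖Xp‖ := by
        rw [div_le_iff₀ (by positivity)] at hXpn; linarith
      have e2 := last_le v
      calc ‖x‖ ≤ r * 1 := by linarith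
        _ ≤ r * ((2 + B) * ‖Xp‖) := by gcongr
        _ = _ := by ring
    have hrM : r * (2 + B) * M = ε1 / 4 := by rw [hr]; field_simp
    have hrB : r * (2 + B) ≤ ε1 / 4 := by
      rw [← hrM]; exact le_mul_of_one_le_right (by positivity) (by linarith)
    set η := (M : ℂ) * log (1 + x / Xp) with hη
    have hηn : ‖η‖ ≤ ε1 := by
      rw [hη, norm_mul, norm_real, Real.norm_of_nonneg hM0.le]
      have e1 := norm_log_one_add_half_le_self (z := x / Xp) (by linarith)
      have e2 : M * ‖log (1 + x / Xp)‖ ≤ M * (3 / 2 * (r * (2 + B))) := by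
        gcongr; linarith
      linarith
    have h1x : 1 + x / Xp ≠ 0 := by
      intro h0
      have : x / Xp = -1 := by linear_combination h0
      rw [this, norm_neg, norm_one] at hxX
      linarith
    set E := exp (-(Yp + η) / 2) with hE
    set t := mkPt (E • b) 0 with ht
    have hEn : ‖E‖ ≤ 2 * (√(2 + B) * √s) := by
      have e1 : ‖exp (-Yp)‖ ≤ (2 + B) * s := by
        rw [exp_neg, hYp, Y_exp (norm_pos_iff.1 hHp0), inv_div, norm_div, norm_exp, re_ofReal_mul]
        have : 1 ≤ Real.exp (A * (lastC p).re) := Real.one_le_exp (by positivity)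
        exact (div_le_self (norm_nonneg _) this).trans hHp
      have e2 : ‖exp (-η)‖ ≤ 4 := by
        rw [norm_exp]
        have : (-η).re ≤ 1 := ((re_le_norm _).trans (by rw [norm_neg]; linarith))
        have := Real.exp_le_exp.2 this
        have := Real.exp_one_lt_d9
        linarith
      have e3 : ‖E‖ ^ 2 ≤ (2 * (√(2 + B) * √s)) ^ 2 := by
        rw [← norm_pow, hE, ← exp_nat_mul]
        have : ((2 : ℕ) : ℂ) * (-(Yp + η) / 2) = -Yp + -η := by push_cast; ring
        rw [this, exp_add, norm_mul, mul_pow, mul_pow, Real.sq_sqrt (by positivity), Real.sq_sqrt hs.le]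
        calc _ ≤ (2 + B) * s * 4 := by gcongr
          _ = _ := by ring
      exact abs_le_of_sq_le_sq' e3 (by positivity) |>.2
    have htn : ‖t‖ ≤ ε1 * √s := by
      rw [ht, mk_smul0, norm_smul]
      have e1 : ‖mkPt b 0‖ ≤ r := (mk_init_le v).trans hvn.le
      have e2 : √(2 + B) ≤ 2 + B := by
        rw [Real.sqrt_le_left (by positivity)]; nlinarith
      calc _ ≤ (2 * (√(2 + B) * √s)) * r := by gcongr
        _ ≤ (2 * ((2 + B) * √s)) * r := by gcongr
        _ = 2 * (r * (2 + B)) * √s := by ring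
        _ ≤ ε1 * √s := by gcongr; linarith
    obtain ⟨ζ, hζ1, hζ2, hζ3⟩ := hsol t η htn hηn
    set z := p + t + ζ • (en : CSp N) with hz
    have hzD : z ∈ DP P := mem_DP.2 hζ2
    have hYz : Yf A s h z = Yp + η := by
      have e1 : log (s + h z) = log (s + h p) + (A * ζ - η) := by
        have e2 : (s + h p) * exp (A * ζ - η) = exp (log (s + h p) + (A * ζ - η)) := by
          rw [exp_add, exp_log (norm_pos_iff.1 hHp0)]
        have e3 := abs_lt.1 (abs_arg_lt_pi_div_two_iff.2 (Or.inl (hs.trans_le (hpos p hp))))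
        have e4 : |(A * ζ - η).im| ≤ 1 := by
          refine (abs_im_le_norm _).trans ((norm_sub_le _ _).trans ?_)
          rwa [norm_mul, norm_real, Real.norm_of_nonneg hA0.le]
        have e5 := abs_le.1 e4
        have hpi := Real.pi_gt_three
        rw [hζ3, e2, log_exp]
        · rw [add_im, log_im]; linarith
        · rw [add_im, log_im]; linarith
      have e6 : lastC z = lastC p + ζ := by
        rw [hz, last_add, last_add, last_smul, en_last, ht, lastC_mk]; ring
      rw [Yf, e1, e6, hYp, Yf]; ring
    have hiz : initC z - initC q = E • b := by
      rw [hz, init_add, init_add, init_smul, en_init, ht, initC_mk, hpd, sub_eq_add_neg q, init_add]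
      have : initC (-((s : ℂ) • (en : CSp N))) = -((s : ℂ) • initC (en : CSp N)) := rfl
      rw [this, en_init]; simp
    have hF0p : F0 A s M q h p = mkPt 0 Xp := by
      have : initC p - initC q = 0 := by
        rw [hpd, sub_eq_add_neg q, init_add]
        have : initC (-((s : ℂ) • (en : CSp N))) = -((s : ℂ) • initC (en : CSp N)) := rfl
        rw [this, en_init]; simp
      rw [F0, this, smul_zero]
    have hF0z : F0 A s M q h z = mkPt b (Xp + x) := by
      rw [F0, hiz, hYz, smul_smul]
      congr 1
      · have : exp ((Yp + η) / 2) * E = 1 := by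
          rw [hE, ← exp_add]; ring_nf; exact exp_zero
        rw [this, one_smul]
      · have hMc : (M : ℂ) ≠ 0 := ofReal_ne_zero.2 hM0.ne'
        have : (Yp + η + Real.log s) / M = (Yp + Real.log s) / M + log (1 + x / Xp) := by
          rw [hη]; field_simp; ring
        rw [this, exp_add, exp_log h1x, ← hXp]
        field_simp
    refine ⟨z, hzD, ?_⟩
    show a • (F0 A s M q h z - F0 A s M q h p) = y
    have e7 : mkPt b (Xp + x) - mkPt 0 Xp = v := by
      apply pt_ext
      · show initC (mkPt b (Xp + x)) - initC (mkPt 0 Xp) = _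
        rw [initC_mk, initC_mk, sub_zero]
      · show lastC (mkPt b (Xp + x)) - lastC (mkPt 0 Xp) = _
        rw [lastC_mk, lastC_mk, add_sub_cancel_left]
    rw [hF0z, hF0p, e7, hv, smul_smul, mul_inv_cancel₀ ha0, one_smul]

end Emb2

end PartF5

section PartG1
open MeasureTheory Filter Topology
open scoped ContDiff ComplexConjugate ENNReal

section Auto
variable {N : ℕ}

/-- the exponent in the automorphism -/
def Wt (a u : ℂ) : ℂ := Real.log (1 - ‖a‖ ^ 2) - 2 * log (1 - conj a * u)

/-- automorphism of the ellipsoid -/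
def aut (m : Fin N → ℕ) (a : ℂ) (z : CSp N) : CSp N :=
  mkPt (dil m (Wt a (lastC z)) (initC z)) ((lastC z - a) / (1 - conj a * lastC z))

lemma one_sub_pos {a u : ℂ} (ha : ‖a‖ < 1) (hu : ‖u‖ < 1) : 0 < (1 - conj a * u).re := by
  rw [sub_re, one_re]
  have h1 := re_le_norm (conj a * u)
  rw [norm_mul, RCLike.norm_conj] at h1
  have : ‖a‖ * ‖u‖ < 1 := by nlinarith [norm_nonneg a, norm_nonneg u]
  linarith

lemma sq_id (a u : ℂ) : ‖1 - conj a * u‖ ^ 2 - ‖u - a‖ ^ 2 = (1 - ‖a‖ ^ 2) * (1 - ‖u‖ ^ 2) := by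
  simp only [← normSq_eq_norm_sq, normSq_apply]
  simp
  ring

lemma Wt_exp {a u : ℂ} (ha : ‖a‖ < 1) (hu : ‖u‖ < 1) : Real.exp (Wt a u).re = (1 - ‖a‖ ^ 2) / ‖1 - conj a * u‖ ^ 2 := by
  have h0 : 0 < 1 - ‖a‖ ^ 2 := by nlinarith [norm_nonneg a]
  have h1 : 0 < ‖1 - conj a * u‖ := (one_sub_pos ha hu).trans_le (re_le_norm _)
  have : (Wt a u).re = Real.log (1 - ‖a‖ ^ 2) - 2 * Real.log ‖1 - conj a * u‖ := by
    rw [Wt, sub_re, ofReal_re]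
    have : (2 : ℂ) = ((2 : ℝ) : ℂ) := by norm_num
    rw [this, re_ofReal_mul, log_re]
  rw [this, Real.exp_sub, Real.exp_log h0, two_mul, Real.exp_add, Real.exp_log h1, sq ‖1 - conj a * u‖]

lemma last_lt {P : (Fin N → ℂ) → ℝ} (hP0 : ∀ z, 0 ≤ P z) {z : CSp N} (hz : z ∈ DP P) : ‖lastC z‖ < 1 := by
  simp only [DP, mem_setOf_eq] at hz
  have := hP0 (initC z)
  by_contra h
  push Not at h
  nlinarith

lemma aut_maps {m : Fin N → ℕ} {P : (Fin N → ℂ) → ℝ} (hP : IsWHP m P) (hP0 : ∀ z, 0 ≤ P z) {a : ℂ} (ha : ‖a‖ < 1)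
    {z : CSp N} (hz : z ∈ DP P) : aut m a z ∈ DP P := by
  have hl := last_lt hP0 hz
  simp only [DP, mem_setOf_eq] at hz ⊢
  have h1 : 0 < ‖1 - conj a * lastC z‖ := (one_sub_pos ha hl).trans_le (re_le_norm _)
  have h0 : 0 < 1 - ‖a‖ ^ 2 := by nlinarith [norm_nonneg a]
  rw [aut, lastC_mk, initC_mk, whp_dil hP, Wt_exp ha hl, norm_div, div_pow, div_mul_eq_mul_div, ← add_div, div_lt_one (by positivity)]
  have := sq_id a (lastC z)
  nlinarith

lemma aut_inv {m : Fin N → ℕ} {P : (Fin N → ℂ) → ℝ} (hP0 : ∀ z, 0 ≤ P z) {a : ℂ} (ha : ‖a‖ < 1)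
    {z : CSp N} (hz : z ∈ DP P) : aut m (-a) (aut m a z) = z := by
  have hl := last_lt hP0 hz
  have hre := one_sub_pos ha hl
  have hne : 1 - conj a * lastC z ≠ 0 := fun h0 => by rw [h0] at hre; simp at hre
  have h0 : 0 < 1 - ‖a‖ ^ 2 := by nlinarith [norm_nonneg a]
  have hc : (((1 - ‖a‖ ^ 2 : ℝ)) : ℂ) = 1 - conj a * a := by
    rw [← normSq_eq_conj_mul_self, normSq_eq_norm_sq]; push_cast; rfl
  set u := lastC z with hu
  have e1 : 1 - conj (-a) * ((u - a) / (1 - conj a * u)) = ((1 - ‖a‖ ^ 2 : ℝ) : ℂ) * (1 - conj a * u)⁻¹ := by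
    rw [hc, map_neg]; field_simp; ring
  have hne2 : (1 - conj a * a : ℂ) ≠ 0 := by rw [← hc]; exact ofReal_ne_zero.2 h0.ne'
  apply pt_ext
  · rw [aut, initC_mk, aut, initC_mk, lastC_mk, ← hu]
    have e2 : Wt (-a) ((u - a) / (1 - conj a * u)) = -Wt a u := by
      rw [Wt, e1, log_ofReal_mul h0 (inv_ne_zero hne), log_inv _ (fun h => by
        have := abs_arg_lt_pi_div_two_iff.2 (Or.inl hre)
        rw [h, abs_of_pos Real.pi_pos] at this
        linarith [Real.pi_pos]), Wt, norm_neg]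
      ring
    rw [e2]
    ext j
    simp only [dil]
    rw [← mul_assoc, ← exp_add, neg_div, neg_add_cancel, exp_zero, one_mul]
  · rw [aut, lastC_mk, aut, lastC_mk, ← hu, e1, hc]
    have e3 : (u - a) / (1 - conj a * u) - -a = u * ((1 - conj a * a) * (1 - conj a * u)⁻¹) := by
      rw [div_eq_mul_inv]
      have e4 : (1 - conj a * u) * (1 - conj a * u)⁻¹ = 1 := mul_inv_cancel₀ hne
      linear_combination (-a) * e4
    rw [e3, mul_div_assoc, div_self (mul_ne_zero hne2 (inv_ne_zero hne)), mul_one]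

lemma aut_diff {m : Fin N → ℕ} {P : (Fin N → ℂ) → ℝ} (hP0 : ∀ z, 0 ≤ P z) {a : ℂ} (ha : ‖a‖ < 1) :
    DifferentiableOn ℂ (aut m a) (DP P) := by
  have hl : DifferentiableOn ℂ (lastC (N := N)) (DP P) := lastL.differentiable.differentiableOn
  have hd : DifferentiableOn ℂ (fun z : CSp N => 1 - conj a * lastC z) (DP P) := (hl.const_mul _).const_sub _
  have hpos : ∀ z ∈ DP P, 0 < (1 - conj a * lastC z).re := fun z hz => one_sub_pos ha (last_lt hP0 hz)
  refine mk_diffOn ?_ ?_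
  · refine differentiableOn_pi.2 fun j => ?_
    have h1 : DifferentiableOn ℂ (fun z : CSp N => Wt a (lastC z) * (2 * m j : ℂ)⁻¹) (DP P) :=
      (((hd.clog fun z hz => Or.inl (hpos z hz)).const_mul 2).const_sub _).mul_const _
    have h2 : DifferentiableOn ℂ (fun z : CSp N => initC z j) (DP P) :=
      (EuclideanSpace.proj (𝕜 := ℂ) j.castSucc).differentiable.differentiableOn
    simp only [dil, div_eq_mul_inv]
    exact h1.cexp.mul h2
  · simp only [div_eq_mul_inv]
    exact (hl.sub_const a).mul (hd.inv fun z hz h0 => by have := hpos z hz; rw [h0] at this; simp at this)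

/-- the domain admits a normalized embedding at `p` whose image contains a ball of radius `r` -/
def Gd (Ω : Set (CSp N)) (p : CSp N) (r : ℝ) : Prop :=
  ∃ f : CSp N → CSp N, DifferentiableOn ℂ f Ω ∧ InjOn f Ω ∧ f '' Ω ⊆ ball 0 1 ∧ f p = 0 ∧ ball 0 r ⊆ f '' Ω

lemma Gd_aut {m : Fin N → ℕ} {P : (Fin N → ℂ) → ℝ} (hP : IsWHP m P) (hP0 : ∀ z, 0 ≤ P z) {a : ℂ} (ha : ‖a‖ < 1)
    {p : CSp N} {r : ℝ} (h : Gd (DP P) (aut m a p) r) : Gd (DP P) p r := by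
  obtain ⟨f, h1, h2, h3, h4, h5⟩ := h
  have hmaps : MapsTo (aut m a) (DP P) (DP P) := fun z hz => aut_maps hP hP0 ha hz
  have ha' : ‖-a‖ < 1 := by rwa [norm_neg]
  refine ⟨f ∘ aut m a, h1.comp (aut_diff hP0 ha) hmaps, h2.comp ?_ hmaps, ?_, h4, ?_⟩
  · intro z hz w hw hzw
    rw [← aut_inv (m := m) hP0 ha hz, hzw, aut_inv hP0 ha hw]
  · rintro _ ⟨z, hz, rfl⟩
    exact h3 ⟨_, hmaps hz, rfl⟩
  · intro y hy
    obtain ⟨z, hz, rfl⟩ := h5 hy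
    refine ⟨aut m (-a) z, aut_maps hP hP0 ha' hz, ?_⟩
    have := aut_inv (m := m) hP0 ha' hz
    rw [neg_neg] at this
    rw [Function.comp_apply, this]

lemma Gd_red {m : Fin N → ℕ} {P : (Fin N → ℂ) → ℝ} (hP : IsWHP m P) (hP0 : ∀ z, 0 ≤ P z) {r : ℝ}
    (h : ∀ w : Fin N → ℂ, mkPt w (1 / 2 : ℂ) ∈ DP P → Gd (DP P) (mkPt w (1 / 2)) r) {p : CSp N} (hp : p ∈ DP P) :
    Gd (DP P) p r := by
  have ha := last_lt hP0 hp
  have hb : ‖(-(1 / 2) : ℂ)‖ < 1 := by rw [norm_neg]; norm_num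
  refine Gd_aut hP hP0 ha (Gd_aut hP hP0 hb ?_)
  have h1 := aut_maps hP hP0 hb (aut_maps hP hP0 ha hp)
  have h2 : aut m (-(1 / 2)) (aut m (lastC p) p) = mkPt (initC (aut m (-(1 / 2)) (aut m (lastC p) p))) (1 / 2) := by
    apply pt_ext
    · rw [initC_mk]
    · rw [lastC_mk, aut, lastC_mk, aut, lastC_mk]; simp
  rw [h2] at h1 ⊢
  exact h _ h1

end Auto

end PartG1

section PartG2
open MeasureTheory Filter Topology
open scoped ContDiff ComplexConjugate ENNReal

section Fin2
variable {N : ℕ}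

lemma Gd_mono {Ω : Set (CSp N)} {p : CSp N} {r r' : ℝ} (h : Gd Ω p r) (hr : r' ≤ r) : Gd Ω p r' := by
  obtain ⟨f, h1, h2, h3, h4, h5⟩ := h
  exact ⟨f, h1, h2, h3, h4, (ball_subset_ball hr).trans h5⟩

lemma Gd_scale {Ω : Set (CSp N)} {p : CSp N} {d R : ℝ} (hR : 0 < R) (hp : p ∈ Ω) (hΩ : ∀ z ∈ Ω, ‖z‖ < R)
    (hb : ball p d ⊆ Ω) : Gd Ω p (d / (2 * R)) := by
  have hR2 : ((2 * R : ℝ) : ℂ) ≠ 0 := ofReal_ne_zero.2 (by positivity)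
  refine ⟨fun z => ((2 * R : ℝ) : ℂ)⁻¹ • (z - p), ?_, ?_, ?_, by simp, ?_⟩
  · have hdd : Differentiable ℂ (fun z : CSp N => z - p) := differentiable_id.sub_const p
    exact (hdd.const_smul (((2 * R : ℝ) : ℂ)⁻¹)).differentiableOn
  · intro z _ w _ h
    have := smul_right_injective (CSp N) (inv_ne_zero hR2) h
    simpa using this
  · rintro _ ⟨z, hz, rfl⟩
    rw [mem_ball_zero_iff, norm_smul, norm_inv, norm_real, Real.norm_of_nonneg (by positivity), inv_mul_lt_iff₀ (by positivity)]
    have := norm_sub_le z p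
    linarith [hΩ z hz, hΩ p hp]
  · intro y hy
    rw [mem_ball_zero_iff, lt_div_iff₀ (by positivity)] at hy
    refine ⟨p + ((2 * R : ℝ) : ℂ) • y, hb ?_, ?_⟩
    · rw [mem_ball, dist_eq_norm, add_sub_cancel_left, norm_smul, norm_real, Real.norm_of_nonneg (by positivity)]
      linarith
    · simp only [add_sub_cancel_left]
      rw [smul_smul, inv_mul_cancel₀ hR2, one_smul]

lemma lpo_en {P : (Fin N → ℂ) → ℝ} (hc : ContDiff ℝ ∞ P) {q : CSp N} {x : ℝ} (hq : lastC q = x) :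
    lpo (rh P) q en = ((2 * x : ℝ) : ℂ) := by
  apply Complex.ext
  · rw [lpo_re, fderiv_rh hc, en_last, en_init, hq]; simp
  · have e2 : (lpo (rh P) q en).im = (lpo (rh P) q ((-I) • en)).re := by rw [lpo_smul]; simp
    rw [e2, lpo_re, fderiv_rh hc, last_smul, init_smul, en_last, en_init, hq]; simp

lemma near {m : Fin N → ℕ} (hm : ∀ j, 0 < m j) {P : (Fin N → ℂ) → ℝ} (hP : IsWHP m P)
    (hPpos : ∀ z' : Fin N → ℂ, z' ≠ 0 → 0 < P z') (hP0 : ∀ z, 0 ≤ P z)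
    (hLv : ∀ z, z ≠ 0 → ∀ t, t ≠ 0 → 0 < Lv P z t) :
    ∃ s0 > 0, ∃ r0 > 0, ∀ (w : Fin N → ℂ) (x0 : ℝ), x0 ^ 2 + P w = 1 → 1 / 2 < x0 → x0 ≤ 3 / 4 → x0 - 1 / 2 ≤ s0 →
      Gd (DP P) (mkPt w (1 / 2)) r0 := by
  have hc := whp_cd hP
  have hnn := Lv_P_nonneg hc hLv
  have hcl : Continuous (lastC (N := N)) := lastC_cd.continuous
  set S : Set (CSp N) := {z | rh P z = 0 ∧ (lastC z).im = 0 ∧ 1 / 2 ≤ (lastC z).re ∧ (lastC z).re ≤ 3 / 4} with hSd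
  have hT := rh_cpt hm hP hPpos
  have hS : IsCompact S := by
    refine hT.of_isClosed_subset ?_ fun z hz => hz.1.le
    refine (isClosed_eq (rh_cd hc).continuous continuous_const).inter ?_
    refine (isClosed_eq (continuous_im.comp hcl) continuous_const).inter ?_
    exact (isClosed_le continuous_const (continuous_re.comp hcl)).inter (isClosed_le (continuous_re.comp hcl) continuous_const)
  have hpos : ∀ q ∈ S, ∀ t, t ≠ 0 → 0 < Lv (rh P) q t := by
    intro q hq t ht
    rw [Lv_rh hc]
    obtain ⟨h1, h2, h3, h4⟩ := hq
    by_cases hi : initC t = 0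
    · have hl : lastC t ≠ 0 := fun h0 => ht (pt_ext (hi.trans rfl) (h0.trans rfl))
      have := hnn (initC q) (initC t)
      have : 0 < ‖lastC t‖ := norm_pos_iff.2 hl
      positivity
    · have : initC q ≠ 0 := by
        intro h0
        rw [rh, h0, whp_zero hP, ← normSq_eq_norm_sq, normSq_apply, h2] at h1
        nlinarith
      have := hLv _ this _ hi
      positivity
  obtain ⟨k, hk, c, hc0, C, hC, δ, hδ, B, hB, H⟩ := peak_full (rh_cd hc)
    (fun x t => by rw [Lv_rh hc]; have := hnn (initC x) (initC t); positivity) hT hS (fun q hq => hq.1) hpos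
  obtain ⟨s0, hs0, r0, hr0, E⟩ := emb (N := N) hc0 hC hδ hB
  refine ⟨s0, hs0, r0, hr0, fun w x0 hw h1 h2 h3 => ?_⟩
  set q : CSp N := mkPt w x0 with hq
  have hql : lastC q = x0 := lastC_mk _ _
  have hqS : q ∈ S := by
    refine ⟨?_, ?_, ?_, ?_⟩
    · rw [rh, hql, hq, initC_mk, norm_real, Real.norm_eq_abs, sq_abs]; linarith
    · rw [hql, ofReal_im]
    · rw [hql, ofReal_re]; exact h1.le
    · rw [hql, ofReal_re]; exact h2
  have hp : q - ((x0 - 1 / 2 : ℝ) : ℂ) • en = mkPt w (1 / 2) := by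
    rw [sub_eq_add_neg, ← neg_smul]
    apply pt_ext
    · rw [init_add, init_smul, en_init, smul_zero, add_zero, hq, initC_mk, initC_mk]
    · rw [last_add, last_smul, en_last, hql, lastC_mk]; push_cast; ring
  have hpD : mkPt w (1 / 2 : ℂ) ∈ DP P := by
    rw [mem_DP, rh, lastC_mk, initC_mk]
    have : ‖(1 / 2 : ℂ)‖ = 1 / 2 := by norm_num
    rw [this]; nlinarith
  obtain ⟨h, g1, g2, g3, g4, g5, g6, g7, g8⟩ := H q hqS
  have := E P k (k * (2 * x0)) x0 q h (fun z hz => (last_lt hP0 hz).le) (by linarith) (by nlinarith) hql h1.le g1 g2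
    (by rw [g3, lpo_en hc hql]; push_cast; ring) g4 (fun z hz => g5 z (mem_DP.1 hz).le) (fun z hz => g6 z (mem_DP.1 hz).le) g7 g8
    (x0 - 1 / 2) (by linarith) h3 (by rw [hp]; exact hpD)
  rw [hp] at this
  exact this

lemma main_gd {m : Fin N → ℕ} (hm : ∀ j, 0 < m j) {P : (Fin N → ℂ) → ℝ} (hP : IsWHP m P)
    (hPpos : ∀ z' : Fin N → ℂ, z' ≠ 0 → 0 < P z') (hP0 : ∀ z, 0 ≤ P z)
    (hLv : ∀ z, z ≠ 0 → ∀ t, t ≠ 0 → 0 < Lv P z t) :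
    ∃ r > 0, ∀ p ∈ DP P, Gd (DP P) p r := by
  obtain ⟨s1, hs1, r0, hr0, H⟩ := near hm hP hPpos hP0 hLv
  have hcr := (rh_cd (whp_cd hP)).continuous
  set s0 := min s1 (1 / 4) with hs0d
  have hs0 : 0 < s0 := by positivity
  have hT := rh_cpt hm hP hPpos
  have hK : IsCompact {z : CSp N | rh P z ≤ -s0} :=
    hT.of_isClosed_subset (isClosed_le hcr continuous_const) fun z hz => (show rh P z ≤ 0 from le_trans hz (by linarith))
  have hDo : IsOpen (DP P) := by
    have : DP P = {z : CSp N | rh P z < 0} := by ext z; exact mem_DP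
    rw [this]; exact isOpen_lt hcr continuous_const
  obtain ⟨d, hd, hdK⟩ := hK.exists_thickening_subset_open hDo (fun z hz => mem_DP.2 (lt_of_le_of_lt hz (by linarith)))
  obtain ⟨R, hR, hTR⟩ := hT.isBounded.subset_ball_lt 0 0
  refine ⟨min r0 (d / (2 * R)), by positivity, fun p hp => Gd_red hP hP0 (fun w hw => ?_) hp⟩
  have hw' := mem_DP.1 hw
  rw [rh, lastC_mk, initC_mk] at hw'
  have e2 : ‖(1 / 2 : ℂ)‖ = 1 / 2 := by norm_num
  rw [e2] at hw'
  set x0 := Real.sqrt (1 - P w) with hx0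
  have hx : x0 ^ 2 = 1 - P w := Real.sq_sqrt (by linarith)
  have hx0' : 0 ≤ x0 := Real.sqrt_nonneg _
  have h1 : 1 / 2 < x0 := by by_contra h; push Not at h; nlinarith
  by_cases hs : x0 - 1 / 2 ≤ s0
  · refine Gd_mono (H w x0 (by linarith) h1 ?_ ?_) (min_le_left _ _)
    · linarith [min_le_right s1 (1 / 4 : ℝ)]
    · exact hs.trans (min_le_left _ _)
  · push Not at hs
    refine Gd_mono (Gd_scale hR hw (fun z hz => by simpa using hTR (mem_DP.1 hz).le) ((ball_subset_thickening ?_ d).trans hdK)) (min_le_right _ _)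
    show rh P _ ≤ -s0
    rw [rh, lastC_mk, initC_mk, e2]
    nlinarith

lemma final {m : Fin N → ℕ} (hm : ∀ j, 0 < m j) {P : (Fin N → ℂ) → ℝ} (hP : IsWHP m P)
    (hPpos : ∀ z' : Fin N → ℂ, z' ≠ 0 → 0 < P z')
    (hLv : ∀ z, z ≠ 0 → ∀ t, t ≠ 0 → 0 < Lv P z t) :
    0 < sInf (sqf (DP P) '' DP P) := by
  have hP0 : ∀ z, 0 ≤ P z := fun z => by
    by_cases h : z = 0
    · rw [h, whp_zero hP]
    · exact (hPpos z h).le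
  obtain ⟨r, hr, H⟩ := main_gd hm hP hPpos hP0 hLv
  have h0 : (0 : CSp N) ∈ DP P := by
    have e1 : lastC (0 : CSp N) = 0 := rfl
    have e2 : initC (0 : CSp N) = 0 := rfl
    rw [mem_DP, rh, e1, e2, whp_zero hP]; simp
  refine hr.trans_le (le_csInf (Set.Nonempty.image _ ⟨0, h0⟩) ?_)
  rintro _ ⟨p, hp, rfl⟩
  refine le_csSup ⟨1, ?_⟩ ⟨hr, H p hp⟩
  rintro x ⟨-, f, -, -, h3, -, h5⟩
  by_contra hx
  push Not at hx
  have := h3 (h5 (show (en : CSp N) ∈ ball 0 x by rw [mem_ball_zero_iff, en_norm]; exact hx))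
  rw [mem_ball_zero_iff, en_norm] at this
  exact lt_irrefl _ this

end Fin2

end PartG2

/-- Suppose every boundary point `q = (q', q_n)` of `D_P` with `q' ≠ 0` is strongly
pseudoconvex, in the sense that for `ρ(z) = |z_n|² + P(z') - 1` and every nonzero `t`
complex-tangent to `∂D_P` at `q` (i.e. `Dρ(q)(t) = 0` and `Dρ(q)(i t) = 0` for the real
Fréchet derivative `Dρ(q)`), the function `w ↦ ρ(q + w t)` of one complex variable has
strictly positive Laplacian at `w = 0`.  Then `D_P` is holomorphically homogeneous regular:
`inf_{z ∈ D_P} σ_{D_P}(z) > 0`. -/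
theorem stmt4 {N : ℕ} (hN : 1 ≤ N) (m : Fin N → ℕ) (hm : ∀ j, 0 < m j)
    (P : (Fin N → ℂ) → ℝ) (hP : IsWHP m P)
    (hPpos : ∀ z' : Fin N → ℂ, z' ≠ 0 → 0 < P z')
    (hWB : ∀ q ∈ frontier (DP P), initC q ≠ 0 → ∀ t : CSp N, t ≠ 0 →
      fderiv ℝ (fun z : CSp N => ‖lastC z‖ ^ 2 + P (initC z) - 1) q t = 0 →
      fderiv ℝ (fun z : CSp N => ‖lastC z‖ ^ 2 + P (initC z) - 1) q
        (Complex.I • t) = 0 →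
      0 < fderiv ℝ (fun w : ℂ => fderiv ℝ (fun u : ℂ =>
              ‖lastC (q + u • t)‖ ^ 2 + P (initC (q + u • t)) - 1) w 1) 0 1
        + fderiv ℝ (fun w : ℂ => fderiv ℝ (fun u : ℂ =>
              ‖lastC (q + u • t)‖ ^ 2 + P (initC (q + u • t)) - 1) w Complex.I) 0
            Complex.I) :
    0 < sInf (sqf (DP P) '' DP P) := by
  exact final hm hP hPpos (Lv_P_pos1 hP hPpos (fun z hz τ hτ h1 h2 => wb_use hP hWB z hz τ hτ h1 h2))
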